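/- arXiv:2207.12012 — 2 statements merged into one kernel-verified Lean document; each statement's English description precedes it below -/
import Mathlib

section
/- Let k be a field of characteristic 0 and g a Lie algebra over k. For every right U(g)-module M (equivalently, left module over the opposite algebra U(g)ᵐᵒᵖ) and every n ≥ 0, the n-th homology of the chain complex M ⊗_{U(g)} V•(g) is k-linearly isomorphic to Torₙ^{U(g)}(M, k), where k is the trivial left U(g)-module. In particular the homology of the homological Chevalley–Eilenberg complex CE•(g;M) := M ⊗_{U(g)} V•(g) computes the Lie algebra homology H•(g;M) = Tor•^{U(g)}(M, k). -/
/-!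
STATEMENT 4: for a Lie algebra `g` over a field `k` of characteristic `0` and a right
`U(g)`-module `M`, the `n`-th homology of the homological Chevalley–Eilenberg complex
`CE•(g;M) := M ⊗_{U(g)} V•(g)` is `k`-linearly isomorphic to `Torₙ^{U(g)}(M, k)` (where `k`
is the trivial `U(g)`-module given by the augmentation `ε`).

Since `Torₙ^{U(g)}(M, k)` is computed from an arbitrary projective resolution of `k` by left
`U(g)`-modules, the statement is formalized as: for every projective resolution
`⋯ → P₁ → P₀ →^{eP} k → 0` of the trivial module `k`, the homology of `M ⊗_{U(g)} V•(g)` is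
`k`-linearly isomorphic, in every degree `n ≥ 0`, to the homology of `M ⊗_{U(g)} P•`.

A right `U(g)`-module is a module over the opposite algebra `U(g)ᵐᵒᵖ`, and the balanced tensor
product `M ⊗_{U(g)} N` over the noncommutative algebra `U(g)` is realized as the quotient
`CoinvTensor` of `M ⊗[k] N` by the `k`-span of the elements `(m·a) ⊗ n − m ⊗ (a·n)`.  The
differentials `D`/`DP` of the resulting complexes are the maps induced on these quotients by
`id_M ⊗ d`/`id_M ⊗ dP` (hypothesized via their values on pure tensors), and homology in degree
`n` is `ker / im` as usual (degree `0` being a plain cokernel).  The Koszul differential `d` is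
pinned down by its standard defining formula `hd` on the generators `u ⊗ g₁∧⋯∧gₙ`
(`0`-indexed), with `d n : Vₙ₊₁(g) → Vₙ(g)`.
-/

open TensorProduct

set_option synthInstance.maxHeartbeats 1000000
set_option maxHeartbeats 1000000

/-- The index (in a tuple of length `n + 1`) of the `m`-th entry remaining after the entries in
positions `i < j` have been deleted. -/
def remove2Idx (i j m : ℕ) : ℕ :=
  if m < i then m else if m + 1 < j then m + 1 else m + 2

/-- Given a tuple `x = (x₀, …, xₙ)` of length `n + 1`, two indices `i < j`, and an element `a`,
this is the `n`-tuple `(a, x₀, …, x̂ᵢ, …, x̂ⱼ, …, xₙ)` (hats mean omitted entries). -/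
def consRemove2 {α : Type*} {n : ℕ} (a : α) (x : Fin (n + 1) → α) (i j : Fin (n + 1)) :
    Fin n → α := fun l =>
  if h : (l : ℕ) = 0 then a
  else
    x ⟨remove2Idx (i : ℕ) (j : ℕ) ((l : ℕ) - 1), by
      have h1 := l.isLt
      have h2 : 1 ≤ (l : ℕ) := Nat.one_le_iff_ne_zero.mpr h
      unfold remove2Idx
      split
      · omega
      · split <;> omega⟩

/-- The wedge `v₀ ∧ ⋯ ∧ vₙ₋₁` as an element of the `n`-th exterior power `⋀[k]^n V`. -/
noncomputable def wedge (k : Type*) [CommRing k] {V : Type*} [AddCommGroup V] [Module k V]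
    (n : ℕ) (v : Fin n → V) : ⋀[k]^n V :=
  ⟨ExteriorAlgebra.ιMulti k n v, ExteriorAlgebra.ιMulti_range k n ⟨v, rfl⟩⟩

section CoinvTensor

variable (k A M N : Type*) [CommRing k] [Ring A] [Algebra k A]
  [AddCommGroup M] [Module k M] [Module Aᵐᵒᵖ M]
  [AddCommGroup N] [Module k N] [Module A N]

/-- The submodule of relations defining the balanced tensor product `M ⊗[A] N` of a right
`A`-module `M` and a left `A`-module `N` over a (possibly noncommutative) `k`-algebra `A`. -/
def coinvRel : Submodule k (M ⊗[k] N) :=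
  Submodule.span k
    {z | ∃ (m : M) (a : A) (n : N), z = (MulOpposite.op a • m) ⊗ₜ[k] n - m ⊗ₜ[k] (a • n)}

/-- The balanced tensor product `M ⊗[A] N` over the (possibly noncommutative) `k`-algebra `A`,
realized as a quotient of `M ⊗[k] N` by the usual bilinearity relations. -/
def CoinvTensor : Type _ :=
  (M ⊗[k] N) ⧸ coinvRel k A M N

noncomputable instance : AddCommGroup (CoinvTensor k A M N) :=
  inferInstanceAs (AddCommGroup ((M ⊗[k] N) ⧸ coinvRel k A M N))

noncomputable instance : Module k (CoinvTensor k A M N) :=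
  inferInstanceAs (Module k ((M ⊗[k] N) ⧸ coinvRel k A M N))

/-- The canonical projection `M ⊗[k] N → M ⊗[A] N`. -/
def CoinvTensor.mk (x : M ⊗[k] N) : CoinvTensor k A M N :=
  Submodule.Quotient.mk x

end CoinvTensor

section PBW

attribute [local instance] LieRing.ofAssociativeRing
attribute [local instance] LieAlgebra.ofAssociativeAlgebra

/-- Number of inversions of a list. -/
def invCount {B : Type*} [LinearOrder B] : List B → ℕ
  | [] => 0
  | a :: l => l.countP (fun b => decide (b < a)) + invCount l

theorem invCount_swap {B : Type*} [LinearOrder B] (l1 : List B) (a b : B) (l2 : List B)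
    (h : b < a) : invCount (l1 ++ b :: a :: l2) < invCount (l1 ++ a :: b :: l2) := by
  induction l1 with
  | nil =>
    have h' : ¬ a < b := not_lt.mpr h.le
    simp [invCount, h, h']
    omega
  | cons c l1 ih =>
    have hp : List.Perm (l1 ++ b :: a :: l2) (l1 ++ a :: b :: l2) :=
      List.Perm.append_left _ (List.Perm.swap _ _ _)
    simp only [List.cons_append, invCount, hp.countP_eq]
    omega

theorem exists_descent {B : Type*} [LinearOrder B] (l : List B) (h : ¬ l.Pairwise (· ≤ ·)) :
    ∃ t : List B × B × B × List B, t.2.2.1 < t.2.1 ∧ l = t.1 ++ t.2.1 :: t.2.2.1 :: t.2.2.2 := by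
  induction l with
  | nil => simp at h
  | cons a l ih =>
    by_cases hl : l.Pairwise (· ≤ ·)
    · cases l with
      | nil => simp at h
      | cons b l =>
        refine ⟨([], a, b, l), ?_, rfl⟩
        by_contra hab
        simp only [not_lt] at hab
        apply h
        rw [List.pairwise_cons]
        refine ⟨fun c hc => ?_, hl⟩
        rw [List.pairwise_cons] at hl
        rcases List.mem_cons.1 hc with rfl | hc
        · exact hab
        · exact hab.trans (hl.1 c hc)
    · obtain ⟨⟨l1, c, d, l2⟩, h1, h2⟩ := ih hl
      exact ⟨(a :: l1, c, d, l2), h1, by simp [h2]⟩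

variable {k g : Type*} [Field k] [LieRing g] [LieAlgebra k g]
  {B : Type*} [LinearOrder B] (bas : Module.Basis B k g)
  {N : Type*} [AddCommGroup N] [Module k N]

open Classical in
/-- The normal form map on words. -/
noncomputable def pbwL (s : List B → N) (l : List B) : N :=
  if h : l.Pairwise (· ≤ ·) then s l
  else
    let t := (exists_descent l h).choose
    pbwL s (t.1 ++ t.2.2.1 :: t.2.1 :: t.2.2.2) +
      bas.constr k (fun c => pbwL s (t.1 ++ c :: t.2.2.2)) ⁅bas t.2.1, bas t.2.2.1⁆
termination_by (l.length, invCount l)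
decreasing_by
  · obtain ⟨h1, h2⟩ := (exists_descent l h).choose_spec
    have := invCount_swap t.1 _ _ t.2.2.2 h1
    rw [Prod.lex_def]
    right
    refine ⟨?_, lt_of_lt_of_eq this (congrArg invCount h2.symm)⟩
    refine Eq.trans ?_ (congrArg List.length h2.symm)
    simp [t]
  · obtain ⟨h1, h2⟩ := (exists_descent l h).choose_spec
    rw [Prod.lex_def]
    left
    refine lt_of_lt_of_eq ?_ (congrArg List.length h2.symm)
    simp [t]

/-- A function on words, extended linearly in one slot. -/
noncomputable def slot (f : List B → N) (l1 l2 : List B) : g →ₗ[k] N :=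
  bas.constr k (fun c => f (l1 ++ c :: l2))

theorem slot_basis (f : List B → N) (l1 l2 : List B) (c : B) :
    slot bas f l1 l2 (bas c) = f (l1 ++ c :: l2) := by
  simp [slot]

theorem pbwL_sorted (s : List B → N) (l : List B) (h : l.Pairwise (· ≤ ·)) :
    pbwL bas s l = s l := by
  rw [pbwL, dif_pos h]

theorem pbwL_step (s : List B → N) (l : List B) (h : ¬ l.Pairwise (· ≤ ·)) :
    ∃ l1 a b l2, b < a ∧ l = l1 ++ a :: b :: l2 ∧
      pbwL bas s l = pbwL bas s (l1 ++ b :: a :: l2) + slot bas (pbwL bas s) l1 l2 ⁅bas a, bas b⁆ := by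
  have ht := (exists_descent l h).choose_spec
  refine ⟨_, _, _, _, ht.1, ht.2, ?_⟩
  rw [pbwL, dif_neg h]
  rfl

theorem slot_slot (f : List B → N) (l1 l2 l3 : List B) (v w : g) :
    bas.constr k (fun c => slot bas f (l1 ++ c :: l2) l3 w) v =
      bas.constr k (fun d => slot bas f l1 (l2 ++ d :: l3) v) w := by
  let F1 : g →ₗ[k] g →ₗ[k] N := bas.constr k (fun c => slot bas f (l1 ++ c :: l2) l3)
  let F2 : g →ₗ[k] g →ₗ[k] N := bas.constr k (fun d => slot bas f l1 (l2 ++ d :: l3))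
  have h1 : ∀ v w, bas.constr k (fun c => slot bas f (l1 ++ c :: l2) l3 w) v = F1 v w := by
    intro v w
    have : bas.constr k (fun c => slot bas f (l1 ++ c :: l2) l3 w) = F1.flip w := by
      apply bas.ext; intro i; simp [F1]
    rw [this]; rfl
  have h2 : ∀ v w, bas.constr k (fun c => slot bas f l1 (l2 ++ c :: l3) w) v = F2 v w := by
    intro v w
    have : bas.constr k (fun c => slot bas f l1 (l2 ++ c :: l3) w) = F2.flip w := by
      apply bas.ext; intro i; simp [F2]
    rw [this]; rfl
  rw [h1, h2]
  have : F1 = F2.flip := by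
    apply bas.ext; intro i; apply bas.ext; intro j
    simp [F1, F2, slot]
  rw [this]; rfl

/-- The straightening relation at a place. -/
def RelAt (f : List B → N) (l1 : List B) (a b : B) (l2 : List B) : Prop :=
  f (l1 ++ a :: b :: l2) = f (l1 ++ b :: a :: l2) + slot bas f l1 l2 ⁅bas a, bas b⁆

theorem slot_rel_right (f : List B → N) (l1 : List B) (d : B) (l2 : List B)
    (H : ∀ c, RelAt bas f l1 c d l2) (v : g) :
    slot bas f l1 (d :: l2) v = slot bas f (l1 ++ [d]) l2 v + slot bas f l1 l2 ⁅v, bas d⁆ := by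
  have : slot bas f l1 (d :: l2) = slot bas f (l1 ++ [d]) l2 +
      slot bas f l1 l2 ∘ₗ (-(LieAlgebra.ad k g (bas d) : g →ₗ[k] g)) := by
    apply bas.ext; intro c
    have := H c
    unfold RelAt at this
    rw [LinearMap.add_apply, slot_basis, slot_basis, this, LinearMap.comp_apply,
      LinearMap.neg_apply, LieAlgebra.ad_apply, lie_skew]
    simp
  rw [this, LinearMap.add_apply, LinearMap.comp_apply, LinearMap.neg_apply, LieAlgebra.ad_apply,
    lie_skew]

theorem slot_rel_after (f : List B → N) (l1 l2 : List B) (c d : B) (l3 : List B)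
    (H : ∀ x, RelAt bas f (l1 ++ x :: l2) c d l3) (v : g) :
    slot bas f l1 (l2 ++ c :: d :: l3) v = slot bas f l1 (l2 ++ d :: c :: l3) v +
      bas.constr k (fun x => slot bas f (l1 ++ x :: l2) l3 ⁅bas c, bas d⁆) v := by
  have : slot bas f l1 (l2 ++ c :: d :: l3) = slot bas f l1 (l2 ++ d :: c :: l3) +
      bas.constr k (fun x => slot bas f (l1 ++ x :: l2) l3 ⁅bas c, bas d⁆) := by
    apply bas.ext; intro x
    have := H x
    unfold RelAt at this
    simp only [List.append_assoc, List.cons_append] at this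
    simp [slot_basis, this]
  rw [this]; rfl

theorem slot_rel_before (f : List B → N) (l1 l2 : List B) (a b : B) (l3 : List B)
    (H : ∀ x, RelAt bas f l1 a b (l2 ++ x :: l3)) (v : g) :
    slot bas f (l1 ++ a :: b :: l2) l3 v = slot bas f (l1 ++ b :: a :: l2) l3 v +
      bas.constr k (fun x => slot bas f l1 (l2 ++ x :: l3) ⁅bas a, bas b⁆) v := by
  have : slot bas f (l1 ++ a :: b :: l2) l3 = slot bas f (l1 ++ b :: a :: l2) l3 +
      bas.constr k (fun x => slot bas f l1 (l2 ++ x :: l3) ⁅bas a, bas b⁆) := by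
    apply bas.ext; intro x
    have := H x
    unfold RelAt at this
    simp [slot_basis, this]
  rw [this]; rfl

/-- Confluence for two overlapping or disjoint descents, the first being to the left. -/
theorem confl (f : List B → N) (l1 : List B) (a b : B) (l2 m1 : List B) (c d : B) (m2 : List B)
    (hba : b < a) (hdc : d < c) (heq : l1 ++ a :: b :: l2 = m1 ++ c :: d :: m2)
    (t : List B) (hm : m1 = l1 ++ t)
    (IH1 : ∀ p x y q, (p ++ x :: y :: q).length < (l1 ++ a :: b :: l2).length →
      RelAt bas f p x y q)
    (IH2 : ∀ p x y q, y < x → (p ++ x :: y :: q).length = (l1 ++ a :: b :: l2).length →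
      invCount (p ++ x :: y :: q) < invCount (l1 ++ a :: b :: l2) → RelAt bas f p x y q) :
    f (l1 ++ b :: a :: l2) + slot bas f l1 l2 ⁅bas a, bas b⁆ =
      f (m1 ++ d :: c :: m2) + slot bas f m1 m2 ⁅bas c, bas d⁆ := by
  subst hm
  rw [List.append_assoc, List.append_cancel_left_eq] at heq
  rcases t with _ | ⟨a', _ | ⟨b', t⟩⟩
  · simp only [List.nil_append, List.cons.injEq] at heq
    obtain ⟨rfl, rfl, rfl⟩ := heq
    simp
  · simp only [List.cons_append, List.nil_append, List.cons.injEq] at heq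
    obtain ⟨rfl, rfl, rfl⟩ := heq
    -- a > b > d, word  l1 a b d m2
    have hs1 := invCount_swap l1 a b (d :: m2) hba
    have hs2 := invCount_swap (l1 ++ [a]) b d m2 hdc
    simp only [List.append_assoc, List.cons_append, List.nil_append] at hs2
    have hs3 := invCount_swap (l1 ++ [b]) a d m2 (hdc.trans hba)
    simp only [List.append_assoc, List.cons_append, List.nil_append] at hs3
    have r1 := IH2 (l1 ++ [b]) a d m2 (hdc.trans hba) (by simp) (by simpa using hs1)
    have r2 := IH2 l1 b d (a :: m2) hdc (by simp) (by simpa using hs3.trans hs1)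
    have r3 := IH2 l1 a d (b :: m2) (hdc.trans hba) (by simp) (by simpa using hs2)
    have hs4 := invCount_swap l1 a d (b :: m2) (hdc.trans hba)
    have r4 := IH2 (l1 ++ [d]) a b m2 hba (by simp) (by simpa using hs4.trans hs2)
    unfold RelAt at r1 r2 r3 r4
    simp only [List.append_assoc, List.cons_append, List.nil_append] at r1 r2 r3 r4 ⊢
    rw [r1, r2, r3, r4]
    have e1 := slot_rel_right bas f l1 d m2 (fun c => IH1 _ _ _ _ (by simp)) ⁅bas a, bas b⁆
    have e2 := slot_rel_right bas f l1 b m2 (fun c => IH1 _ _ _ _ (by simp)) ⁅bas a, bas d⁆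
    have e3 := slot_rel_right bas f l1 a m2 (fun c => IH1 _ _ _ _ (by simp)) ⁅bas b, bas d⁆
    rw [e1, e2, e3]
    have J : ⁅⁅bas a, bas b⁆, bas d⁆ + ⁅⁅bas b, bas d⁆, bas a⁆ = ⁅⁅bas a, bas d⁆, bas b⁆ := by
      have := lie_jacobi (bas a) (bas b) (bas d)
      rw [← lie_skew ⁅bas a, bas b⁆, ← lie_skew ⁅bas b, bas d⁆, ← lie_skew ⁅bas a, bas d⁆,
        ← lie_skew (bas a) (bas d), lie_neg, neg_neg]
      rw [← sub_eq_zero, ← neg_eq_zero, ← this]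
      abel
    rw [← J, map_add]
    abel
  · simp only [List.cons_append, List.cons.injEq] at heq
    obtain ⟨rfl, rfl, rfl⟩ := heq
    have hs1 := invCount_swap l1 a b (t ++ c :: d :: m2) hba
    have hs2 := invCount_swap (l1 ++ a :: b :: t) c d m2 hdc
    simp only [List.append_assoc, List.cons_append, List.nil_append] at hs2
    have r1 := IH2 (l1 ++ b :: a :: t) c d m2 hdc (by simp) (by simpa using hs1)
    have r2 := IH2 l1 a b (t ++ d :: c :: m2) hba (by simp) (by simpa using hs2)
    unfold RelAt at r1 r2
    simp only [List.append_assoc, List.cons_append, List.nil_append] at r1 r2 ⊢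
    rw [r1, r2]
    rw [slot_rel_after bas f l1 t c d m2 (fun c => IH1 _ _ _ _ (by simp)),
      slot_rel_before bas f l1 t a b m2 (fun c => IH1 _ _ _ _ (by simp)), slot_slot]
    abel

theorem pbwL_rel_lt (s : List B → N) (n : ℕ) : ∀ (i : ℕ) (l1 : List B) (a b : B) (l2 : List B),
    b < a → (l1 ++ a :: b :: l2).length = n → invCount (l1 ++ a :: b :: l2) = i →
    RelAt bas (pbwL bas s) l1 a b l2 := by
  induction n using Nat.strong_induction_on with
  | _ n ihn =>
  intro i
  induction i using Nat.strong_induction_on with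
  | _ i ihi =>
  intro l1 a b l2 hba hn hi
  have hns : ¬ (l1 ++ a :: b :: l2).Pairwise (· ≤ ·) := by
    intro h
    rw [List.pairwise_append, List.pairwise_cons] at h
    exact absurd (h.2.1.1 b (by simp)) (not_le.mpr hba)
  obtain ⟨m1, c, d, m2, hdc, heq, hstep⟩ := pbwL_step bas s _ hns
  have IH1 : ∀ p x y q, (p ++ x :: y :: q).length < (l1 ++ a :: b :: l2).length →
      RelAt bas (pbwL bas s) p x y q := by
    intro p x y q hlt
    rcases lt_trichotomy y x with h | h | h
    · exact ihn _ (hn ▸ hlt) _ p x y q h rfl rfl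
    · subst h; simp [RelAt]
    · have := ihn _ (hn ▸ hlt) _ p y x q h (by simp) rfl
      unfold RelAt at this ⊢
      rw [this, ← lie_skew, map_neg]
      abel
  have IH2 : ∀ p x y q, y < x → (p ++ x :: y :: q).length = (l1 ++ a :: b :: l2).length →
      invCount (p ++ x :: y :: q) < invCount (l1 ++ a :: b :: l2) →
        RelAt bas (pbwL bas s) p x y q := by
    intro p x y q h hl hlt
    exact ihi _ (hi ▸ hlt) p x y q h (hl.trans hn) rfl
  unfold RelAt
  rw [hstep]
  rcases List.append_eq_append_iff.1 heq with ⟨t, h1, _⟩ | ⟨t, h1, _⟩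
  · exact (confl bas _ l1 a b l2 m1 c d m2 hba hdc heq t h1 IH1 IH2).symm
  · exact confl bas _ m1 c d m2 l1 a b l2 hdc hba heq.symm t h1 (heq ▸ IH1) (heq ▸ IH2)

theorem pbwL_rel (s : List B → N) (l1 : List B) (a b : B) (l2 : List B) :
    RelAt bas (pbwL bas s) l1 a b l2 := by
  rcases lt_trichotomy b a with h | h | h
  · exact pbwL_rel_lt bas s _ _ l1 a b l2 h rfl rfl
  · subst h; simp [RelAt]
  · have := pbwL_rel_lt bas s _ _ l1 b a l2 h rfl rfl
    unfold RelAt at this ⊢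
    rw [this, ← lie_skew, map_neg]
    abel

/-- Functions on words satisfying all straightening relations. -/
def relFun : Submodule k (List B → N) where
  carrier := {f | ∀ l1 a b l2, RelAt bas f l1 a b l2}
  zero_mem' := by
    intro l1 a b l2
    have : slot bas (0 : List B → N) l1 l2 = 0 := by
      apply bas.ext; intro c; simp [slot_basis]
    simp [RelAt, this]
  add_mem' := by
    intro f f' hf hf' l1 a b l2
    have : slot bas (f + f') l1 l2 = slot bas f l1 l2 + slot bas f' l1 l2 := by
      apply bas.ext; intro c; simp [slot_basis]
    have h1 := hf l1 a b l2
    have h2 := hf' l1 a b l2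
    unfold RelAt at h1 h2 ⊢
    simp only [Pi.add_apply, this, LinearMap.add_apply, h1, h2]
    abel
  smul_mem' := by
    intro r f hf l1 a b l2
    have : slot bas (r • f) l1 l2 = r • slot bas f l1 l2 := by
      apply bas.ext; intro c; simp [slot_basis]
    have h1 := hf l1 a b l2
    unfold RelAt at h1 ⊢
    simp only [Pi.smul_apply, this, LinearMap.smul_apply, h1, smul_add]

/-- Appending a letter on the right, extended linearly. -/
noncomputable def appendMap : g →ₗ[k] Module.End k (List B → N) :=
  LinearMap.mk₂ k (fun x f l => slot bas f l [] x)
    (by intro x y f; ext l; simp)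
    (by intro c x f; ext l; simp)
    (by
      intro x f f'; ext l
      have : slot bas (f + f') l [] = slot bas f l [] + slot bas f' l [] := by
        apply bas.ext; intro c; simp [slot_basis]
      simp [this])
    (by
      intro c x f; ext l
      have : slot bas (c • f) l [] = c • slot bas f l [] := by
        apply bas.ext; intro c; simp [slot_basis]
      simp [this])

theorem appendMap_apply (x : g) (f : List B → N) (l : List B) :
    appendMap bas x f l = slot bas f l [] x := rfl

theorem appendMap_mem (x : g) (f : List B → N) (hf : f ∈ relFun (N := N) bas) :
    appendMap bas x f ∈ relFun (N := N) bas := by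
  have hb : ∀ c, appendMap bas (bas c) f ∈ relFun (N := N) bas := by
    intro c l1 a b l2
    have h := hf l1 a b (l2 ++ [c])
    unfold RelAt at h ⊢
    have : slot bas (appendMap bas (bas c) f) l1 l2 = slot bas f l1 (l2 ++ [c]) := by
      apply bas.ext; intro c; simp [slot_basis, appendMap_apply]
    rw [this]
    simpa [appendMap_apply, slot_basis] using h
  have : (relFun (N := N) bas).comap ((appendMap bas).flip f) = ⊤ := by
    rw [eq_top_iff, ← bas.span_eq, Submodule.span_le]
    rintro _ ⟨c, rfl⟩
    exact hb c
  have h2 : x ∈ (relFun (N := N) bas).comap ((appendMap bas).flip f) := by rw [this]; trivial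
  exact h2

theorem appendMap_lie (x y : g) (f : List B → N) (hf : f ∈ relFun (N := N) bas) :
    appendMap bas ⁅x, y⁆ f =
      appendMap bas x (appendMap bas y f) - appendMap bas y (appendMap bas x f) := by
  let F1 : g →ₗ[k] g →ₗ[k] (List B → N) :=
    (LieModule.toEnd k g g : g →ₗ[k] Module.End k g).compr₂ ((appendMap bas).flip f)
  let G : g →ₗ[k] g →ₗ[k] (List B → N) :=
    ((appendMap (N := N) bas).flip.compr₂ (LinearMap.id)).comp ((appendMap bas).flip f)
  have hG : ∀ x y, G x y = appendMap bas y (appendMap bas x f) := fun x y => rfl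
  have hF : ∀ x y, F1 x y = appendMap bas ⁅x, y⁆ f := fun x y => rfl
  have : F1 = G.flip - G := by
    apply bas.ext; intro i; apply bas.ext; intro j
    simp only [LinearMap.sub_apply, LinearMap.flip_apply, hG, hF]
    ext l
    have h := hf l i j []
    unfold RelAt at h
    simp [appendMap_apply, slot_basis, h]
  rw [← hF, this]
  rfl

/-- The action of the Lie algebra on `relFun`. -/
noncomputable def relAct : g →ₗ⁅k⁆ Module.End k (relFun (N := N) bas) where
  toFun x := (appendMap bas x).restrict (fun f hf => appendMap_mem bas x f hf)
  map_add' x y := by ext f; simp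
  map_smul' c x := by ext f; simp
  map_lie' := by
    intro x y
    ext f l
    have := congrFun (appendMap_lie bas x y f.1 f.2) l
    rw [LieRing.of_associative_ring_bracket]
    simpa using this

/-- Existence form of PBW: any function on sorted words extends to a linear map on `U(g)`. -/
theorem pbw_exists (s : List B → N) : ∃ Φ : UniversalEnvelopingAlgebra k g →ₗ[k] N,
    (∀ l : List B, Φ ((l.map (fun b => UniversalEnvelopingAlgebra.ι k (bas b))).prod) =
      pbwL bas s l) := by
  let ρ := UniversalEnvelopingAlgebra.lift k (relAct (N := N) bas)
  let L0 : relFun (N := N) bas := ⟨pbwL bas s, pbwL_rel bas s⟩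
  let ev : relFun (N := N) bas →ₗ[k] N :=
    (LinearMap.proj (R := k) (φ := fun _ : List B => N) []).comp (relFun (N := N) bas).subtype
  refine ⟨ev.comp ((LinearMap.applyₗ L0).comp ρ.toLinearMap), fun l => ?_⟩
  have key : ∀ (l m : List B) (f : relFun (N := N) bas),
      (ρ ((l.map (fun b => UniversalEnvelopingAlgebra.ι k (bas b))).prod) f).1 m = f.1 (m ++ l) := by
    intro l
    induction l with
    | nil => intro m f; simp
    | cons a l ih =>
      intro m f
      simp only [List.map_cons, List.prod_cons, map_mul, Module.End.mul_apply]
      have : ρ (UniversalEnvelopingAlgebra.ι k (bas a)) = relAct bas (bas a) :=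
        UniversalEnvelopingAlgebra.lift_ι_apply' k _ _
      rw [this]
      change slot bas _ m [] (bas a) = _
      rw [slot_basis, Submodule.subtype_apply, ih]
      simp
  exact (key l [] L0)

end PBW

section Filtration

attribute [local instance] LieRing.ofAssociativeRing

variable {k g : Type*} [Field k] [LieRing g] [LieAlgebra k g]
  {B : Type*} (bas : Module.Basis B k g)

local notation "𝔘" => UniversalEnvelopingAlgebra k g

/-- The canonical map as a linear map. -/
noncomputable def ιl : g →ₗ[k] 𝔘 := ((UniversalEnvelopingAlgebra.ι k : g →ₗ⁅k⁆ 𝔘) : g →ₗ[k] 𝔘)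

@[simp] theorem ιl_apply (x : g) : ιl x = UniversalEnvelopingAlgebra.ι k x := rfl

/-- The product in `U(g)` of a word in the basis. -/
noncomputable def wprod (l : List B) : 𝔘 :=
  (l.map (fun b => UniversalEnvelopingAlgebra.ι k (bas b))).prod

theorem wprod_nil : wprod bas [] = 1 := rfl

theorem wprod_cons (a : B) (l : List B) :
    wprod bas (a :: l) = UniversalEnvelopingAlgebra.ι k (bas a) * wprod bas l := by
  simp [wprod]

theorem wprod_append (l l' : List B) :
    wprod bas (l ++ l') = wprod bas l * wprod bas l' := by
  simp [wprod]

theorem ι_lie (x y : g) : UniversalEnvelopingAlgebra.ι k ⁅x, y⁆ =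
    UniversalEnvelopingAlgebra.ι k x * UniversalEnvelopingAlgebra.ι k y -
      UniversalEnvelopingAlgebra.ι k y * UniversalEnvelopingAlgebra.ι k x := by
  rw [LieHom.map_lie, LieRing.of_associative_ring_bracket]

/-- The span of words of length less than `p`. -/
noncomputable def Wf (p : ℕ) : Submodule k 𝔘 :=
  Submodule.span k {u | ∃ l : List B, l.length < p ∧ u = wprod bas l}

theorem wprod_mem (l : List B) (p : ℕ) (h : l.length < p) : wprod bas l ∈ Wf bas p :=
  Submodule.subset_span ⟨l, h, rfl⟩

theorem Wf_zero : Wf bas 0 = ⊥ := by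
  simp [Wf]

theorem Wf_mono {p q : ℕ} (h : p ≤ q) : Wf bas p ≤ Wf bas q := by
  apply Submodule.span_mono
  rintro _ ⟨l, hl, rfl⟩
  exact ⟨l, hl.trans_le h, rfl⟩

/-- A linear map on `g` maps into a submodule as soon as the basis does. -/
theorem lin_mem {N : Type*} [AddCommGroup N] [Module k N] (S : Submodule k N) (φ : g →ₗ[k] N)
    (h : ∀ b, φ (bas b) ∈ S) (x : g) : φ x ∈ S := by
  have : S.comap φ = ⊤ := by
    rw [eq_top_iff, ← bas.span_eq, Submodule.span_le]
    rintro _ ⟨c, rfl⟩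
    exact h c
  have h2 : x ∈ S.comap φ := by rw [this]; trivial
  exact h2

theorem Wf_ind {N : Type*} [AddCommGroup N] [Module k N] (S : Submodule k N) (φ : 𝔘 →ₗ[k] N)
    (p : ℕ) (h : ∀ l : List B, l.length < p → φ (wprod bas l) ∈ S) (u : 𝔘) (hu : u ∈ Wf bas p) :
    φ u ∈ S := by
  have : Wf bas p ≤ S.comap φ := by
    rw [Wf, Submodule.span_le]
    rintro _ ⟨l, hl, rfl⟩
    exact h l hl
  exact this hu

theorem Wf_ι_mul (x : g) (p : ℕ) (u : 𝔘) (hu : u ∈ Wf bas p) :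
    UniversalEnvelopingAlgebra.ι k x * u ∈ Wf bas (p + 1) := by
  refine Wf_ind bas _ (LinearMap.mulLeft k (UniversalEnvelopingAlgebra.ι k x)) p ?_ u hu
  intro l hl
  refine lin_mem bas _ ((LinearMap.mulRight k (wprod bas l)).comp
    (ιl (k := k) (g := g))) ?_ x
  intro b
  have := wprod_mem bas (b :: l) (p + 1) (by simpa using hl)
  rwa [wprod_cons] at this

theorem Wf_mul_ι (x : g) (p : ℕ) (u : 𝔘) (hu : u ∈ Wf bas p) :
    u * UniversalEnvelopingAlgebra.ι k x ∈ Wf bas (p + 1) := by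
  refine Wf_ind bas _ (LinearMap.mulRight k (UniversalEnvelopingAlgebra.ι k x)) p ?_ u hu
  intro l hl
  refine lin_mem bas _ ((LinearMap.mulLeft k (wprod bas l)).comp
    (ιl (k := k) (g := g))) ?_ x
  intro b
  have := wprod_mem bas (l ++ [b]) (p + 1) (by simpa using hl)
  rw [wprod_append, wprod_cons, wprod_nil, mul_one] at this
  exact this

theorem wprod_comm_mem (x : g) (l : List B) :
    wprod bas l * UniversalEnvelopingAlgebra.ι k x - UniversalEnvelopingAlgebra.ι k x * wprod bas l
      ∈ Wf bas (l.length + 1) := by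
  induction l with
  | nil => simp [wprod_nil]
  | cons a l ih =>
    have e : wprod bas (a :: l) * UniversalEnvelopingAlgebra.ι k x -
        UniversalEnvelopingAlgebra.ι k x * wprod bas (a :: l) =
        UniversalEnvelopingAlgebra.ι k (bas a) * (wprod bas l * UniversalEnvelopingAlgebra.ι k x -
          UniversalEnvelopingAlgebra.ι k x * wprod bas l) +
        UniversalEnvelopingAlgebra.ι k ⁅bas a, x⁆ * wprod bas l := by
      rw [ι_lie, wprod_cons]
      noncomm_ring
    rw [e]
    exact Submodule.add_mem _ (Wf_ι_mul bas _ _ _ ih)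
      (Wf_ι_mul bas _ _ _ (wprod_mem bas l _ (by simp)))

theorem wprod_swap_mem (l1 : List B) (a b : B) (l2 : List B) :
    wprod bas (l1 ++ a :: b :: l2) - wprod bas (l1 ++ b :: a :: l2)
      ∈ Wf bas (l1.length + l2.length + 2) := by
  induction l1 with
  | nil =>
    have e : wprod bas ([] ++ a :: b :: l2) - wprod bas ([] ++ b :: a :: l2) =
        UniversalEnvelopingAlgebra.ι k ⁅bas a, bas b⁆ * wprod bas l2 := by
      simp only [List.nil_append, ι_lie, wprod_cons]
      noncomm_ring
    rw [e]
    exact Wf_mono bas (by simp) (Wf_ι_mul bas _ _ _ (wprod_mem bas l2 (l2.length + 1) (by simp)))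
  | cons c l1 ih =>
    simp only [List.cons_append, wprod_cons, ← mul_sub]
    exact Wf_mono bas (by simp only [List.length_cons]; omega) (Wf_ι_mul bas _ _ _ ih)

theorem Wf_exhaust (u : 𝔘) : ∃ p, u ∈ Wf bas p := by
  let S : Submodule k 𝔘 := ⨆ p, Wf bas p
  have hS : ∀ x, x ∈ S ↔ ∃ p, x ∈ Wf bas p := fun x =>
    Submodule.mem_iSup_of_directed _ (Monotone.directed_le (fun p q h => Wf_mono bas h))
  have key : ∀ t : TensorAlgebra k g, ∀ u ∈ S, UniversalEnvelopingAlgebra.mkAlgHom k g t * u ∈ S := by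
    intro t
    induction t using TensorAlgebra.induction with
    | algebraMap r =>
      intro u hu
      rw [AlgHom.commutes, ← Algebra.smul_def]
      exact S.smul_mem _ hu
    | ι x =>
      intro u hu
      rw [hS] at hu ⊢
      obtain ⟨p, hp⟩ := hu
      exact ⟨p + 1, Wf_ι_mul bas x p u hp⟩
    | mul a b ha hb =>
      intro u hu
      rw [map_mul, mul_assoc]
      exact ha _ (hb _ hu)
    | add a b ha hb =>
      intro u hu
      rw [map_add, add_mul]
      exact S.add_mem (ha _ hu) (hb _ hu)
  obtain ⟨t, rfl⟩ : ∃ t, UniversalEnvelopingAlgebra.mkAlgHom k g t = u :=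
    RingCon.mk'_surjective (c := UniversalEnvelopingAlgebra.ringCon k g) u
  rw [← hS]
  have h1 : (1 : 𝔘) ∈ S := (hS 1).2 ⟨1, wprod_mem bas [] 1 (by simp)⟩
  simpa using key t 1 h1

/-- The induced filtration on `U(g) ⊗ N`. -/
noncomputable def WT (N : Type*) [AddCommGroup N] [Module k N] (p : ℕ) : Submodule k (𝔘 ⊗[k] N) :=
  Submodule.span k {z | ∃ u ∈ Wf bas p, ∃ n : N, z = u ⊗ₜ[k] n}

variable {N : Type*} [AddCommGroup N] [Module k N]

theorem tmul_mem_WT {p : ℕ} {u : 𝔘} (hu : u ∈ Wf bas p) (n : N) : u ⊗ₜ[k] n ∈ WT bas N p :=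
  Submodule.subset_span ⟨u, hu, n, rfl⟩

theorem WT_zero : WT bas N 0 = ⊥ := by
  rw [eq_bot_iff, WT, Submodule.span_le]
  rintro _ ⟨u, hu, n, rfl⟩
  rw [Wf_zero] at hu
  simp only [Submodule.mem_bot] at hu
  simp [hu]

theorem WT_mono {p q : ℕ} (h : p ≤ q) : WT bas N p ≤ WT bas N q := by
  apply Submodule.span_mono
  rintro _ ⟨u, hu, n, rfl⟩
  exact ⟨u, Wf_mono bas h hu, n, rfl⟩

theorem WT_ind {N' : Type*} [AddCommGroup N'] [Module k N'] (S : Submodule k N')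
    (φ : 𝔘 ⊗[k] N →ₗ[k] N') (p : ℕ) (h : ∀ u ∈ Wf bas p, ∀ n : N, φ (u ⊗ₜ n) ∈ S)
    (z : 𝔘 ⊗[k] N) (hz : z ∈ WT bas N p) : φ z ∈ S := by
  have : WT bas N p ≤ S.comap φ := by
    rw [WT, Submodule.span_le]
    rintro _ ⟨u, hu, n, rfl⟩
    exact h u hu n
  exact this hz

theorem WT_exhaust (z : 𝔘 ⊗[k] N) : ∃ p, z ∈ WT bas N p := by
  induction z using TensorProduct.induction_on with
  | zero => exact ⟨0, Submodule.zero_mem _⟩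
  | tmul u n =>
    obtain ⟨p, hp⟩ := Wf_exhaust bas u
    exact ⟨p, tmul_mem_WT bas hp n⟩
  | add a b ha hb =>
    obtain ⟨p, hp⟩ := ha
    obtain ⟨q, hq⟩ := hb
    exact ⟨max p q, Submodule.add_mem _ (WT_mono bas (le_max_left _ _) hp)
      (WT_mono bas (le_max_right _ _) hq)⟩

/-- Right multiplication by `ι x` on `U(g) ⊗ N`. -/
noncomputable def Rm (x : g) : 𝔘 ⊗[k] N →ₗ[k] 𝔘 ⊗[k] N :=
  LinearMap.rTensor N (LinearMap.mulRight k (UniversalEnvelopingAlgebra.ι k x))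

@[simp] theorem Rm_tmul (x : g) (u : 𝔘) (n : N) :
    Rm (k := k) x (u ⊗ₜ[k] n) = (u * UniversalEnvelopingAlgebra.ι k x) ⊗ₜ[k] n := by
  simp [Rm]

theorem Rm_mem (x : g) (p : ℕ) (z : 𝔘 ⊗[k] N) (hz : z ∈ WT bas N p) :
    Rm x z ∈ WT bas N (p + 1) := by
  refine WT_ind bas _ (Rm x) p ?_ z hz
  intro u hu n
  rw [Rm_tmul]
  exact tmul_mem_WT bas (Wf_mul_ι bas x p u hu) n

theorem smul_mem_WT (x : g) (p : ℕ) (z : 𝔘 ⊗[k] N) (hz : z ∈ WT bas N p) :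
    UniversalEnvelopingAlgebra.ι k x • z ∈ WT bas N (p + 1) := by
  refine WT_ind bas _ (LinearMap.rTensor N (LinearMap.mulLeft k (UniversalEnvelopingAlgebra.ι k x)))
    p ?_ z hz
  intro u hu n
  exact tmul_mem_WT bas (Wf_ι_mul bas x p u hu) n

theorem Rm_smul (x : g) (u : 𝔘) (z : 𝔘 ⊗[k] N) : Rm x (u • z) = u • Rm x z := by
  induction z using TensorProduct.induction_on with
  | zero => simp
  | tmul v n => simp [TensorProduct.smul_tmul', mul_assoc]
  | add a b ha hb => rw [smul_add, map_add, ha, hb, map_add, smul_add]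

/-- The leading part of the derivation `δ` on words. -/
noncomputable def sδ : List B → 𝔘 ⊗[k] g
  | [] => 0
  | a :: l => wprod bas l ⊗ₜ[k] bas a + UniversalEnvelopingAlgebra.ι k (bas a) • sδ l

theorem sδ_append (l : List B) (c : B) :
    sδ bas (l ++ [c]) = Rm (bas c) (sδ bas l) + wprod bas l ⊗ₜ[k] bas c := by
  induction l with
  | nil => simp [sδ, wprod_nil]
  | cons a l ih =>
    simp only [List.cons_append, sδ, ih, map_add, Rm_tmul, Rm_smul, smul_add, wprod_append,
      wprod_cons, wprod_nil, mul_one, TensorProduct.smul_tmul', smul_eq_mul]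
    abel

theorem sδ_mem (l : List B) : sδ bas l ∈ WT bas g l.length := by
  induction l with
  | nil => simp [sδ]
  | cons a l ih =>
    exact Submodule.add_mem _ (tmul_mem_WT bas (wprod_mem bas l _ (by simp)) _)
      (smul_mem_WT bas _ _ _ ih)

theorem sδ_swap_mem (l1 : List B) (a b : B) (l2 : List B) :
    sδ bas (l1 ++ a :: b :: l2) - sδ bas (l1 ++ b :: a :: l2)
      ∈ WT bas g (l1.length + l2.length + 1) := by
  induction l1 with
  | nil =>
    have e : sδ bas ([] ++ a :: b :: l2) - sδ bas ([] ++ b :: a :: l2) =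
        UniversalEnvelopingAlgebra.ι k ⁅bas a, bas b⁆ • sδ bas l2 := by
      simp only [List.nil_append, sδ, wprod_cons, ι_lie, smul_add, sub_smul, mul_smul,
        TensorProduct.smul_tmul', smul_eq_mul]
      abel
    rw [e]
    exact WT_mono bas (by simp) (smul_mem_WT bas _ _ _ (sδ_mem bas l2))
  | cons c l1 ih =>
    have e : sδ bas (c :: l1 ++ a :: b :: l2) - sδ bas (c :: l1 ++ b :: a :: l2) =
        (wprod bas (l1 ++ a :: b :: l2) - wprod bas (l1 ++ b :: a :: l2)) ⊗ₜ[k] bas c +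
        UniversalEnvelopingAlgebra.ι k (bas c) •
          (sδ bas (l1 ++ a :: b :: l2) - sδ bas (l1 ++ b :: a :: l2)) := by
      simp only [List.cons_append, sδ, TensorProduct.sub_tmul, smul_sub]
      abel
    rw [e]
    have h := smul_mem_WT bas (bas c) _ _ ih
    refine Submodule.add_mem _ (WT_mono bas ?_ (tmul_mem_WT bas (wprod_swap_mem bas l1 a b l2) _))
      (WT_mono bas ?_ h)
    · simp only [List.length_cons]; omega
    · simp only [List.length_cons]; omega

/-- The multiplication map `U(g) ⊗ g → U(g)`. -/
noncomputable def μg : 𝔘 ⊗[k] g →ₗ[k] 𝔘 :=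
  TensorProduct.lift ((LinearMap.mul k 𝔘).compl₂ (ιl (k := k) (g := g)))

@[simp] theorem μg_tmul (u : 𝔘) (x : g) :
    μg (u ⊗ₜ[k] x) = u * UniversalEnvelopingAlgebra.ι k x := rfl

theorem μg_smul (u : 𝔘) (z : 𝔘 ⊗[k] g) : μg (u • z) = u * μg z := by
  induction z using TensorProduct.induction_on with
  | zero => simp
  | tmul v n => simp [TensorProduct.smul_tmul', mul_assoc]
  | add a b ha hb => rw [smul_add, map_add, ha, hb, map_add, mul_add]

theorem μg_mem (p : ℕ) (z : 𝔘 ⊗[k] g) (hz : z ∈ WT bas g p) : μg z ∈ Wf bas (p + 1) := by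
  refine WT_ind bas _ μg p ?_ z hz
  intro u hu x
  exact Wf_mul_ι bas x p u hu

theorem μg_sδ (l : List B) : μg (sδ bas l) - (l.length : k) • wprod bas l ∈ Wf bas l.length := by
  induction l with
  | nil => simp [sδ]
  | cons a l ih =>
    have e : μg (sδ bas (a :: l)) - ((a :: l).length : k) • wprod bas (a :: l) =
        (wprod bas l * UniversalEnvelopingAlgebra.ι k (bas a) -
          UniversalEnvelopingAlgebra.ι k (bas a) * wprod bas l) +
        UniversalEnvelopingAlgebra.ι k (bas a) *
          (μg (sδ bas l) - (l.length : k) • wprod bas l) := by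
      simp only [sδ, map_add, μg_tmul, μg_smul, wprod_cons, List.length_cons, Nat.cast_add,
        Nat.cast_one, add_smul, one_smul, mul_sub, mul_smul_comm]
      abel
    rw [e]
    exact Submodule.add_mem _ (wprod_comm_mem bas _ l) (Wf_ι_mul bas _ _ _ ih)

theorem slot_mem {N : Type*} [AddCommGroup N] [Module k N] (S : Submodule k N) (f : List B → N)
    (l1 l2 : List B) (h : ∀ c, f (l1 ++ c :: l2) ∈ S) (x : g) : slot bas f l1 l2 x ∈ S := by
  refine lin_mem bas S _ (fun b => ?_) x
  simpa [slot] using h b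

theorem pbwL_sδ [LinearOrder B] (n : ℕ) : ∀ (i : ℕ) (l : List B), l.length = n → invCount l = i →
    pbwL bas (sδ bas) l - sδ bas l ∈ WT bas g (l.length - 1) := by
  induction n using Nat.strong_induction_on with
  | _ n ihn =>
  intro i
  induction i using Nat.strong_induction_on with
  | _ i ihi =>
  intro l hn hi
  by_cases hs : l.Pairwise (· ≤ ·)
  · rw [pbwL_sorted bas _ l hs, sub_self]
    exact Submodule.zero_mem _
  · obtain ⟨l1, a, b, l2, hba, rfl, hstep⟩ := pbwL_step bas (sδ bas) l hs
    have hinv := invCount_swap l1 a b l2 hba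
    have h1 := ihi _ (hi ▸ hinv) (l1 ++ b :: a :: l2) (by simpa using hn) rfl
    have h2 := sδ_swap_mem bas l1 a b l2
    have h3 : ∀ c, pbwL bas (sδ bas) (l1 ++ c :: l2) ∈ WT bas g (l1.length + l2.length + 1) := by
      intro c
      have := ihn (l1 ++ c :: l2).length (by rw [← hn]; simp) _ (l1 ++ c :: l2) rfl rfl
      have h4 := sδ_mem bas (l1 ++ c :: l2)
      have h5 := Submodule.add_mem _ (WT_mono bas (Nat.sub_le _ _) this) h4
      rw [sub_add_cancel] at h5
      exact WT_mono bas (by simp; omega) h5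
    have h4 := slot_mem bas _ _ l1 l2 h3 ⁅bas a, bas b⁆
    have hl : (l1 ++ a :: b :: l2).length - 1 = l1.length + l2.length + 1 := by simp; omega
    have hl' : (l1 ++ b :: a :: l2).length - 1 = l1.length + l2.length + 1 := by simp; omega
    rw [hl'] at h1
    rw [hl, hstep]
    have := Submodule.add_mem _ (Submodule.sub_mem _ h1 h2) h4
    convert this using 1
    abel

theorem exists_δ : ∃ δ : 𝔘 →ₗ[k] 𝔘 ⊗[k] g,
    (∀ p u, u ∈ Wf bas (p + 1) → δ u ∈ WT bas g p) ∧
    (∀ p u, u ∈ Wf bas (p + 1) → ∀ x,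
      δ (u * UniversalEnvelopingAlgebra.ι k x) - Rm x (δ u) - u ⊗ₜ[k] x ∈ WT bas g p) ∧
    (∀ p u, u ∈ Wf bas (p + 1) → μg (δ u) - (p : k) • u ∈ Wf bas p) := by
  let _ : LinearOrder B := IsWellOrder.linearOrder WellOrderingRel
  obtain ⟨δ, hδ'⟩ := pbw_exists bas (sδ bas)
  have hδ : ∀ l, δ (wprod bas l) = pbwL bas (sδ bas) l := hδ'
  have hA : ∀ l, δ (wprod bas l) - sδ bas l ∈ WT bas g (l.length - 1) := fun l => by
    rw [hδ]; exact pbwL_sδ bas _ _ l rfl rfl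
  have hB : ∀ l, δ (wprod bas l) ∈ WT bas g l.length := fun l => by
    have := Submodule.add_mem _ (WT_mono bas (Nat.sub_le _ _) (hA l)) (sδ_mem bas l)
    rwa [sub_add_cancel] at this
  have h1 : ∀ p u, u ∈ Wf bas (p + 1) → δ u ∈ WT bas g p := by
    intro p u hu
    refine Wf_ind bas _ δ (p + 1) (fun l hl => ?_) u hu
    exact WT_mono bas (by omega) (hB l)
  refine ⟨δ, h1, ?_, ?_⟩
  · intro p u hu x
    let φ : 𝔘 →ₗ[k] 𝔘 ⊗[k] g :=
      δ.comp (LinearMap.mulRight k (UniversalEnvelopingAlgebra.ι k x)) - (Rm x).comp δ -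
        (TensorProduct.mk k 𝔘 g).flip x
    refine Wf_ind bas _ φ (p + 1) (fun l hl => ?_) u hu
    let ψ : g →ₗ[k] 𝔘 ⊗[k] g :=
      δ.comp ((LinearMap.mulLeft k (wprod bas l)).comp (ιl (k := k) (g := g))) -
        ((LinearMap.rTensorHom g).comp ((LinearMap.mul k 𝔘).flip.comp
          (ιl (k := k) (g := g)))).flip (δ (wprod bas l)) - TensorProduct.mk k 𝔘 g (wprod bas l)
    refine lin_mem bas _ ψ (fun c => ?_) x
    change δ (wprod bas l * UniversalEnvelopingAlgebra.ι k (bas c)) - Rm (bas c) (δ (wprod bas l)) -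
      wprod bas l ⊗ₜ[k] bas c ∈ WT bas g p
    have h2 := hA (l ++ [c])
    rw [sδ_append, wprod_append, wprod_cons, wprod_nil, mul_one, List.length_append,
      List.length_singleton, Nat.add_sub_cancel] at h2
    have h3 : Rm (bas c) (δ (wprod bas l) - sδ bas l) ∈ WT bas g l.length := by
      rcases Nat.eq_zero_or_pos l.length with h0 | h0
      · have := hA l
        rw [h0, WT_zero, Submodule.mem_bot] at this
        rw [this, map_zero]; exact Submodule.zero_mem _
      · have := Rm_mem bas (bas c) _ _ (hA l)
        rwa [Nat.sub_add_cancel h0] at this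
    have h4 := WT_mono bas (Nat.lt_succ_iff.1 hl) (Submodule.sub_mem _ h2 h3)
    rw [map_sub] at h4
    convert h4 using 1
    abel
  · intro p u hu
    refine Wf_ind bas _ (μg.comp δ - (p : k) • LinearMap.id) (p + 1) (fun l hl => ?_) u hu
    simp only [LinearMap.sub_apply, LinearMap.comp_apply, LinearMap.smul_apply, LinearMap.id_apply]
    rcases Nat.lt_succ_iff_lt_or_eq.1 hl with h | h
    · refine Submodule.sub_mem _ (Wf_mono bas h (μg_mem bas _ _ (hB l))) 
        (Submodule.smul_mem _ _ (wprod_mem bas l p h))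
    · subst h
      have h2 : μg (δ (wprod bas l) - sδ bas l) ∈ Wf bas l.length := by
        rcases Nat.eq_zero_or_pos l.length with h0 | h0
        · have := hA l
          rw [h0, WT_zero, Submodule.mem_bot] at this
          rw [this, map_zero]; exact Submodule.zero_mem _
        · have := μg_mem bas _ _ (hA l)
          rwa [Nat.sub_add_cancel h0] at this
      have := Submodule.add_mem _ h2 (μg_sδ bas l)
      rw [map_sub] at this
      convert this using 1
      abel

end Filtration

section Exterior

variable {k g : Type*} [Field k] [LieRing g] [LieAlgebra k g]

/-- Left wedge multiplication. -/
noncomputable def eg (n : ℕ) : g →ₗ[k] (⋀[k]^n g) →ₗ[k] (⋀[k]^(n + 1) g) :=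
  LinearMap.mk₂ k (fun x w => ⟨ExteriorAlgebra.ι k x * (w : ExteriorAlgebra k g), by
      show _ ∈ (LinearMap.range (ExteriorAlgebra.ι k)) ^ (n + 1)
      rw [pow_succ']
      exact Submodule.mul_mem_mul ⟨x, rfl⟩ w.2⟩)
    (by intro x y w; ext; simp [add_mul])
    (by intro c x w; ext; simp)
    (by intro x w w'; ext; simp [mul_add])
    (by intro c x w; ext; simp)

theorem eg_coe (n : ℕ) (x : g) (w : ⋀[k]^n g) :
    ((eg n x w : ⋀[k]^(n + 1) g) : ExteriorAlgebra k g) = ExteriorAlgebra.ι k x * w := rfl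

theorem eg_self (n : ℕ) (x : g) (w : ⋀[k]^n g) : eg (n + 1) x (eg n x w) = 0 := by
  ext
  simp [eg_coe, ← mul_assoc]

theorem eg_anti (n : ℕ) (x y : g) (w : ⋀[k]^n g) :
    eg (n + 1) x (eg n y w) = - eg (n + 1) y (eg n x w) := by
  have h := eg_self n (x + y) w
  simp only [map_add, LinearMap.add_apply, eg_self, zero_add, add_zero] at h
  rw [eq_neg_iff_add_eq_zero, ← h]
  first | rfl | exact add_comm _ _

theorem wedge_cons (n : ℕ) (x : g) (v : Fin n → g) :
    wedge k (n + 1) (Fin.cons x v : Fin (n + 1) → g) = eg n x (wedge k n v) := by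
  ext
  rw [eg_coe]
  simp only [wedge]
  rw [ExteriorAlgebra.ιMulti_succ_apply]
  rfl

theorem wedge_span (n : ℕ) : Submodule.span k (Set.range (wedge k n (V := g))) = ⊤ :=
  exteriorPower.ιMulti_span k n g

theorem ext_top_le (n : ℕ) (S : Submodule k (⋀[k]^n g)) (h : ∀ v, wedge k n v ∈ S) :
    ∀ w, w ∈ S := by
  intro w
  have : w ∈ Submodule.span k (Set.range (wedge k n (V := g))) := by rw [wedge_span]; trivial
  refine (Submodule.span_le.2 ?_) this
  rintro _ ⟨v, rfl⟩
  exact h v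

theorem ext_succ_ind (n : ℕ) (S : Submodule k (⋀[k]^(n + 1) g)) (h : ∀ x w, eg n x w ∈ S) :
    ∀ w, w ∈ S := by
  refine ext_top_le _ S (fun v => ?_)
  rw [← Fin.cons_self_tail v, wedge_cons]
  exact h _ _

/-- Auxiliary bilinear map for the adjoint action. -/
noncomputable def adAux (x : g) :
    g →ₗ[k] (ExteriorAlgebra k g × ExteriorAlgebra k g) →ₗ[k] ExteriorAlgebra k g :=
  LinearMap.mk₂ k (fun y p => ExteriorAlgebra.ι k ⁅x, y⁆ * p.1 + ExteriorAlgebra.ι k y * p.2)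
    (by intro y y' p; simp [add_mul]; abel)
    (by intro c y p; simp)
    (by intro y p p'; simp [mul_add]; abel)
    (by intro c y p; simp)

/-- The adjoint action on the exterior algebra. -/
noncomputable def adE (x : g) : ExteriorAlgebra k g →ₗ[k] ExteriorAlgebra k g :=
  CliffordAlgebra.foldr' (0 : QuadraticForm k g) (adAux x) (by
    intro y w n
    have h1 : ExteriorAlgebra.ι k y * ExteriorAlgebra.ι k y = 0 := ExteriorAlgebra.ι_sq_zero y
    have h2 : ExteriorAlgebra.ι k ⁅x, y⁆ * ExteriorAlgebra.ι k y +
      ExteriorAlgebra.ι k y * ExteriorAlgebra.ι k ⁅x, y⁆ = 0 := ExteriorAlgebra.ι_add_mul_swap _ _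
    change ExteriorAlgebra.ι k ⁅x, y⁆ * (ExteriorAlgebra.ι k y * w) + ExteriorAlgebra.ι k y *
      (ExteriorAlgebra.ι k ⁅x, y⁆ * w + ExteriorAlgebra.ι k y * n) = _
    rw [mul_add, ← mul_assoc, ← mul_assoc, ← mul_assoc, h1, ← add_assoc, ← add_mul, h2]
    simp) 0

theorem adE_ι_mul (x y : g) (w : ExteriorAlgebra k g) :
    adE x (ExteriorAlgebra.ι k y * w) =
      ExteriorAlgebra.ι k ⁅x, y⁆ * w + ExteriorAlgebra.ι k y * adE x w :=
  CliffordAlgebra.foldr'_ι_mul _ _ _ _ _ _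

theorem adE_wedge_mem (x : g) (n : ℕ) (v : Fin n → g) :
    adE x (wedge k n v : ExteriorAlgebra k g) ∈ ⋀[k]^n g := by
  induction n with
  | zero =>
    have : (wedge k 0 v : ExteriorAlgebra k g) = algebraMap k _ 1 := by
      simp [wedge]
    rw [this]
    have h : adE x (algebraMap k (ExteriorAlgebra k g) 1) = (1 : k) • (0 : ExteriorAlgebra k g) :=
      CliffordAlgebra.foldr'_algebraMap _ _ _ _ _
    rw [h, smul_zero]
    exact Submodule.zero_mem _
  | succ n ih =>
    rw [← Fin.cons_self_tail v, wedge_cons, eg_coe, adE_ι_mul]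
    exact Submodule.add_mem _ (eg n ⁅x, v 0⁆ (wedge k n (Fin.tail v))).2
      (eg n (v 0) ⟨_, ih (Fin.tail v)⟩).2

theorem adE_mem (x : g) (n : ℕ) (w : ⋀[k]^n g) : adE x (w : ExteriorAlgebra k g) ∈ ⋀[k]^n g :=
  ext_top_le n ((⋀[k]^n g).comap ((adE x).comp (⋀[k]^n g).subtype)) (adE_wedge_mem x n) w

/-- The adjoint action on the exterior powers. -/
noncomputable def adg (n : ℕ) (x : g) : (⋀[k]^n g) →ₗ[k] (⋀[k]^n g) :=
  ((adE x).comp (⋀[k]^n g).subtype).codRestrict _ (adE_mem x n)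

theorem adg_coe (n : ℕ) (x : g) (w : ⋀[k]^n g) :
    (adg n x w : ExteriorAlgebra k g) = adE x w := rfl

theorem adg_eg (n : ℕ) (x y : g) (w : ⋀[k]^n g) :
    adg (n + 1) x (eg n y w) = eg n ⁅x, y⁆ w + eg n y (adg n x w) := by
  ext
  simp [adg_coe, eg_coe, adE_ι_mul]

theorem adg_zero (x : g) : adg (k := k) 0 x = 0 := by
  refine LinearMap.ext fun w => ?_
  have := ext_top_le 0 (LinearMap.ker (adg (k := k) 0 x)) (fun v => by
    rw [LinearMap.mem_ker]
    ext
    rw [adg_coe]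
    have : (wedge k 0 v : ExteriorAlgebra k g) = algebraMap k _ 1 := by
      simp [wedge]
    rw [this]
    have h : adE x (algebraMap k (ExteriorAlgebra k g) 1) = (1 : k) • (0 : ExteriorAlgebra k g) :=
      CliffordAlgebra.foldr'_algebraMap _ _ _ _ _
    rw [h, smul_zero]; rfl) w
  rw [LinearMap.mem_ker] at this
  rw [this]
  rfl

theorem adg_lie (n : ℕ) (x y : g) (w : ⋀[k]^n g) :
    adg n ⁅x, y⁆ w = adg n x (adg n y w) - adg n y (adg n x w) := by
  induction n with
  | zero => simp [adg_zero]
  | succ n ih =>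
    have := ext_succ_ind n (LinearMap.ker (adg (n + 1) ⁅x, y⁆ - ((adg (n + 1) x).comp (adg (n + 1) y)
      - (adg (n + 1) y).comp (adg (n + 1) x)))) (fun z w => by
        simp only [LinearMap.mem_ker, LinearMap.sub_apply, LinearMap.comp_apply, adg_eg, map_add, ih,
          lie_lie, map_sub]
        abel) w
    rwa [LinearMap.mem_ker, LinearMap.sub_apply, sub_eq_zero] at this

theorem adg_wedge (n : ℕ) (x : g) (v : Fin (n + 1) → g) :
    adg (n + 1) x (wedge k (n + 1) v) =
      ∑ j : Fin (n + 1), ((-1 : k) ^ (j : ℕ)) • eg n ⁅x, v j⁆ (wedge k n (v ∘ j.succAbove)) := by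
  induction n with
  | zero =>
    rw [← Fin.cons_self_tail v, wedge_cons, adg_eg, adg_zero]
    simp
    rfl
  | succ n ih =>
    obtain ⟨y, v, rfl⟩ : ∃ y v', v = Fin.cons y v' := ⟨v 0, Fin.tail v, (Fin.cons_self_tail v).symm⟩
    rw [wedge_cons, adg_eg, ih]
    conv_rhs => rw [Fin.sum_univ_succ]
    have e0 : (Fin.cons y v : Fin (n + 2) → g) ∘ (0 : Fin (n + 2)).succAbove = v := by
      ext i; simp
    have e1 : ∀ j : Fin (n + 1), (Fin.cons y v : Fin (n + 2) → g) ∘ j.succ.succAbove =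
        Fin.cons y (v ∘ j.succAbove) := by
      intro j; ext i
      cases i using Fin.cases <;> simp
    simp only [e0, e1, wedge_cons, map_sum, map_smul, Fin.cons_zero, Fin.cons_succ, Fin.val_zero,
      pow_zero, one_smul, Fin.val_succ, pow_succ, mul_neg, mul_one, neg_smul]
    congr 1
    refine Finset.sum_congr rfl (fun j _ => ?_)
    rw [eg_anti, smul_neg]
    exact (neg_smul _ _).symm

theorem consRemove2_zero {n : ℕ} (a x : g) (v : Fin (n + 1) → g) (j : Fin (n + 1)) :
    consRemove2 a (Fin.cons x v : Fin (n + 2) → g) 0 j.succ =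
      (Fin.cons a (v ∘ j.succAbove) : Fin (n + 1) → g) := by
  funext l
  cases l using Fin.cases with
  | zero => simp [consRemove2]
  | succ l =>
    simp only [consRemove2, Fin.val_succ, Nat.add_eq_zero_iff, one_ne_zero, and_false, dite_false,
      Fin.cons_succ, Function.comp_apply]
    have : (⟨remove2Idx ((0 : Fin (n + 2)) : ℕ) ((j : ℕ) + 1) ((l : ℕ) + 1 - 1), by
        unfold remove2Idx; have := l.isLt; simp; split <;> omega⟩ : Fin (n + 2)) =
        (j.succAbove l).succ := by
      ext
      simp only [remove2Idx, Fin.succAbove, Fin.lt_def]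
      simp
      split <;> simp
    rw [this, Fin.cons_succ]

theorem consRemove2_succ {m : ℕ} (a x : g) (v : Fin (m + 2) → g) (i j : Fin (m + 2)) :
    ∃ r : Fin m → g, consRemove2 a (Fin.cons x v : Fin (m + 3) → g) i.succ j.succ =
      (Fin.cons a (Fin.cons x r : Fin (m + 1) → g) : Fin (m + 2) → g) ∧
      consRemove2 a v i j = (Fin.cons a r : Fin (m + 1) → g) := by
  refine ⟨Fin.tail (consRemove2 a v i j), ?_, ?_⟩
  · funext l
    cases l using Fin.cases with
    | zero => simp [consRemove2]
    | succ l =>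
      cases l using Fin.cases with
      | zero =>
        simp only [consRemove2, Fin.val_succ, Fin.cons_succ, Fin.cons_zero]
        simp [remove2Idx]
      | succ l =>
        simp only [consRemove2, Fin.val_succ, Fin.cons_succ, Fin.tail]
        simp only [Nat.add_eq_zero_iff, one_ne_zero, and_false, dite_false]
        have : (⟨remove2Idx ((i : ℕ) + 1) ((j : ℕ) + 1) ((l : ℕ) + 1 + 1 - 1), by
            unfold remove2Idx; have := l.isLt; split
            · omega
            · split <;> omega⟩ : Fin (m + 3)) =
            Fin.succ ⟨remove2Idx (i : ℕ) (j : ℕ) ((l : ℕ) + 1 - 1), by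
              unfold remove2Idx; have := l.isLt; split
              · omega
              · split <;> omega⟩ := by
          ext
          simp only [remove2Idx, Fin.val_succ]
          simp
          split
          · rfl
          · split <;> rfl
        rw [this, Fin.cons_succ]
  · rw [← Fin.cons_self_tail (consRemove2 a v i j)]
    congr 1

end Exterior


section Koszul

attribute [local instance] LieRing.ofAssociativeRing

variable {k g : Type*} [Field k] [LieRing g] [LieAlgebra k g]

local notation "𝔘" => UniversalEnvelopingAlgebra k g

/-- Left wedge multiplication on the Koszul complex. -/
noncomputable def EE (n : ℕ) (x : g) : 𝔘 ⊗[k] (⋀[k]^n g) →ₗ[k] 𝔘 ⊗[k] (⋀[k]^(n + 1) g) :=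
  LinearMap.lTensor 𝔘 (eg n x)

@[simp] theorem EE_tmul (n : ℕ) (x : g) (u : 𝔘) (w : ⋀[k]^n g) :
    EE n x (u ⊗ₜ[k] w) = u ⊗ₜ[k] eg n x w := rfl

/-- The action commuting with the differential. -/
noncomputable def th (n : ℕ) (x : g) : 𝔘 ⊗[k] (⋀[k]^n g) →ₗ[k] 𝔘 ⊗[k] (⋀[k]^n g) :=
  Rm x - LinearMap.lTensor 𝔘 (adg n x)

@[simp] theorem th_tmul (n : ℕ) (x : g) (u : 𝔘) (w : ⋀[k]^n g) :
    th n x (u ⊗ₜ[k] w) =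
      (u * UniversalEnvelopingAlgebra.ι k x) ⊗ₜ[k] w - u ⊗ₜ[k] adg n x w := by
  simp [th]

theorem kz_mem {N : Type*} [AddCommGroup N] [Module k N] (n : ℕ) (S : Submodule k N)
    (φ : 𝔘 ⊗[k] (⋀[k]^n g) →ₗ[k] N) (h : ∀ u v, φ (u ⊗ₜ[k] wedge k n v) ∈ S) (z) : φ z ∈ S := by
  induction z using TensorProduct.induction_on with
  | zero => rw [map_zero]; exact S.zero_mem
  | tmul u w => exact ext_top_le n (S.comap (φ.comp (TensorProduct.mk k 𝔘 _ u))) (h u) w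
  | add a b ha hb => rw [map_add]; exact S.add_mem ha hb

theorem kz_succ_mem {N : Type*} [AddCommGroup N] [Module k N] (n : ℕ) (S : Submodule k N)
    (φ : 𝔘 ⊗[k] (⋀[k]^(n + 1) g) →ₗ[k] N) (h : ∀ x z, φ (EE n x z) ∈ S) (z) : φ z ∈ S := by
  refine kz_mem (n + 1) S φ (fun u v => ?_) z
  rw [← Fin.cons_self_tail v, wedge_cons]
  exact h (v 0) (u ⊗ₜ wedge k n (Fin.tail v))

theorem kz_ext {N : Type*} [AddCommGroup N] [Module k N] (n : ℕ)
    (φ ψ : 𝔘 ⊗[k] (⋀[k]^n g) →ₗ[k] N)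
    (h : ∀ u v, φ (u ⊗ₜ[k] wedge k n v) = ψ (u ⊗ₜ[k] wedge k n v)) (z) : φ z = ψ z := by
  have := kz_mem n ⊥ (φ - ψ) (fun u v => by
    rw [Submodule.mem_bot, LinearMap.sub_apply, h, sub_self]) z
  rwa [Submodule.mem_bot, LinearMap.sub_apply, sub_eq_zero] at this

theorem kz_succ_ext {N : Type*} [AddCommGroup N] [Module k N] (n : ℕ)
    (φ ψ : 𝔘 ⊗[k] (⋀[k]^(n + 1) g) →ₗ[k] N)
    (h : ∀ x z, φ (EE n x z) = ψ (EE n x z)) (z) : φ z = ψ z := by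
  have := kz_succ_mem n ⊥ (φ - ψ) (fun u v => by
    rw [Submodule.mem_bot, LinearMap.sub_apply, h, sub_self]) z
  rwa [Submodule.mem_bot, LinearMap.sub_apply, sub_eq_zero] at this

theorem tp_ext {N N' : Type*} [AddCommGroup N] [Module k N] [AddCommGroup N'] [Module k N']
    (φ ψ : 𝔘 ⊗[k] N →ₗ[k] N')
    (h : ∀ u w, φ (u ⊗ₜ[k] w) = ψ (u ⊗ₜ[k] w)) (z) : φ z = ψ z := by
  have : φ = ψ := TensorProduct.ext' h
  rw [this]

/-- The Koszul differential, described by its defining formula. -/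
def IsKoszul (d : ∀ n : ℕ, (𝔘 ⊗[k] ⋀[k]^(n + 1) g) →ₗ[𝔘] (𝔘 ⊗[k] ⋀[k]^n g)) : Prop :=
  ∀ (n : ℕ) (u : 𝔘) (v : Fin (n + 1) → g),
      d n (u ⊗ₜ[k] wedge k (n + 1) v) =
        (∑ i : Fin (n + 1),
            ((-1 : k) ^ (i : ℕ)) •
              ((u * UniversalEnvelopingAlgebra.ι k (v i)) ⊗ₜ[k] wedge k n (v ∘ i.succAbove))) +
          ∑ p : Fin (n + 1) × Fin (n + 1),
            if p.1 < p.2 then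
              ((-1 : k) ^ ((p.1 : ℕ) + (p.2 : ℕ))) •
                (u ⊗ₜ[k] wedge k n (consRemove2 ⁅v p.1, v p.2⁆ v p.1 p.2))
            else 0

theorem d_EE_zero {d : ∀ n : ℕ, (𝔘 ⊗[k] ⋀[k]^(n + 1) g) →ₗ[𝔘] (𝔘 ⊗[k] ⋀[k]^n g)}
    (hd : IsKoszul (k := k) (g := g) d) (x : g) (z : 𝔘 ⊗[k] (⋀[k]^0 g)) :
    d 0 (EE 0 x z) = th 0 x z := by
  refine kz_ext 0 (((d 0).restrictScalars k).comp (EE 0 x)) (th 0 x) (fun u v => ?_) z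
  simp only [LinearMap.comp_apply, EE_tmul, LinearMap.restrictScalars_apply, th_tmul, adg_zero]
  rw [← wedge_cons, hd]
  simp
  rfl

theorem wedge_consRemove2_succ {n : ℕ} (a x : g) (v : Fin (n + 1) → g) (i j : Fin (n + 1))
    (hij : i < j) :
    wedge k (n + 1) (consRemove2 a (Fin.cons x v : Fin (n + 2) → g) i.succ j.succ) =
      - eg n x (wedge k n (consRemove2 a v i j)) := by
  cases n with
  | zero => exact absurd hij (by have := i.isLt; have := j.isLt; rw [Fin.lt_def]; omega)
  | succ m =>
    obtain ⟨r, h1, h2⟩ := consRemove2_succ a x v i j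
    rw [h1, h2, wedge_cons, wedge_cons, wedge_cons, eg_anti]

theorem d_EE_succ {d : ∀ n : ℕ, (𝔘 ⊗[k] ⋀[k]^(n + 1) g) →ₗ[𝔘] (𝔘 ⊗[k] ⋀[k]^n g)}
    (hd : IsKoszul (k := k) (g := g) d) (n : ℕ) (x : g) (z : 𝔘 ⊗[k] (⋀[k]^(n + 1) g)) :
    d (n + 1) (EE (n + 1) x z) = th (n + 1) x z - EE n x (d n z) := by
  refine kz_ext (n + 1) (((d (n + 1)).restrictScalars k).comp (EE (n + 1) x))
    (th (n + 1) x - (EE n x).comp ((d n).restrictScalars k)) (fun u v => ?_) z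
  simp only [LinearMap.comp_apply, EE_tmul, LinearMap.restrictScalars_apply, th_tmul,
    LinearMap.sub_apply]
  rw [← wedge_cons, hd, hd, adg_wedge]
  have e0 : (Fin.cons x v : Fin (n + 2) → g) ∘ (0 : Fin (n + 2)).succAbove = v := by
    ext i; simp
  have e1 : ∀ j : Fin (n + 1), (Fin.cons x v : Fin (n + 2) → g) ∘ j.succ.succAbove =
      Fin.cons x (v ∘ j.succAbove) := by
    intro j; ext i
    cases i using Fin.cases <;> simp
  have f1 : ∑ i : Fin (n + 2), ((-1 : k) ^ (i : ℕ)) •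
      ((u * UniversalEnvelopingAlgebra.ι k ((Fin.cons x v : Fin (n + 2) → g) i)) ⊗ₜ[k]
        wedge k (n + 1) ((Fin.cons x v : Fin (n + 2) → g) ∘ i.succAbove)) =
      (u * UniversalEnvelopingAlgebra.ι k x) ⊗ₜ[k] wedge k (n + 1) v -
      EE n x (∑ i : Fin (n + 1), ((-1 : k) ^ (i : ℕ)) •
              ((u * UniversalEnvelopingAlgebra.ι k (v i)) ⊗ₜ[k] wedge k n (v ∘ i.succAbove))) := by
    rw [Fin.sum_univ_succ, e0, map_sum, sub_eq_add_neg, ← Finset.sum_neg_distrib]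
    congr 1
    · simp
    · refine Finset.sum_congr rfl (fun j _ => ?_)
      rw [e1, wedge_cons, Fin.val_succ, pow_succ, mul_neg, mul_one, neg_smul, map_smul, EE_tmul,
        Fin.cons_succ]
  have f2 : (∑ p : Fin (n + 2) × Fin (n + 2), if p.1 < p.2 then ((-1 : k) ^ ((p.1 : ℕ) + (p.2 : ℕ))) •
                (u ⊗ₜ[k] wedge k (n + 1) (consRemove2 ⁅(Fin.cons x v : Fin (n + 2) → g) p.1,
                (Fin.cons x v : Fin (n + 2) → g) p.2⁆ (Fin.cons x v : Fin (n + 2) → g) p.1 p.2))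
            else 0) = 
       - u ⊗ₜ[k] (∑ j : Fin (n + 1), ((-1 : k) ^ (j : ℕ)) •
          eg n ⁅x, v j⁆ (wedge k n (v ∘ j.succAbove))) - 
       EE n x (∑ p : Fin (n + 1) × Fin (n + 1),
            if p.1 < p.2 then
              ((-1 : k) ^ ((p.1 : ℕ) + (p.2 : ℕ))) •
                (u ⊗ₜ[k] wedge k n (consRemove2 ⁅v p.1, v p.2⁆ v p.1 p.2))
            else 0) := by
    rw [Fintype.sum_prod_type, Fin.sum_univ_succ, sub_eq_add_neg, Fintype.sum_prod_type, map_sum,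
      ← Finset.sum_neg_distrib]
    congr 1
    · rw [Fin.sum_univ_succ, TensorProduct.tmul_sum, ← Finset.sum_neg_distrib]
      simp only [lt_self_iff_false, if_false, zero_add]
      refine Finset.sum_congr rfl (fun j _ => ?_)
      rw [if_pos (Fin.succ_pos j), consRemove2_zero, wedge_cons, Fin.val_succ, ← add_assoc, pow_succ,
        mul_neg, mul_one, neg_smul, TensorProduct.tmul_smul]
      simp
    · refine Finset.sum_congr rfl (fun i _ => ?_)
      rw [Fin.sum_univ_succ, map_sum, ← Finset.sum_neg_distrib, if_neg (by simp), zero_add]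
      refine Finset.sum_congr rfl (fun j _ => ?_)
      simp only [Fin.succ_lt_succ_iff, Fin.cons_succ]
      split_ifs with h
      · rw [wedge_consRemove2_succ _ _ _ _ _ h, map_smul, EE_tmul, TensorProduct.tmul_neg, smul_neg]
        congr 2
        simp only [Fin.val_succ]
        ring
      · simp
  rw [f1, f2, map_add]
  abel

theorem th_EE (n : ℕ) (x y : g) (z : 𝔘 ⊗[k] (⋀[k]^n g)) :
    th (n + 1) x (EE n y z) = EE n y (th n x z) - EE n ⁅x, y⁆ z := by
  refine tp_ext ((th (n + 1) x).comp (EE n y)) ((EE n y).comp (th n x) - EE n ⁅x, y⁆) (fun u w => ?_) z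
  simp [adg_eg, TensorProduct.tmul_add]
  abel

theorem th_th (n : ℕ) (x y : g) (z : 𝔘 ⊗[k] (⋀[k]^n g)) :
    th n x (th n y z) - th n y (th n x z) = - th n ⁅x, y⁆ z := by
  refine tp_ext ((th n x).comp (th n y) - (th n y).comp (th n x)) (-th n ⁅x, y⁆) (fun u w => ?_) z
  simp only [LinearMap.sub_apply, LinearMap.comp_apply, th_tmul, map_sub, LinearMap.neg_apply,
    adg_lie, ι_lie, mul_sub, TensorProduct.sub_tmul, TensorProduct.tmul_sub, mul_assoc]
  abel

theorem EE_anti (n : ℕ) (x y : g) (z : 𝔘 ⊗[k] (⋀[k]^n g)) :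
    EE (n + 1) x (EE n y z) = - EE (n + 1) y (EE n x z) := by
  refine tp_ext ((EE (n + 1) x).comp (EE n y)) (-((EE (n + 1) y).comp (EE n x))) (fun u w => ?_) z
  simp [eg_anti n x y, TensorProduct.tmul_neg]

theorem d_th {d : ∀ n : ℕ, (𝔘 ⊗[k] ⋀[k]^(n + 1) g) →ₗ[𝔘] (𝔘 ⊗[k] ⋀[k]^n g)}
    (hd : IsKoszul (k := k) (g := g) d) (n : ℕ) (x : g) (z : 𝔘 ⊗[k] (⋀[k]^(n + 1) g)) :
    d n (th (n + 1) x z) = th n x (d n z) := by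
  induction n with
  | zero =>
    refine kz_succ_ext 0 (((d 0).restrictScalars k).comp (th 1 x))
      ((th 0 x).comp ((d 0).restrictScalars k)) (fun y z => ?_) z
    simp only [LinearMap.comp_apply, LinearMap.restrictScalars_apply]
    have := th_th 0 x y z
    rw [show th 1 x (EE 0 y z) = _ from th_EE 0 x y z, map_sub, d_EE_zero hd, d_EE_zero hd,
      d_EE_zero hd, ← neg_eq_iff_eq_neg.2 this]
    abel
  | succ n ih =>
    refine kz_succ_ext (n + 1) (((d (n + 1)).restrictScalars k).comp (th (n + 1 + 1) x))
      ((th (n + 1) x).comp ((d (n + 1)).restrictScalars k)) (fun y z => ?_) z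
    simp only [LinearMap.comp_apply, LinearMap.restrictScalars_apply]
    have := th_th (n + 1) x y z
    rw [th_EE, map_sub, d_EE_succ hd, d_EE_succ hd,
      d_EE_succ hd, map_sub, ih, ← neg_eq_iff_eq_neg.2 this, th_EE]
    abel

theorem d_d {d : ∀ n : ℕ, (𝔘 ⊗[k] ⋀[k]^(n + 1) g) →ₗ[𝔘] (𝔘 ⊗[k] ⋀[k]^n g)}
    (hd : IsKoszul (k := k) (g := g) d) (n : ℕ) (z : 𝔘 ⊗[k] (⋀[k]^(n + 1 + 1) g)) :
    d n (d (n + 1) z) = 0 := by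
  induction n with
  | zero =>
    refine kz_succ_ext (0 + 1) (((d 0).restrictScalars k).comp ((d (0 + 1)).restrictScalars k))
      0 (fun y z => ?_) z
    simp only [LinearMap.comp_apply, LinearMap.restrictScalars_apply, LinearMap.zero_apply]
    rw [d_EE_succ hd, map_sub, d_EE_zero hd, d_th hd, sub_self]
  | succ n ih =>
    refine kz_succ_ext (n + 1 + 1) (((d (n + 1)).restrictScalars k).comp
      ((d (n + 1 + 1)).restrictScalars k)) 0 (fun y z => ?_) z
    simp only [LinearMap.comp_apply, LinearMap.restrictScalars_apply, LinearMap.zero_apply]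
    rw [d_EE_succ hd, map_sub, d_EE_succ hd, d_th hd, ih, map_zero, sub_zero, sub_self]

end Koszul


section Homotopy

attribute [local instance] LieRing.ofAssociativeRing

variable {k g : Type*} [Field k] [LieRing g] [LieAlgebra k g]

local notation "𝔘" => UniversalEnvelopingAlgebra k g

/-- `(v ⊗ y) ⊗ w ↦ v ⊗ (y ∧ w)`. -/
noncomputable def kk (n : ℕ) : (𝔘 ⊗[k] g) ⊗[k] (⋀[k]^n g) →ₗ[k] 𝔘 ⊗[k] (⋀[k]^(n + 1) g) :=
  (LinearMap.lTensor 𝔘 (TensorProduct.lift (eg n))).comp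
    (TensorProduct.assoc k 𝔘 g (⋀[k]^n g)).toLinearMap

@[simp] theorem kk_tmul (n : ℕ) (v : 𝔘) (y : g) (w : ⋀[k]^n g) :
    kk n ((v ⊗ₜ[k] y) ⊗ₜ[k] w) = v ⊗ₜ[k] eg n y w := rfl

/-- The contracting homotopy (to leading order). -/
noncomputable def hh (δ : 𝔘 →ₗ[k] 𝔘 ⊗[k] g) (n : ℕ) :
    𝔘 ⊗[k] (⋀[k]^n g) →ₗ[k] 𝔘 ⊗[k] (⋀[k]^(n + 1) g) :=
  (kk n).comp (LinearMap.rTensor _ δ)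

@[simp] theorem hh_tmul (δ : 𝔘 →ₗ[k] 𝔘 ⊗[k] g) (n : ℕ) (u : 𝔘) (w : ⋀[k]^n g) :
    hh δ n (u ⊗ₜ[k] w) = kk n (δ u ⊗ₜ[k] w) := rfl

theorem hh_EE (δ : 𝔘 →ₗ[k] 𝔘 ⊗[k] g) (n : ℕ) (x : g) (z : 𝔘 ⊗[k] (⋀[k]^n g)) :
    hh δ (n + 1) (EE n x z) = - EE (n + 1) x (hh δ n z) := by
  refine tp_ext ((hh δ (n + 1)).comp (EE n x)) (- (EE (n + 1) x).comp (hh δ n)) (fun u w => ?_) z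
  simp only [LinearMap.comp_apply, EE_tmul, hh_tmul, LinearMap.neg_apply]
  refine tp_ext ((kk (n + 1)).comp ((TensorProduct.mk k _ _).flip (eg n x w)))
    (-(EE (n + 1) x).comp ((kk n).comp ((TensorProduct.mk k _ _).flip w))) (fun v y => ?_) (δ u)
  simp [eg_anti n y x, TensorProduct.tmul_neg]

variable {B : Type*} (bas : Module.Basis B k g)

theorem lTensor_mem {N N' : Type*} [AddCommGroup N] [Module k N] [AddCommGroup N'] [Module k N']
    (f : N →ₗ[k] N') (p : ℕ) (z : 𝔘 ⊗[k] N) (hz : z ∈ WT bas N p) :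
    LinearMap.lTensor 𝔘 f z ∈ WT bas N' p := by
  refine WT_ind bas _ (LinearMap.lTensor 𝔘 f) p (fun u hu w => ?_) z hz
  exact tmul_mem_WT bas hu _

theorem EE_mem (n p : ℕ) (x : g) (z : 𝔘 ⊗[k] (⋀[k]^n g)) (hz : z ∈ WT bas _ p) :
    EE n x z ∈ WT bas _ p := lTensor_mem bas _ p z hz

theorem kk_mem (n p : ℕ) (t : 𝔘 ⊗[k] g) (ht : t ∈ WT bas _ p) (w : ⋀[k]^n g) :
    kk n (t ⊗ₜ[k] w) ∈ WT bas _ p := by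
  refine WT_ind bas _ ((kk n).comp ((TensorProduct.mk k _ _).flip w)) p (fun u hu y => ?_) t ht
  exact tmul_mem_WT bas hu _

theorem hth (δ : 𝔘 →ₗ[k] 𝔘 ⊗[k] g) 
    (h1 : ∀ p u, u ∈ Wf bas (p + 1) → δ u ∈ WT bas g p)
    (h2 : ∀ p u, u ∈ Wf bas (p + 1) → ∀ x, δ (u * UniversalEnvelopingAlgebra.ι k x) -
      Rm x (δ u) - u ⊗ₜ[k] x ∈ WT bas g p)
    (n p : ℕ) (x : g) (z : 𝔘 ⊗[k] (⋀[k]^n g)) (hz : z ∈ WT bas _ (p + 1)) :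
    hh δ n (th n x z) - th (n + 1) x (hh δ n z) - EE n x z ∈ WT bas _ p := by
  refine WT_ind bas _ ((hh δ n).comp (th n x) - (th (n + 1) x).comp (hh δ n) - EE n x) (p + 1)
    (fun u hu w => ?_) z hz
  simp only [LinearMap.sub_apply, LinearMap.comp_apply, th_tmul, hh_tmul, map_sub, EE_tmul]
  have e : ∀ t : 𝔘 ⊗[k] g, th (n + 1) x (kk n (t ⊗ₜ[k] w)) = kk n (Rm x t ⊗ₜ[k] w) -
      kk n (LinearMap.lTensor 𝔘 ((LieAlgebra.ad k g x : Module.End k g)) t ⊗ₜ[k] w) -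
      kk n (t ⊗ₜ[k] adg n x w) := by
    intro t
    refine tp_ext ((th (n + 1) x).comp ((kk n).comp ((TensorProduct.mk k _ _).flip w)))
      ((kk n).comp (((TensorProduct.mk k _ _).flip w).comp (Rm x)) -
       (kk n).comp (((TensorProduct.mk k _ _).flip w).comp
        (LinearMap.lTensor 𝔘 ((LieAlgebra.ad k g x : Module.End k g)))) -
       (kk n).comp ((TensorProduct.mk k _ _).flip (adg n x w))) (fun v y => ?_) t
    simp [adg_eg, TensorProduct.tmul_add]
    abel
  have e2 : kk n (δ (u * UniversalEnvelopingAlgebra.ι k x) ⊗ₜ[k] w) - kk n (δ u ⊗ₜ[k] adg n x w) -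
      th (n + 1) x (kk n (δ u ⊗ₜ[k] w)) - u ⊗ₜ[k] eg n x w =
      kk n ((δ (u * UniversalEnvelopingAlgebra.ι k x) - Rm x (δ u) - u ⊗ₜ[k] x) ⊗ₜ[k] w) +
      kk n (LinearMap.lTensor 𝔘 ((LieAlgebra.ad k g x : Module.End k g)) (δ u) ⊗ₜ[k] w) := by
    rw [e, TensorProduct.sub_tmul, TensorProduct.sub_tmul, map_sub, map_sub, kk_tmul]
    abel
  rw [e2]
  exact Submodule.add_mem _ (kk_mem bas n p _ (h2 p u hu x) w)
    (kk_mem bas n p _ (lTensor_mem bas _ p _ (h1 p u hu)) w)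

theorem dh_zero {d : ∀ n : ℕ, (𝔘 ⊗[k] ⋀[k]^(n + 1) g) →ₗ[𝔘] (𝔘 ⊗[k] ⋀[k]^n g)}
    (hd : IsKoszul (k := k) (g := g) d) (δ : 𝔘 →ₗ[k] 𝔘 ⊗[k] g)
    (h3 : ∀ p u, u ∈ Wf bas (p + 1) → μg (δ u) - (p : k) • u ∈ Wf bas p)
    (p : ℕ) (z : 𝔘 ⊗[k] (⋀[k]^0 g)) (hz : z ∈ WT bas _ (p + 1)) :
    d 0 (hh δ 0 z) - (p : k) • z ∈ WT bas _ p := by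
  refine WT_ind bas _ (((d 0).restrictScalars k).comp (hh δ 0) - (p : k) • LinearMap.id) (p + 1)
    (fun u hu w => ?_) z hz
  simp only [LinearMap.sub_apply, LinearMap.comp_apply, hh_tmul, LinearMap.smul_apply,
    LinearMap.id_apply, LinearMap.restrictScalars_apply]
  have e : ∀ t : 𝔘 ⊗[k] g, d 0 (kk 0 (t ⊗ₜ[k] w)) = μg t ⊗ₜ[k] w := by
    intro t
    refine tp_ext (((d 0).restrictScalars k).comp ((kk 0).comp ((TensorProduct.mk k _ _).flip w)))
      (((TensorProduct.mk k _ _).flip w).comp μg) (fun v y => ?_) t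
    have := d_EE_zero hd y (v ⊗ₜ[k] w)
    simp only [EE_tmul, th_tmul, adg_zero, LinearMap.zero_apply, TensorProduct.tmul_zero,
      sub_zero] at this
    exact this
  rw [e, TensorProduct.smul_tmul', ← TensorProduct.sub_tmul]
  exact tmul_mem_WT bas (h3 p u hu) w

theorem dh_succ {d : ∀ n : ℕ, (𝔘 ⊗[k] ⋀[k]^(n + 1) g) →ₗ[𝔘] (𝔘 ⊗[k] ⋀[k]^n g)}
    (hd : IsKoszul (k := k) (g := g) d) (δ : 𝔘 →ₗ[k] 𝔘 ⊗[k] g)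
    (h1 : ∀ p u, u ∈ Wf bas (p + 1) → δ u ∈ WT bas g p)
    (h2 : ∀ p u, u ∈ Wf bas (p + 1) → ∀ x, δ (u * UniversalEnvelopingAlgebra.ι k x) -
      Rm x (δ u) - u ⊗ₜ[k] x ∈ WT bas g p)
    (h3 : ∀ p u, u ∈ Wf bas (p + 1) → μg (δ u) - (p : k) • u ∈ Wf bas p)
    (n p : ℕ) (z : 𝔘 ⊗[k] (⋀[k]^(n + 1) g)) (hz : z ∈ WT bas _ (p + 1)) :
    d (n + 1) (hh δ (n + 1) z) + hh δ n (d n z) - ((p + n + 1 : ℕ) : k) • z ∈ WT bas _ p := by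
  induction n with
  | zero =>
    refine WT_ind bas _ (((d 1).restrictScalars k).comp (hh δ 1) +
      (hh δ 0).comp ((d 0).restrictScalars k) - ((p + 0 + 1 : ℕ) : k) • LinearMap.id) (p + 1)
      (fun u hu w => ?_) z hz
    refine ext_succ_ind 0 (Submodule.comap ((((d 1).restrictScalars k).comp (hh δ 1) +
      (hh δ 0).comp ((d 0).restrictScalars k) - ((p + 0 + 1 : ℕ) : k) • LinearMap.id).comp
        (TensorProduct.mk k 𝔘 _ u)) (WT bas _ p)) (fun x w => ?_) w
    have hy := tmul_mem_WT bas hu w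
    rw [Submodule.mem_comap, LinearMap.comp_apply, TensorProduct.mk_apply, ← EE_tmul]
    generalize u ⊗ₜ[k] w = y at hy
    have a1 := hth bas δ h1 h2 0 p x y hy
    have a2 := EE_mem bas _ p x _ (dh_zero bas hd δ h3 p y hy)
    convert Submodule.add_mem _ a1 a2 using 1
    simp only [LinearMap.sub_apply, LinearMap.add_apply, LinearMap.comp_apply, LinearMap.smul_apply,
      LinearMap.id_apply, LinearMap.restrictScalars_apply]
    rw [d_EE_zero hd, show hh δ 1 (EE 0 x y) = _ from hh_EE δ 0 x y, map_neg,
      show d 1 (EE (0 + 1) x (hh δ 0 y)) = _ from d_EE_succ hd 0 x _, map_sub, map_smul]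
    push_cast
    simp only [add_smul, one_smul, zero_smul]
    abel
  | succ n ih =>
    refine WT_ind bas _ (((d (n + 1 + 1)).restrictScalars k).comp (hh δ (n + 1 + 1)) +
      (hh δ (n + 1)).comp ((d (n + 1)).restrictScalars k) - ((p + (n + 1) + 1 : ℕ) : k) • LinearMap.id)
      (p + 1) (fun u hu w => ?_) z hz
    refine ext_succ_ind (n + 1)
     (Submodule.comap ((((d (n + 1 + 1)).restrictScalars k).comp (hh δ (n + 1 + 1)) +
      (hh δ (n + 1)).comp ((d (n + 1)).restrictScalars k) -
        ((p + (n + 1) + 1 : ℕ) : k) • LinearMap.id).comp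
        (TensorProduct.mk k 𝔘 _ u)) (WT bas _ p)) (fun x w => ?_) w
    have hy := tmul_mem_WT bas hu w
    rw [Submodule.mem_comap, LinearMap.comp_apply, TensorProduct.mk_apply, ← EE_tmul]
    generalize u ⊗ₜ[k] w = y at hy
    have a1 := hth bas δ h1 h2 (n + 1) p x y hy
    have a2 := EE_mem bas _ p x _ (ih y hy)
    convert Submodule.add_mem _ a1 a2 using 1
    simp only [LinearMap.sub_apply, LinearMap.add_apply, LinearMap.comp_apply, LinearMap.smul_apply,
      LinearMap.id_apply, LinearMap.restrictScalars_apply]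
    rw [d_EE_succ hd, hh_EE δ, map_neg, d_EE_succ hd, map_sub, map_sub, map_add, map_smul, hh_EE δ]
    push_cast
    simp only [add_smul, one_smul]
    abel

theorem koszul_exact_succ [CharZero k]
    {d : ∀ n : ℕ, (𝔘 ⊗[k] ⋀[k]^(n + 1) g) →ₗ[𝔘] (𝔘 ⊗[k] ⋀[k]^n g)}
    (hd : IsKoszul (k := k) (g := g) d) (n : ℕ) :
    LinearMap.range (d (n + 1)) = LinearMap.ker (d n) := by
  apply le_antisymm
  · rintro _ ⟨z, rfl⟩
    exact d_d hd n z
  · obtain ⟨δ, h1, h2, h3⟩ := exists_δ (Module.Basis.ofVectorSpace k g)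
    intro z hz
    rw [LinearMap.mem_ker] at hz
    obtain ⟨p, hp⟩ := WT_exhaust (Module.Basis.ofVectorSpace k g) z
    induction p generalizing z with
    | zero =>
      rw [WT_zero, Submodule.mem_bot] at hp
      rw [hp]; exact Submodule.zero_mem _
    | succ p ih =>
      have a := dh_succ _ hd δ h1 h2 h3 n p z hp
      rw [hz, map_zero, add_zero] at a
      have b := ih (by
        have e := (((d n).restrictScalars k)).map_smul ((p + n + 1 : ℕ) : k) z
        simp only [LinearMap.restrictScalars_apply] at e
        rw [map_sub, d_d hd, e, hz, smul_zero, sub_zero]) a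
      obtain ⟨y, hy⟩ := b
      have hc : ((p + n + 1 : ℕ) : k) ≠ 0 := Nat.cast_ne_zero.2 (by omega)
      refine ⟨((p + n + 1 : ℕ) : k)⁻¹ • (hh δ (n + 1) z - y), ?_⟩
      have e := (((d (n + 1)).restrictScalars k)).map_smul ((p + n + 1 : ℕ) : k)⁻¹
        (hh δ (n + 1) z - y)
      simp only [LinearMap.restrictScalars_apply] at e
      rw [e, map_sub, hy, sub_sub_cancel, smul_smul, inv_mul_cancel₀ hc, one_smul]

/-- The augmentation of the Koszul complex. -/
noncomputable def eV (ε : 𝔘 →ₐ[k] k) : 𝔘 ⊗[k] (⋀[k]^0 g) →ₗ[k] k :=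
  TensorProduct.lift ((LinearMap.mul k k).compl₁₂ ε.toLinearMap
    (exteriorPower.zeroEquiv k g).toLinearMap)

@[simp] theorem eV_tmul (ε : 𝔘 →ₐ[k] k) (u : 𝔘) (w : ⋀[k]^0 g) :
    eV ε (u ⊗ₜ[k] w) = ε u * exteriorPower.zeroEquiv k g w := rfl

theorem eV_lin (ε : 𝔘 →ₐ[k] k) (u : 𝔘) (z : 𝔘 ⊗[k] (⋀[k]^0 g)) :
    eV ε (u • z) = ε u * eV ε z := by
  induction z using TensorProduct.induction_on with
  | zero => simp
  | tmul v n => simp [TensorProduct.smul_tmul', mul_assoc]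
  | add a b ha hb => rw [smul_add, map_add, ha, hb, map_add, mul_add]

theorem eV_surj (ε : 𝔘 →ₐ[k] k) : Function.Surjective (eV (k := k) (g := g) ε) := by
  intro c
  exact ⟨1 ⊗ₜ (exteriorPower.zeroEquiv k g).symm c, by simp⟩

theorem eV_d {d : ∀ n : ℕ, (𝔘 ⊗[k] ⋀[k]^(n + 1) g) →ₗ[𝔘] (𝔘 ⊗[k] ⋀[k]^n g)}
    (hd : IsKoszul (k := k) (g := g) d) (ε : 𝔘 →ₐ[k] k)
    (hε : ∀ x : g, ε (UniversalEnvelopingAlgebra.ι k x) = 0) (z) : eV ε (d 0 z) = 0 := by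
  refine kz_succ_ext 0 ((eV ε).comp ((d 0).restrictScalars k)) 0 (fun x z => ?_) z
  simp only [LinearMap.comp_apply, LinearMap.restrictScalars_apply, LinearMap.zero_apply]
  rw [d_EE_zero hd]
  refine tp_ext ((eV ε).comp (th 0 x)) 0 (fun u w => ?_) z
  rw [LinearMap.comp_apply, th_tmul, adg_zero, LinearMap.zero_apply, TensorProduct.tmul_zero,
    sub_zero, eV_tmul, map_mul, hε, mul_zero, zero_mul, LinearMap.zero_apply]

theorem koszul_exact_zero [CharZero k]
    {d : ∀ n : ℕ, (𝔘 ⊗[k] ⋀[k]^(n + 1) g) →ₗ[𝔘] (𝔘 ⊗[k] ⋀[k]^n g)}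
    (hd : IsKoszul (k := k) (g := g) d) (ε : 𝔘 →ₐ[k] k)
    (hε : ∀ x : g, ε (UniversalEnvelopingAlgebra.ι k x) = 0) :
    LinearMap.range ((d 0).restrictScalars k) = LinearMap.ker (eV (k := k) (g := g) ε) := by
  apply le_antisymm
  · rintro _ ⟨z, rfl⟩
    exact eV_d hd ε hε z
  · obtain ⟨δ, h1, h2, h3⟩ := exists_δ (Module.Basis.ofVectorSpace k g)
    intro z hz
    rw [LinearMap.mem_ker] at hz
    obtain ⟨p, hp⟩ := WT_exhaust (Module.Basis.ofVectorSpace k g) z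
    induction p generalizing z with
    | zero =>
      rw [WT_zero, Submodule.mem_bot] at hp
      rw [hp]; exact Submodule.zero_mem _
    | succ p ih =>
      rcases Nat.eq_zero_or_pos p with rfl | hpos
      · have : z ∈ LinearMap.range (TensorProduct.mk k 𝔘 (⋀[k]^0 g) 1) := by
          refine WT_ind _ _ LinearMap.id 1 (fun u hu w => ?_) z hp
          refine Wf_ind _ _ ((TensorProduct.mk k 𝔘 (⋀[k]^0 g)).flip w) 1 (fun l hl => ?_) u hu
          have : l = [] := List.length_eq_zero_iff.1 (by omega)
          rw [this, wprod_nil]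
          exact ⟨w, rfl⟩
        obtain ⟨w, rfl⟩ := this
        rw [TensorProduct.mk_apply, eV_tmul, map_one, one_mul, LinearEquiv.map_eq_zero_iff] at hz
        rw [hz, map_zero]
        exact Submodule.zero_mem _
      · have a := dh_zero _ hd δ h3 p z hp
        have b := ih (by rw [map_sub, eV_d hd ε hε, map_smul, hz, smul_zero, sub_zero]) a
        obtain ⟨y, hy⟩ := b
        have hc : (p : k) ≠ 0 := Nat.cast_ne_zero.2 (by omega)
        refine ⟨(p : k)⁻¹ • (hh δ 0 z - y), ?_⟩
        rw [map_smul, map_sub, hy, LinearMap.restrictScalars_apply, sub_sub_cancel, smul_smul,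
          inv_mul_cancel₀ hc, one_smul]

end Homotopy


section HomologicalAlgebra

theorem dep_choice {α : ℕ → Type*} (P : ∀ n, α n → Prop) (R : ∀ n, α n → α (n + 1) → Prop)
    (a0 : α 0) (h0 : P 0 a0) (step : ∀ n a, P n a → ∃ b, P (n + 1) b ∧ R n a b) :
    ∃ f : ∀ n, α n, f 0 = a0 ∧ ∀ n, R n (f n) (f (n + 1)) := by
  choose b hb1 hb2 using step
  let F : ∀ n, {a : α n // P n a} := fun n =>
    Nat.rec ⟨a0, h0⟩ (fun n a => ⟨b n a.1 a.2, hb1 n a.1 a.2⟩) n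
  exact ⟨fun n => (F n).1, rfl, fun n => hb2 n (F n).1 (F n).2⟩

theorem proj_lift {A P M N : Type*} [Ring A] [AddCommGroup P] [Module A P] [Module.Projective A P]
    [AddCommGroup M] [Module A M] [AddCommGroup N] [Module A N] (ψ : M →ₗ[A] N) (φ : P →ₗ[A] N)
    (h : ∀ z, φ z ∈ LinearMap.range ψ) : ∃ f : P →ₗ[A] M, ∀ z, ψ (f z) = φ z := by
  obtain ⟨f, hf⟩ := Module.projective_lifting_property ψ.rangeRestrict
    (φ.codRestrict (LinearMap.range ψ) h) ψ.surjective_rangeRestrict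
  refine ⟨f, fun z => ?_⟩
  have := LinearMap.congr_fun hf z
  exact congrArg Subtype.val this

variable {A : Type*} [Ring A] {X Y : ℕ → Type*} [∀ n, AddCommGroup (X n)] [∀ n, Module A (X n)]
  [∀ n, AddCommGroup (Y n)] [∀ n, Module A (Y n)] [∀ n, Module.Projective A (X n)]

theorem comparison {K : Type*} [AddCommGroup K] [Module A K]
    (dX : ∀ n, X (n + 1) →ₗ[A] X n) (dY : ∀ n, Y (n + 1) →ₗ[A] Y n)
    (eX : X 0 →ₗ[A] K) (eY : Y 0 →ₗ[A] K)
    (hX0 : ∀ z, eX (dX 0 z) = 0) (hX : ∀ n z, dX n (dX (n + 1) z) = 0)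
    (hYs : Function.Surjective eY) (hY0 : ∀ z, eY z = 0 → z ∈ LinearMap.range (dY 0))
    (hY : ∀ n z, dY n z = 0 → z ∈ LinearMap.range (dY (n + 1))) :
    ∃ f : ∀ n, X n →ₗ[A] Y n, (∀ z, eY (f 0 z) = eX z) ∧
      ∀ n z, dY n (f (n + 1) z) = f n (dX n z) := by
  obtain ⟨f0, hf0⟩ := proj_lift eY eX (fun z => hYs _)
  obtain ⟨f, h1, h2⟩ := dep_choice (α := fun n => X n →ₗ[A] Y n)
    (fun n f => ∀ z, f (dX n z) ∈ LinearMap.range (dY n))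
    (fun n f f' => ∀ z, dY n (f' z) = f (dX n z)) f0
    (fun z => hY0 _ (by rw [hf0, hX0])) (fun n f hf => by
      obtain ⟨f', hf'⟩ := proj_lift (dY n) (f.comp (dX n)) hf
      exact ⟨f', fun z => hY _ _ (by rw [hf', LinearMap.comp_apply, hX, map_zero]), hf'⟩)
  exact ⟨f, by rw [h1]; exact hf0, h2⟩

theorem null_homotopy (dX : ∀ n, X (n + 1) →ₗ[A] X n) (dY : ∀ n, Y (n + 1) →ₗ[A] Y n)
    (hX : ∀ n z, dX n (dX (n + 1) z) = 0)
    (hY : ∀ n z, dY n z = 0 → z ∈ LinearMap.range (dY (n + 1)))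
    (f : ∀ n, X n →ₗ[A] Y n) (hf0 : ∀ z, f 0 z ∈ LinearMap.range (dY 0))
    (hf : ∀ n z, dY n (f (n + 1) z) = f n (dX n z)) :
    ∃ s : ∀ n, X n →ₗ[A] Y (n + 1), (∀ z, dY 0 (s 0 z) = f 0 z) ∧
      ∀ n z, dY (n + 1) (s (n + 1) z) + s n (dX n z) = f (n + 1) z := by
  obtain ⟨s0, hs0⟩ := proj_lift (dY 0) (f 0) hf0
  obtain ⟨s, h1, h2⟩ := dep_choice (α := fun n => X n →ₗ[A] Y (n + 1))
    (fun n s => ∀ z, dY n (s (dX n z)) = f n (dX n z))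
    (fun n s s' => ∀ z, dY (n + 1) (s' z) + s (dX n z) = f (n + 1) z) s0
    (fun z => hs0 _) (fun n s hs => by
      obtain ⟨s', hs'⟩ := proj_lift (dY (n + 1)) (f (n + 1) - s.comp (dX n)) (fun z => hY _ _ (by
        rw [LinearMap.sub_apply, map_sub, LinearMap.comp_apply, hs, hf, sub_self]))
      refine ⟨s', fun z => ?_, fun z => ?_⟩
      · rw [hs', LinearMap.sub_apply, LinearMap.comp_apply, hX, map_zero, sub_zero]
      · rw [hs', LinearMap.sub_apply, LinearMap.comp_apply, sub_add_cancel])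
  exact ⟨s, by rw [h1]; exact hs0, h2⟩

end HomologicalAlgebra

section CoinvMap

variable {k A : Type*} (M : Type*) {N N' N'' : Type*} [CommRing k] [Ring A] [Algebra k A]
  [AddCommGroup M] [Module k M] [Module Aᵐᵒᵖ M]
  [AddCommGroup N] [Module k N] [Module A N] [IsScalarTower k A N]
  [AddCommGroup N'] [Module k N'] [Module A N'] [IsScalarTower k A N']

/-- Functoriality of the balanced tensor product. -/
noncomputable def coinvMap (φ : N →ₗ[A] N') : CoinvTensor k A M N →ₗ[k] CoinvTensor k A M N' :=
  Submodule.mapQ (coinvRel k A M N) (coinvRel k A M N')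
    (LinearMap.lTensor M (φ.restrictScalars k)) (by
      rw [coinvRel, Submodule.span_le]
      rintro _ ⟨m, a, n, rfl⟩
      refine Submodule.subset_span ⟨m, a, φ n, ?_⟩
      simp)

theorem coinvMap_mk (φ : N →ₗ[A] N') (m : M) (n : N) :
    coinvMap (k := k) M φ (CoinvTensor.mk k A M N (m ⊗ₜ n)) = CoinvTensor.mk k A M N' (m ⊗ₜ φ n) :=
  rfl

theorem coinv_ext {C : Type*} [AddCommGroup C] [Module k C] (f f' : CoinvTensor k A M N →ₗ[k] C)
    (h : ∀ m n, f (CoinvTensor.mk k A M N (m ⊗ₜ n)) = f' (CoinvTensor.mk k A M N (m ⊗ₜ n))) (z) :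
    f z = f' z := by
  have : f = f' := by
    refine Submodule.linearMap_qext (coinvRel k A M N) ?_
    refine TensorProduct.ext' (fun m n => ?_)
    exact h m n
  rw [this]

theorem coinv_mk_add (m : M) (n n' : N) : CoinvTensor.mk k A M N (m ⊗ₜ (n + n')) =
    CoinvTensor.mk k A M N (m ⊗ₜ n) + CoinvTensor.mk k A M N (m ⊗ₜ n') := by
  rw [TensorProduct.tmul_add]; rfl

theorem coinv_mk_sub (m : M) (n n' : N) : CoinvTensor.mk k A M N (m ⊗ₜ (n - n')) =
    CoinvTensor.mk k A M N (m ⊗ₜ n) - CoinvTensor.mk k A M N (m ⊗ₜ n') := by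
  rw [TensorProduct.tmul_sub]; rfl

end CoinvMap

section HomologyIso

variable {k : Type*} [CommRing k]

theorem homology_zero_iso {C1 C0 E1 E0 : Type*} [AddCommGroup C1] [Module k C1]
    [AddCommGroup C0] [Module k C0] [AddCommGroup E1] [Module k E1] [AddCommGroup E0] [Module k E0]
    (D : C1 →ₗ[k] C0) (D' : E1 →ₗ[k] E0) (F0 : C0 →ₗ[k] E0) (F1 : C1 →ₗ[k] E1)
    (G0 : E0 →ₗ[k] C0) (G1 : E1 →ₗ[k] C1) (s : C0 →ₗ[k] C1) (t : E0 →ₗ[k] E1)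
    (hF : ∀ z, D' (F1 z) = F0 (D z)) (hG : ∀ z, D (G1 z) = G0 (D' z))
    (hs : ∀ z, D (s z) = G0 (F0 z) - z) (ht : ∀ z, D' (t z) = F0 (G0 z) - z) :
    Nonempty ((C0 ⧸ LinearMap.range D) ≃ₗ[k] (E0 ⧸ LinearMap.range D')) := by
  refine ⟨LinearEquiv.ofLinear
    (Submodule.mapQ _ _ F0 (by rintro _ ⟨z, rfl⟩; exact ⟨F1 z, hF z⟩))
    (Submodule.mapQ _ _ G0 (by rintro _ ⟨z, rfl⟩; exact ⟨G1 z, hG z⟩)) ?_ ?_⟩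
  · refine Submodule.linearMap_qext _ (LinearMap.ext fun z => ?_)
    exact (Submodule.Quotient.eq _).2 ⟨t z, ht z⟩
  · refine Submodule.linearMap_qext _ (LinearMap.ext fun z => ?_)
    exact (Submodule.Quotient.eq _).2 ⟨s z, hs z⟩

theorem homology_succ_iso {C2 C1 C0 E2 E1 E0 : Type*} [AddCommGroup C1] [Module k C1]
    [AddCommGroup C0] [Module k C0] [AddCommGroup E1] [Module k E1] [AddCommGroup E0] [Module k E0]
    [AddCommGroup C2] [Module k C2] [AddCommGroup E2] [Module k E2]
    (D : C1 →ₗ[k] C0) (D' : E1 →ₗ[k] E0) (DD : C2 →ₗ[k] C1) (DD' : E2 →ₗ[k] E1)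
    (F0 : C0 →ₗ[k] E0) (F1 : C1 →ₗ[k] E1) (F2 : C2 →ₗ[k] E2)
    (G0 : E0 →ₗ[k] C0) (G1 : E1 →ₗ[k] C1) (G2 : E2 →ₗ[k] C2)
    (s0 : C0 →ₗ[k] C1) (t0 : E0 →ₗ[k] E1) (s1 : C1 →ₗ[k] C2) (t1 : E1 →ₗ[k] E2)
    (hF0 : ∀ z, D' (F1 z) = F0 (D z)) (hG0 : ∀ z, D (G1 z) = G0 (D' z))
    (hF1 : ∀ z, DD' (F2 z) = F1 (DD z)) (hG1 : ∀ z, DD (G2 z) = G1 (DD' z))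
    (hs : ∀ z, DD (s1 z) + s0 (D z) = G1 (F1 z) - z)
    (ht : ∀ z, DD' (t1 z) + t0 (D' z) = F1 (G1 z) - z) :
    Nonempty ((↥(LinearMap.ker D) ⧸ (LinearMap.range DD).comap (LinearMap.ker D).subtype) ≃ₗ[k]
      (↥(LinearMap.ker D') ⧸ (LinearMap.range DD').comap (LinearMap.ker D').subtype)) := by
  refine ⟨LinearEquiv.ofLinear
    (Submodule.mapQ _ _ (F1.restrict (p := LinearMap.ker D) (q := LinearMap.ker D') (by
        intro z hz
        rw [LinearMap.mem_ker] at hz ⊢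
        rw [hF0, hz, map_zero])) (by
          rintro ⟨_, hy⟩ ⟨z, rfl⟩; exact ⟨F2 z, hF1 z⟩))
    (Submodule.mapQ _ _ (G1.restrict (p := LinearMap.ker D') (q := LinearMap.ker D) (by
        intro z hz
        rw [LinearMap.mem_ker] at hz ⊢
        rw [hG0, hz, map_zero])) (by
          rintro ⟨_, hy⟩ ⟨z, rfl⟩; exact ⟨G2 z, hG1 z⟩)) ?_ ?_⟩
  · refine Submodule.linearMap_qext _ (LinearMap.ext fun z => ?_)
    refine (Submodule.Quotient.eq _).2 ⟨t1 z, ?_⟩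
    have := ht z
    rw [LinearMap.mem_ker.1 z.2, map_zero, add_zero] at this
    exact this
  · refine Submodule.linearMap_qext _ (LinearMap.ext fun z => ?_)
    refine (Submodule.Quotient.eq _).2 ⟨s1 z, ?_⟩
    have := hs z
    rw [LinearMap.mem_ker.1 z.2, map_zero, add_zero] at this
    exact this

end HomologyIso

section Assemble

/-- Two projective resolutions of the same module give isomorphic homology after applying
`M ⊗_A -`. -/
theorem tor_unique {k A : Type*} [CommRing k] [Ring A] [Algebra k A]
    (M : Type*) [AddCommGroup M] [Module k M] [Module Aᵐᵒᵖ M]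
    {X : ℕ → Type*} [∀ n, AddCommGroup (X n)] [∀ n, Module k (X n)] [∀ n, Module A (X n)]
    [∀ n, IsScalarTower k A (X n)] [∀ n, Module.Projective A (X n)]
    {Y : ℕ → Type*} [∀ n, AddCommGroup (Y n)] [∀ n, Module k (Y n)] [∀ n, Module A (Y n)]
    [∀ n, IsScalarTower k A (Y n)] [∀ n, Module.Projective A (Y n)]
    {K : Type*} [AddCommGroup K] [Module A K]
    (dX : ∀ n, X (n + 1) →ₗ[A] X n) (dY : ∀ n, Y (n + 1) →ₗ[A] Y n)
    (eX : X 0 →ₗ[A] K) (eY : Y 0 →ₗ[A] K)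
    (hXs : Function.Surjective eX) (hYs : Function.Surjective eY)
    (hX0 : LinearMap.range (dX 0) = LinearMap.ker eX)
    (hX : ∀ n, LinearMap.range (dX (n + 1)) = LinearMap.ker (dX n))
    (hY0 : LinearMap.range (dY 0) = LinearMap.ker eY)
    (hY : ∀ n, LinearMap.range (dY (n + 1)) = LinearMap.ker (dY n))
    (D : ∀ n, CoinvTensor k A M (X (n + 1)) →ₗ[k] CoinvTensor k A M (X n))
    (hD : ∀ n m w, D n (CoinvTensor.mk k _ M _ (m ⊗ₜ[k] w)) =
      CoinvTensor.mk k _ M _ (m ⊗ₜ[k] dX n w))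
    (D' : ∀ n, CoinvTensor k A M (Y (n + 1)) →ₗ[k] CoinvTensor k A M (Y n))
    (hD' : ∀ n m w, D' n (CoinvTensor.mk k _ M _ (m ⊗ₜ[k] w)) =
      CoinvTensor.mk k _ M _ (m ⊗ₜ[k] dY n w)) :
    Nonempty ((CoinvTensor k A M (X 0) ⧸ LinearMap.range (D 0)) ≃ₗ[k]
        (CoinvTensor k A M (Y 0) ⧸ LinearMap.range (D' 0))) ∧
      ∀ n : ℕ,
        Nonempty
          ((↥(LinearMap.ker (D n)) ⧸
              (LinearMap.range (D (n + 1))).comap (LinearMap.ker (D n)).subtype) ≃ₗ[k]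
            (↥(LinearMap.ker (D' n)) ⧸
              (LinearMap.range (D' (n + 1))).comap (LinearMap.ker (D' n)).subtype)) := by
  have x0 : ∀ z, eX (dX 0 z) = 0 := fun z => by
    rw [← LinearMap.mem_ker, ← hX0]; exact ⟨z, rfl⟩
  have y0 : ∀ z, eY (dY 0 z) = 0 := fun z => by
    rw [← LinearMap.mem_ker, ← hY0]; exact ⟨z, rfl⟩
  have x1 : ∀ n z, dX n (dX (n + 1) z) = 0 := fun n z => by
    rw [← LinearMap.mem_ker, ← hX]; exact ⟨z, rfl⟩
  have y1 : ∀ n z, dY n (dY (n + 1) z) = 0 := fun n z => by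
    rw [← LinearMap.mem_ker, ← hY]; exact ⟨z, rfl⟩
  have x2 : ∀ z, eX z = 0 → z ∈ LinearMap.range (dX 0) := fun z hz => by rw [hX0]; exact hz
  have y2 : ∀ z, eY z = 0 → z ∈ LinearMap.range (dY 0) := fun z hz => by rw [hY0]; exact hz
  have x3 : ∀ n z, dX n z = 0 → z ∈ LinearMap.range (dX (n + 1)) := fun n z hz => by
    rw [hX]; exact hz
  have y3 : ∀ n z, dY n z = 0 → z ∈ LinearMap.range (dY (n + 1)) := fun n z hz => by
    rw [hY]; exact hz
  obtain ⟨f, f0, f1⟩ := comparison dX dY eX eY x0 x1 hYs y2 y3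
  obtain ⟨f', f0', f1'⟩ := comparison dY dX eY eX y0 y1 hXs x2 x3
  obtain ⟨s, s0, s1⟩ := null_homotopy dX dX x1 x3 (fun n => (f' n).comp (f n) - LinearMap.id)
    (fun z => x2 _ (by simp [f0', f0])) (fun n z => by simp [f1', f1])
  obtain ⟨t, t0, t1⟩ := null_homotopy dY dY y1 y3 (fun n => (f n).comp (f' n) - LinearMap.id)
    (fun z => y2 _ (by simp [f0', f0])) (fun n z => by simp [f1', f1])
  have cF : ∀ n z, D' n (coinvMap (k := k) M (f (n + 1)) z) = coinvMap (k := k) M (f n) (D n z) := by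
    intro n z
    refine coinv_ext M ((D' n).comp (coinvMap (k := k) M (f (n + 1))))
      ((coinvMap (k := k) M (f n)).comp (D n)) (fun m w => ?_) z
    simp only [LinearMap.comp_apply, coinvMap_mk, hD, hD', f1]
  have cG : ∀ n z, D n (coinvMap (k := k) M (f' (n + 1)) z) = coinvMap (k := k) M (f' n) (D' n z) := by
    intro n z
    refine coinv_ext M ((D n).comp (coinvMap (k := k) M (f' (n + 1))))
      ((coinvMap (k := k) M (f' n)).comp (D' n)) (fun m w => ?_) z
    simp only [LinearMap.comp_apply, coinvMap_mk, hD, hD', f1']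
  constructor
  · refine homology_zero_iso (D 0) (D' 0) (coinvMap M (f 0)) (coinvMap M (f 1)) (coinvMap M (f' 0))
      (coinvMap M (f' 1)) (coinvMap M (s 0)) (coinvMap M (t 0)) (cF 0) (cG 0) ?_ ?_
    · refine coinv_ext M ((D 0).comp (coinvMap M (s 0)))
        ((coinvMap M (f' 0)).comp (coinvMap M (f 0)) - LinearMap.id) (fun m w => ?_)
      simp only [LinearMap.comp_apply, coinvMap_mk, hD, LinearMap.sub_apply, LinearMap.id_apply, s0,
        coinv_mk_sub]
    · refine coinv_ext M ((D' 0).comp (coinvMap M (t 0)))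
        ((coinvMap M (f 0)).comp (coinvMap M (f' 0)) - LinearMap.id) (fun m w => ?_)
      simp only [LinearMap.comp_apply, coinvMap_mk, hD', LinearMap.sub_apply, LinearMap.id_apply, t0,
        coinv_mk_sub]
  · intro n
    refine homology_succ_iso (D n) (D' n) (D (n + 1)) (D' (n + 1))
      (coinvMap M (f n)) (coinvMap M (f (n + 1))) (coinvMap M (f (n + 2)))
      (coinvMap M (f' n)) (coinvMap M (f' (n + 1))) (coinvMap M (f' (n + 2)))
      (coinvMap M (s n)) (coinvMap M (t n)) (coinvMap M (s (n + 1))) (coinvMap M (t (n + 1)))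
      (cF n) (cG n) (cF (n + 1)) (cG (n + 1)) ?_ ?_
    · refine coinv_ext M ((D (n + 1)).comp (coinvMap M (s (n + 1))) + (coinvMap M (s n)).comp (D n))
        ((coinvMap M (f' (n + 1))).comp (coinvMap M (f (n + 1))) - LinearMap.id) (fun m w => ?_)
      simp only [LinearMap.comp_apply, coinvMap_mk, hD, LinearMap.sub_apply, LinearMap.add_apply,
        LinearMap.id_apply, ← coinv_mk_sub, ← coinv_mk_add, s1]
    · refine coinv_ext M
        ((D' (n + 1)).comp (coinvMap M (t (n + 1))) + (coinvMap M (t n)).comp (D' n))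
        ((coinvMap M (f (n + 1))).comp (coinvMap M (f' (n + 1))) - LinearMap.id) (fun m w => ?_)
      simp only [LinearMap.comp_apply, coinvMap_mk, hD', LinearMap.sub_apply, LinearMap.add_apply,
        LinearMap.id_apply, ← coinv_mk_sub, ← coinv_mk_add, t1]

end Assemble


theorem CE_homology_computes_Tor
    (k g : Type*) [Field k] [CharZero k] [LieRing g] [LieAlgebra k g]
    (M : Type*) [AddCommGroup M] [Module k M]
    [Module (UniversalEnvelopingAlgebra k g)ᵐᵒᵖ M]
    [IsScalarTower k (UniversalEnvelopingAlgebra k g)ᵐᵒᵖ M]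
    -- the Koszul complex `V•(g)` and its differential
    (d : ∀ n : ℕ,
      (UniversalEnvelopingAlgebra k g ⊗[k] ⋀[k]^(n + 1) g) →ₗ[UniversalEnvelopingAlgebra k g]
        (UniversalEnvelopingAlgebra k g ⊗[k] ⋀[k]^n g))
    (hd : ∀ (n : ℕ) (u : UniversalEnvelopingAlgebra k g) (v : Fin (n + 1) → g),
      d n (u ⊗ₜ[k] wedge k (n + 1) v) =
        (∑ i : Fin (n + 1),
            ((-1 : k) ^ (i : ℕ)) •
              ((u * UniversalEnvelopingAlgebra.ι k (v i)) ⊗ₜ[k] wedge k n (v ∘ i.succAbove))) +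
          ∑ p : Fin (n + 1) × Fin (n + 1),
            if p.1 < p.2 then
              ((-1 : k) ^ ((p.1 : ℕ) + (p.2 : ℕ))) •
                (u ⊗ₜ[k] wedge k n (consRemove2 ⁅v p.1, v p.2⁆ v p.1 p.2))
            else 0)
    -- the induced differential on `M ⊗_{U(g)} V•(g)`
    (D : ∀ n : ℕ,
      CoinvTensor k (UniversalEnvelopingAlgebra k g) M
          (UniversalEnvelopingAlgebra k g ⊗[k] ⋀[k]^(n + 1) g) →ₗ[k]
        CoinvTensor k (UniversalEnvelopingAlgebra k g) M
          (UniversalEnvelopingAlgebra k g ⊗[k] ⋀[k]^n g))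
    (hD : ∀ (n : ℕ) (m : M) (w : UniversalEnvelopingAlgebra k g ⊗[k] ⋀[k]^(n + 1) g),
      D n (CoinvTensor.mk k _ M _ (m ⊗ₜ[k] w)) = CoinvTensor.mk k _ M _ (m ⊗ₜ[k] d n w))
    -- an arbitrary projective resolution `P•` of the trivial left `U(g)`-module `k`
    (P : ℕ → Type*) [∀ n, AddCommGroup (P n)] [∀ n, Module k (P n)]
    [∀ n, Module (UniversalEnvelopingAlgebra k g) (P n)]
    [∀ n, IsScalarTower k (UniversalEnvelopingAlgebra k g) (P n)]
    [∀ n, Module.Projective (UniversalEnvelopingAlgebra k g) (P n)]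
    (dP : ∀ n : ℕ, P (n + 1) →ₗ[UniversalEnvelopingAlgebra k g] P n)
    (ε : UniversalEnvelopingAlgebra k g →ₐ[k] k)
    (hε : ∀ x : g, ε (UniversalEnvelopingAlgebra.ι k x) = 0)
    (eP : P 0 →ₗ[k] k)
    (hePlin : ∀ (a : UniversalEnvelopingAlgebra k g) (y : P 0), eP (a • y) = ε a * eP y)
    (hPsurj : Function.Surjective eP)
    (hPexact0 : LinearMap.range ((dP 0).restrictScalars k) = LinearMap.ker eP)
    (hPexact : ∀ n : ℕ, LinearMap.range (dP (n + 1)) = LinearMap.ker (dP n))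
    -- the induced differential on `M ⊗_{U(g)} P•`
    (DP : ∀ n : ℕ,
      CoinvTensor k (UniversalEnvelopingAlgebra k g) M (P (n + 1)) →ₗ[k]
        CoinvTensor k (UniversalEnvelopingAlgebra k g) M (P n))
    (hDP : ∀ (n : ℕ) (m : M) (w : P (n + 1)),
      DP n (CoinvTensor.mk k _ M _ (m ⊗ₜ[k] w)) = CoinvTensor.mk k _ M _ (m ⊗ₜ[k] dP n w)) :
    -- `H₀(M ⊗_{U(g)} V•(g)) ≅ H₀(M ⊗_{U(g)} P•) = Tor₀^{U(g)}(M, k)`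
    Nonempty
      ((CoinvTensor k (UniversalEnvelopingAlgebra k g) M
            (UniversalEnvelopingAlgebra k g ⊗[k] ⋀[k]^0 g) ⧸
          LinearMap.range (D 0)) ≃ₗ[k]
        (CoinvTensor k (UniversalEnvelopingAlgebra k g) M (P 0) ⧸ LinearMap.range (DP 0))) ∧
      -- `Hₙ₊₁(M ⊗_{U(g)} V•(g)) ≅ Hₙ₊₁(M ⊗_{U(g)} P•) = Torₙ₊₁^{U(g)}(M, k)`
      ∀ n : ℕ,
        Nonempty
          ((↥(LinearMap.ker (D n)) ⧸
              (LinearMap.range (D (n + 1))).comap (LinearMap.ker (D n)).subtype) ≃ₗ[k]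
            (↥(LinearMap.ker (DP n)) ⧸
              (LinearMap.range (DP (n + 1))).comap (LinearMap.ker (DP n)).subtype)) := by
  letI : Module (UniversalEnvelopingAlgebra k g) k := Module.compHom k ε.toRingHom
  have hsm : ∀ (a : UniversalEnvelopingAlgebra k g) (c : k), a • c = ε a * c := fun _ _ => rfl
  have hK : IsKoszul (k := k) (g := g) d := hd
  let eX : (UniversalEnvelopingAlgebra k g ⊗[k] ⋀[k]^0 g) →ₗ[UniversalEnvelopingAlgebra k g] k :=
    { toFun := eV ε
      map_add' := map_add _
      map_smul' := fun a z => eV_lin ε a z }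
  let eY : P 0 →ₗ[UniversalEnvelopingAlgebra k g] k :=
    { toFun := eP
      map_add' := map_add _
      map_smul' := fun a z => hePlin a z }
  refine tor_unique M (X := fun n => UniversalEnvelopingAlgebra k g ⊗[k] ⋀[k]^n g) (Y := P)
    d dP eX eY (eV_surj ε) hPsurj ?_ (koszul_exact_succ hK) ?_ hPexact D hD DP hDP
  · ext z
    have := SetLike.ext_iff.1 (koszul_exact_zero hK ε hε) z
    exact this
  · ext z
    have := SetLike.ext_iff.1 hPexact0 z
    exact this
end

section
/- Let k be a field of characteristic 0 and g a Lie algebra over k. For every left U(g)-module M and every n ≥ 0, the n-th cohomology of the cochain complex Hom_{U(g)}(V•(g), M) is k-linearly isomorphic to Extⁿ_{U(g)}(k, M), where k is the trivial left U(g)-module. In particular the cohomology of the cohomological Chevalley–Eilenberg complex CE^•(g;M) := Hom_{U(g)}(V•(g), M) computes the Lie algebra cohomology H^•(g;M) = Ext^•_{U(g)}(k, M). -/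
/-!
STATEMENT 5: for a Lie algebra `g` over a field `k` of characteristic `0` and a left
`U(g)`-module `M`, the `n`-th cohomology of the cochain complex `Hom_{U(g)}(V•(g), M)` is
`k`-linearly isomorphic to `Extⁿ_{U(g)}(k, M)` (where `k` is the trivial `U(g)`-module given by
the augmentation `ε`); i.e. the cohomological Chevalley–Eilenberg complex
`CE^•(g;M) := Hom_{U(g)}(V•(g), M)` computes the Lie algebra cohomology
`H^•(g;M) = Ext^•_{U(g)}(k, M)`.

Since `Extⁿ_{U(g)}(k, M)` is computed from an arbitrary projective resolution of `k` by left
`U(g)`-modules, the statement is formalized as: for every projective resolution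
`⋯ → P₁ → P₀ →^{eP} k → 0` of the trivial module `k`, the cohomology of
`Hom_{U(g)}(V•(g), M)` is `k`-linearly isomorphic, in every degree `n ≥ 0`, to the cohomology
of `Hom_{U(g)}(P•, M)`.  The coboundaries are precomposition (`precomp`) with the
differentials, cohomology in degree `0` is the kernel of the first coboundary and in degree
`n + 1` it is `ker / im` as usual.  The Koszul differential `d` is pinned down by its standard
defining formula `hd` on the generators `u ⊗ g₁∧⋯∧gₙ` (`0`-indexed), with
`d n : Vₙ₊₁(g) → Vₙ(g)`.
-/

open TensorProduct

set_option synthInstance.maxHeartbeats 1000000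
set_option maxHeartbeats 1000000

/-- Precomposition with an `A`-linear map `f : N' → N`, as a `k`-linear map
`Hom_A(N, M) → Hom_A(N', M)`: the coboundary of the cochain complex `Hom_A(resolution, M)`. -/
def precomp (k : Type*) {A N N' : Type*} (M : Type*) [CommRing k] [Ring A] [Algebra k A]
    [AddCommGroup M] [Module k M] [Module A M] [IsScalarTower k A M]
    [AddCommGroup N] [Module A N] [AddCommGroup N'] [Module A N']
    (f : N' →ₗ[A] N) : (N →ₗ[A] M) →ₗ[k] (N' →ₗ[A] M) where
  toFun φ := φ.comp f
  map_add' φ ψ := by ext; simp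
  map_smul' c φ := by ext; simp



section CEproof
set_option linter.unusedSimpArgs false
set_option linter.unusedVariables false
attribute [local instance] LieRing.ofAssociativeRing

namespace CEK
variable {k g : Type*} [Field k] [LieRing g] [LieAlgebra k g]

local notation "UU" => UniversalEnvelopingAlgebra k g
local notation "EE" => ExteriorAlgebra k g
local notation "VV" => UniversalEnvelopingAlgebra k g ⊗[k] ExteriorAlgebra k g
local notation "ιU" => UniversalEnvelopingAlgebra.ι k
local notation "ιE" => ExteriorAlgebra.ι k
local notation "ιL" => LieHom.toLinearMap (UniversalEnvelopingAlgebra.ι k : g →ₗ⁅k⁆ UniversalEnvelopingAlgebra k g)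

theorem swapE (x y : g) (w : EE) : ιE x * (ιE y * w) = - (ιE y * (ιE x * w)) := by
  have h := ExteriorAlgebra.ι_add_mul_swap (R := k) x y
  have h2 : (ιE x * ιE y) * w + (ιE y * ιE x) * w = 0 := by rw [← add_mul, h, zero_mul]
  rw [mul_assoc, mul_assoc] at h2
  exact eq_neg_of_add_eq_zero_left h2

theorem sqE (x : g) (w : EE) : ιE x * (ιE x * w) = 0 := by
  rw [← mul_assoc, ExteriorAlgebra.ι_sq_zero, zero_mul]

/-- the folding step for the Lie derivative -/
noncomputable def Lstep (x : g) : g →ₗ[k] EE × EE →ₗ[k] EE :=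
  LinearMap.mk₂ k (fun y p => ιE ⁅x, y⁆ * p.1 + ιE y * p.2)
    (by intro a b p; simp only [lie_add, map_add, add_mul]; abel)
    (by intro c a p; simp only [lie_smul, map_smul, smul_mul_assoc, smul_add])
    (by intro a p q; simp only [Prod.fst_add, Prod.snd_add, mul_add]; abel)
    (by intro c a p; simp only [Prod.smul_fst, Prod.smul_snd, mul_smul_comm, smul_add])

/-- the Lie derivative on the exterior algebra -/
noncomputable def L0 (x : g) : EE →ₗ[k] EE :=
  CliffordAlgebra.foldr' _ (Lstep (k := k) x) (by
    intro m w fx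
    simp only [Lstep, LinearMap.mk₂_apply]
    change ιE ⁅x, m⁆ * (ιE m * w) + ιE m * (ιE ⁅x, m⁆ * w + ιE m * fx) = _
    rw [mul_add, sqE, swapE]; simp) 0

theorem L0_one (x : g) : L0 (k := k) x 1 = 0 := by
  have := CliffordAlgebra.foldr'_algebraMap (0 : QuadraticForm k g) (Lstep (k := k) x) (by
    intro m w fx
    simp only [Lstep, LinearMap.mk₂_apply]
    change ιE ⁅x, m⁆ * (ιE m * w) + ιE m * (ιE ⁅x, m⁆ * w + ιE m * fx) = _
    rw [mul_add, sqE, swapE]; simp) 0 1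
  rw [map_one, one_smul] at this
  exact this

theorem L0_mul (x y : g) (w : EE) :
    L0 (k := k) x (ιE y * w) = ιE ⁅x, y⁆ * w + ιE y * L0 x w := by
  unfold L0
  rw [CliffordAlgebra.foldr'_ι_mul]
  simp only [Lstep, LinearMap.mk₂_apply]

theorem extE {N : Type*} [AddCommGroup N] [Module k N] {A B : EE →ₗ[k] N}
    (h1 : A 1 = B 1) (h2 : ∀ (y : g) w, A w = B w → A (ιE y * w) = B (ιE y * w)) : A = B := by
  apply LinearMap.ext
  intro w
  induction w using CliffordAlgebra.left_induction with
  | algebraMap r => rw [Algebra.algebraMap_eq_smul_one, map_smul, map_smul, h1]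
  | add x y hx hy => rw [map_add, map_add, hx, hy]
  | ι_mul x m hx => exact h2 _ _ hx

/-- the Lie derivative, linear in the Lie algebra element -/
noncomputable def L : g →ₗ[k] EE →ₗ[k] EE where
  toFun := L0
  map_add' x y := by
    apply extE
    · simp [L0_one]
    · intro z w h
      simp only [LinearMap.add_apply] at h ⊢
      rw [L0_mul, L0_mul, L0_mul, h, add_lie, map_add, add_mul, mul_add]; abel
  map_smul' c x := by
    apply extE
    · simp [L0_one]
    · intro z w h
      simp only [LinearMap.smul_apply, RingHom.id_apply] at h ⊢
      rw [L0_mul, L0_mul, h, smul_lie, map_smul, smul_mul_assoc, mul_smul_comm, smul_add]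

theorem L_one (x : g) : L (k := k) x 1 = 0 := L0_one x
theorem L_mul (x y : g) (w : EE) :
    L (k := k) x (ιE y * w) = ιE ⁅x, y⁆ * w + ιE y * L x w := L0_mul x y w

theorem L_lie (x y : g) (w : EE) : L (k := k) ⁅x, y⁆ w = L x (L y w) - L y (L x w) := by
  have : (L (k := k) ⁅x, y⁆) = L x ∘ₗ L y - L y ∘ₗ L x := by
    apply extE
    · simp [L_one]
    · intro z w h
      simp only [LinearMap.sub_apply, LinearMap.comp_apply] at h ⊢
      simp only [L_mul, map_add, h, lie_lie, map_sub, sub_mul, mul_sub]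
      abel
  rw [this]; rfl

theorem pow_ind {n : ℕ} {S : Submodule k EE}
    (h : ∀ (y : g) (w : EE), w ∈ ⋀[k]^n g → ιE y * w ∈ S) : ⋀[k]^(n + 1) g ≤ S := by
  have h0 : ⋀[k]^(n + 1) g = LinearMap.range (ExteriorAlgebra.ι k (M := g)) * ⋀[k]^n g :=
    pow_succ' _ _
  rw [h0, Submodule.mul_le]
  rintro _ ⟨y, rfl⟩ w hw
  exact h y w hw

theorem mul_mem_pow {n : ℕ} (y : g) {w : EE} (hw : w ∈ ⋀[k]^n g) :
    ιE y * w ∈ ⋀[k]^(n + 1) g := by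
  have h0 : ⋀[k]^(n + 1) g = LinearMap.range (ExteriorAlgebra.ι k (M := g)) * ⋀[k]^n g :=
    pow_succ' _ _
  rw [h0]
  exact Submodule.mul_mem_mul ⟨y, rfl⟩ hw

theorem pow_zero_ind {S : Submodule k EE} (h : (1 : EE) ∈ S) : ⋀[k]^0 g ≤ S := by
  have h0 : ⋀[k]^0 g = 1 := pow_zero _
  rw [h0, Submodule.one_le]
  exact h

theorem one_mem_pow : (1 : EE) ∈ ⋀[k]^0 g := by
  have h0 : ⋀[k]^0 g = 1 := pow_zero _
  rw [h0]
  exact Submodule.one_le.mp le_rfl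

theorem L_le (x : g) (n : ℕ) : (⋀[k]^n g) ≤ (⋀[k]^n g).comap (L (k := k) x) := by
  induction n with
  | zero => exact pow_zero_ind (by simp [L_one])
  | succ n ih =>
    apply pow_ind
    intro y w hw
    rw [Submodule.mem_comap, L_mul]
    exact add_mem (mul_mem_pow _ hw) (mul_mem_pow _ (ih hw))

theorem L_mem (x : g) (n : ℕ) {w : EE} (hw : w ∈ ⋀[k]^n g) : L (k := k) x w ∈ ⋀[k]^n g :=
  L_le x n hw

/-- wedge with `x` from the left -/
noncomputable def e (x : g) : VV →ₗ[k] VV := LinearMap.lTensor _ (LinearMap.mulLeft k (ιE x))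
/-- right multiplication on the first factor -/
noncomputable def R (x : g) : VV →ₗ[k] VV := LinearMap.rTensor _ (LinearMap.mulRight k (ιU x))
/-- Lie derivative on second factor -/
noncomputable def Lam (x : g) : VV →ₗ[k] VV := LinearMap.lTensor _ (L x)

@[simp] theorem e_tmul (x : g) (u : UU) (w : EE) : e x (u ⊗ₜ[k] w) = u ⊗ₜ (ιE x * w) := rfl
@[simp] theorem R_tmul (x : g) (u : UU) (w : EE) : R x (u ⊗ₜ[k] w) = (u * ιU x) ⊗ₜ w := rfl
@[simp] theorem Lam_tmul (x : g) (u : UU) (w : EE) : Lam x (u ⊗ₜ[k] w) = u ⊗ₜ L x w := rfl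

theorem e_add (x y : g) (z : VV) : e (x + y) z = e x z + e y z := by
  have : e (k := k) (x + y) = e x + e y := by
    ext; simp [add_mul, tmul_add]
  rw [this]; rfl
theorem e_smul (c : k) (x : g) (z : VV) : e (c • x) z = c • e x z := by
  have : e (k := k) (c • x) = c • e x := by
    ext; simp 
  rw [this]; rfl
theorem e_e (x y : g) (z : VV) : e x (e y z) = - e y (e x z) := by
  have : e (k := k) x ∘ₗ e y = - e y ∘ₗ e x := by
    apply TensorProduct.ext'
    intro u w
    simp only [LinearMap.comp_apply, LinearMap.neg_apply, e_tmul, swapE x y w, tmul_neg]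
  exact LinearMap.congr_fun this z
theorem e_self (x : g) (z : VV) : e x (e x z) = 0 := by
  have : e (k := k) x ∘ₗ e x = 0 := by
    ext u w; simp [sqE]
  exact LinearMap.congr_fun this z
theorem e_Lam (x y : g) (z : VV) : Lam x (e y z) = e ⁅x, y⁆ z + e y (Lam x z) := by
  have : Lam (k := k) x ∘ₗ e y = e ⁅x, y⁆ + e y ∘ₗ Lam x := by
    ext u w; simp [L_mul, tmul_add]
  exact LinearMap.congr_fun this z
theorem e_R (x y : g) (z : VV) : R x (e y z) = e y (R x z) := by
  have : R (k := k) x ∘ₗ e y = e y ∘ₗ R x := by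
    ext u w; simp
  exact LinearMap.congr_fun this z
theorem R_Lam (x y : g) (z : VV) : R x (Lam y z) = Lam y (R x z) := by
  have : R (k := k) x ∘ₗ Lam y = Lam y ∘ₗ R x := by
    ext u w; simp
  exact LinearMap.congr_fun this z
theorem R_lie (x y : g) (z : VV) : R ⁅x, y⁆ z = R y (R x z) - R x (R y z) := by
  have : R (k := k) ⁅x, y⁆ = R y ∘ₗ R x - R x ∘ₗ R y := by
    ext u w; simp [LieRing.of_associative_ring_bracket, mul_sub, sub_tmul, mul_assoc]
  exact LinearMap.congr_fun this z
theorem Lam_lie (x y : g) (z : VV) : Lam ⁅x, y⁆ z = Lam x (Lam y z) - Lam y (Lam x z) := by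
  have : Lam (k := k) ⁅x, y⁆ = Lam x ∘ₗ Lam y - Lam y ∘ₗ Lam x := by
    ext u w; simp [L_lie, tmul_sub]
  exact LinearMap.congr_fun this z

theorem extV {N : Type*} [AddCommGroup N] [Module k N] {A B : VV →ₗ[k] N}
    (h1 : ∀ u : UU, A (u ⊗ₜ 1) = B (u ⊗ₜ 1))
    (h2 : ∀ (y : g) z, A z = B z → A (e y z) = B (e y z)) : A = B := by
  apply TensorProduct.ext'
  intro u w
  have : A ∘ₗ (TensorProduct.mk k UU EE u) = B ∘ₗ (TensorProduct.mk k UU EE u) := by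
    apply extE
    · exact h1 u
    · intro y w h
      exact h2 y _ h
  exact LinearMap.congr_fun this w

/-- the folding step for the differential -/
noncomputable def dstep : g →ₗ[k] EE × VV →ₗ[k] VV :=
  LinearMap.mk₂ k (fun x p => ιU x ⊗ₜ p.1 - 1 ⊗ₜ L x p.1 - e x p.2)
    (by intro a b p
        simp only [map_add, LinearMap.add_apply, add_tmul, tmul_add, e_add]; abel)
    (by intro c a p
        simp only [map_smul, LinearMap.smul_apply, tmul_smul, smul_tmul', e_smul, smul_sub])
    (by intro a p q
        simp only [Prod.fst_add, Prod.snd_add, map_add, tmul_add]; abel)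
    (by intro c a p
        simp only [Prod.smul_fst, Prod.smul_snd, map_smul, tmul_smul, smul_sub])

theorem dstep_apply (x : g) (w : EE) (z : VV) :
    dstep x (w, z) = ιU x ⊗ₜ w - 1 ⊗ₜ L x w - e x z := rfl

theorem dstep_sq (m : g) (w : EE) (fx : VV) :
    dstep m (CliffordAlgebra.ι (0 : QuadraticForm k g) m * w, dstep m (w, fx)) =
      (0 : QuadraticForm k g) m • fx := by
  rw [dstep_apply, dstep_apply]
  simp only [map_sub, e_tmul, e_self, L_mul, lie_self, map_zero, zero_mul, zero_add, sub_zero]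
  simp

/-- the differential on `1 ⊗ w` -/
noncomputable def del : EE →ₗ[k] VV := CliffordAlgebra.foldr' _ dstep dstep_sq 0

theorem del_one : del (k := k) (g := g) 1 = 0 := by
  have := CliffordAlgebra.foldr'_algebraMap (0 : QuadraticForm k g) dstep dstep_sq 0 1
  rw [map_one, one_smul] at this
  exact this

theorem del_mul (x : g) (w : EE) :
    del (ιE x * w) = ιU x ⊗ₜ w - 1 ⊗ₜ L x w - e x (del w) := by
  unfold del
  rw [CliffordAlgebra.foldr'_ι_mul, dstep_apply]

/-- left multiplication on the first factor -/
noncomputable def lm : UU →ₗ[k] VV →ₗ[k] VV :=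
  LinearMap.mk₂ k (fun u z => LinearMap.rTensor _ (LinearMap.mulLeft k u) z)
    (by intro a b z
        rw [← LinearMap.add_apply, ← LinearMap.rTensor_add]
        congr 2; ext; simp [add_mul])
    (by intro a b z
        rw [← LinearMap.smul_apply, ← LinearMap.rTensor_smul]
        congr 2; ext; simp)
    (by intros; simp) (by intros; simp)

@[simp] theorem lm_tmul (a u : UU) (w : EE) : lm a (u ⊗ₜ[k] w) = (a * u) ⊗ₜ w := rfl
theorem lm_e (a : UU) (x : g) (z : VV) : lm a (e x z) = e x (lm a z) := by
  have : lm a ∘ₗ e x = e x ∘ₗ lm a := by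
    apply TensorProduct.ext'; intro u w; simp
  exact LinearMap.congr_fun this z

/-- the total Koszul differential -/
noncomputable def d : VV →ₗ[k] VV := TensorProduct.lift (lm.compl₂ del)

theorem d_tmul (u : UU) (w : EE) : d (u ⊗ₜ[k] w) = lm u (del w) := rfl

theorem d_one (u : UU) : d (u ⊗ₜ[k] (1 : EE)) = 0 := by rw [d_tmul, del_one, map_zero]

/-- Cartan's formula -/
theorem d_e (x : g) (z : VV) : d (e x z) = R x z - Lam x z - e x (d z) := by
  have : d ∘ₗ e x = R (k := k) x - Lam x - e x ∘ₗ d := by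
    apply TensorProduct.ext'; intro u w
    simp only [LinearMap.comp_apply, e_tmul, LinearMap.sub_apply, R_tmul, Lam_tmul, d_tmul, del_mul,
      map_sub, lm_tmul, mul_one, lm_e]
  exact LinearMap.congr_fun this z

theorem d_T (x : g) (z : VV) : d (R x z) - d (Lam x z) = R x (d z) - Lam x (d z) := by
  have : d ∘ₗ (R (k := k) x - Lam x) = (R x - Lam x) ∘ₗ d := by
    apply extV
    · intro u
      simp [d_one, L_one]
    · intro y z h
      simp only [LinearMap.comp_apply, LinearMap.sub_apply, map_sub] at h ⊢
      have h' : d (R x z) = d (Lam x z) + (R x (d z) - Lam x (d z)) := by rw [← h]; abel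
      simp only [e_Lam, e_R, d_e, map_add, map_sub, h', R_lie, Lam_lie, R_Lam]
      abel
  have := LinearMap.congr_fun this z
  simpa using this

theorem d_d (z : VV) : d (d z) = 0 := by
  have : d ∘ₗ d = (0 : VV →ₗ[k] VV) := by
    apply extV
    · intro u; simp [d_one]
    · intro y z h
      simp only [LinearMap.comp_apply, LinearMap.zero_apply] at h ⊢
      simp only [d_e, map_sub, h, map_zero]
      have := d_T y z
      rw [this]; abel
  exact LinearMap.congr_fun this z


/-- the standard filtration, shifted by one -/
noncomputable def Fil : ℕ → Submodule k UU
  | 0 => ⊥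
  | 1 => Submodule.span k {1}
  | (n + 2) => Fil (n + 1) ⊔ Fil (n + 1) * LinearMap.range ιL

theorem Fil_mono1 (p : ℕ) : Fil (k := k) (g := g) p ≤ Fil (p + 1) := by
  match p with
  | 0 => exact bot_le
  | (n + 1) => exact le_sup_left

theorem Fil_mul {p : ℕ} {u : UU} (hu : u ∈ Fil p) (y : g) : u * ιU y ∈ Fil (p + 1) := by
  match p with
  | 0 =>
    have : u = 0 := hu
    rw [this, zero_mul]; exact zero_mem _
  | (n + 1) => exact (le_sup_right : _ ≤ Fil (n + 2)) (Submodule.mul_mem_mul hu ⟨y, rfl⟩)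

theorem Fil_ind {S : ℕ → Submodule k UU} (h0 : (1 : UU) ∈ S 0)
    (h1 : ∀ p, S p ≤ S (p + 1))
    (h2 : ∀ p, Fil (p + 1) ≤ S p → ∀ u ∈ Fil (p + 1), ∀ y : g, u * ιU y ∈ S (p + 1)) (p : ℕ) :
    Fil (p + 1) ≤ S p := by
  induction p with
  | zero =>
    change Submodule.span k {1} ≤ _
    rw [Submodule.span_le]; simpa using h0
  | succ p ih =>
    change Fil (p + 1) ⊔ Fil (p + 1) * LinearMap.range ιL ≤ _
    refine sup_le (ih.trans (h1 p)) ?_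
    rw [Submodule.mul_le]
    rintro u hu _ ⟨y, rfl⟩
    exact h2 p ih u hu y

/-- tensor product of submodules -/
noncomputable def TF {N : Type*} [AddCommGroup N] [Module k N] (A : Submodule k UU)
    (B : Submodule k N) : Submodule k (UU ⊗[k] N) := Submodule.map₂ (TensorProduct.mk k UU N) A B

section
variable {N N' : Type*} [AddCommGroup N] [Module k N] [AddCommGroup N'] [Module k N']

theorem TF_le {A : Submodule k UU} {B : Submodule k N} {S : Submodule k (UU ⊗[k] N)}
    (h : ∀ u ∈ A, ∀ w ∈ B, u ⊗ₜ w ∈ S) : TF A B ≤ S := Submodule.map₂_le.mpr h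

theorem tmul_mem_TF {A : Submodule k UU} {B : Submodule k N} {u : UU} {w : N} (hu : u ∈ A)
    (hw : w ∈ B) : u ⊗ₜ[k] w ∈ TF A B := Submodule.apply_mem_map₂ _ hu hw

theorem TF_map {A : Submodule k UU} {B : Submodule k N} {S : Submodule k N'}
    (f : UU ⊗[k] N →ₗ[k] N') (h : ∀ u ∈ A, ∀ w ∈ B, f (u ⊗ₜ w) ∈ S) {z : UU ⊗[k] N}
    (hz : z ∈ TF A B) : f z ∈ S :=
  (TF_le (S := S.comap f) h) hz

theorem TF_mono {A A' : Submodule k UU} {B : Submodule k N} (h : A ≤ A') : TF A B ≤ TF A' B :=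
  TF_le fun _ hu _ hw => tmul_mem_TF (h hu) hw

theorem TF_top : TF (⊤ : Submodule k UU) (⊤ : Submodule k N) = ⊤ := by
  unfold TF
  exact TensorProduct.map₂_mk_top_top_eq_top _ _ _
end

/-- the comultiplication -/
noncomputable def Dl : UU →ₐ[k] UU ⊗[k] UU :=
  UniversalEnvelopingAlgebra.lift k
    { toFun := fun x => ιU x ⊗ₜ 1 + 1 ⊗ₜ ιU x
      map_add' := by intro x y; simp only [map_add, add_tmul, tmul_add]; abel
      map_smul' := by intro c x; simp only [map_smul, smul_tmul', tmul_smul, smul_add, RingHom.id_apply]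
      map_lie' := by
        intro x y
        simp only [LieHom.map_lie, LieRing.of_associative_ring_bracket, add_mul, mul_add,
          Algebra.TensorProduct.tmul_mul_tmul, mul_one, one_mul, sub_tmul, tmul_sub]
        abel }

theorem Dl_ι (x : g) : Dl (ιU x) = ιU x ⊗ₜ 1 + 1 ⊗ₜ ιU x := by
  unfold Dl
  rw [UniversalEnvelopingAlgebra.lift_ι_apply]; rfl

theorem Dl_mem (p : ℕ) {u : UU} (hu : u ∈ Fil (p + 1)) : Dl u - u ⊗ₜ 1 ∈ TF (Fil p) ⊤ := by
  have key := Fil_ind (S := fun p => (TF (Fil p) ⊤).comap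
    (Dl.toLinearMap - (TensorProduct.mk k UU UU).flip 1)) (by simp [Algebra.TensorProduct.one_def])
    (fun p => Submodule.comap_mono (TF_mono (Fil_mono1 p))) (by
    intro p ih u hu y
    have h := ih hu
    simp only [Submodule.mem_comap, LinearMap.sub_apply, AlgHom.toLinearMap_apply,
      LinearMap.flip_apply, TensorProduct.mk_apply] at h ⊢
    have e1 : Dl (u * ιU y) - (u * ιU y) ⊗ₜ[k] (1 : UU) =
      (Dl u - u ⊗ₜ 1) * (ιU y ⊗ₜ 1) + ((Dl u - u ⊗ₜ 1) * (1 ⊗ₜ ιU y) + u ⊗ₜ ιU y) := by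
      rw [map_mul, Dl_ι, mul_add, sub_mul, sub_mul, Algebra.TensorProduct.tmul_mul_tmul,
        Algebra.TensorProduct.tmul_mul_tmul, mul_one, mul_one, one_mul]
      abel
    rw [e1]
    refine add_mem ?_ (add_mem ?_ (tmul_mem_TF hu trivial))
    · refine TF_map (LinearMap.mulRight k (ιU y ⊗ₜ[k] (1 : UU))) ?_ h
      intro a ha b _
      simp only [LinearMap.mulRight_apply, Algebra.TensorProduct.tmul_mul_tmul]
      exact tmul_mem_TF (Fil_mul ha y) trivial
    · refine TF_map (LinearMap.mulRight k ((1 : UU) ⊗ₜ[k] (ιU y))) ?_ h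
      intro a ha b _
      simp only [LinearMap.mulRight_apply, Algebra.TensorProduct.tmul_mul_tmul, mul_one]
      exact tmul_mem_TF (Fil_mono1 _ ha) trivial) p
  exact key hu

/-- the derivative -/
noncomputable def D (π : UU →ₗ[k] g) : UU →ₗ[k] UU ⊗[k] g :=
  LinearMap.lTensor _ π ∘ₗ Dl.toLinearMap

/-- right multiplication on `U ⊗ g` -/
noncomputable def Rg (y : g) : UU ⊗[k] g →ₗ[k] UU ⊗[k] g :=
  LinearMap.rTensor _ (LinearMap.mulRight k (ιU y))

theorem Rg_tmul (y : g) (u : UU) (x : g) : Rg y (u ⊗ₜ[k] x) = (u * ιU y) ⊗ₜ x := rfl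

theorem D_mul (π : UU →ₗ[k] g) (hπ : ∀ x, π (ιU x) = x) {p : ℕ} {u : UU}
    (hu : u ∈ Fil (p + 1)) (y : g) :
    D π (u * ιU y) - Rg y (D π u) - u ⊗ₜ y ∈ TF (Fil p) ⊤ := by
  have h := Dl_mem p hu
  have e1 : D π (u * ιU y) - Rg y (D π u) - u ⊗ₜ y =
      LinearMap.lTensor _ π ((Dl u - u ⊗ₜ 1) * (1 ⊗ₜ ιU y)) := by
    have e2 : Rg y ∘ₗ LinearMap.lTensor _ π =
        LinearMap.lTensor _ π ∘ₗ LinearMap.mulRight k (ιU y ⊗ₜ[k] (1 : UU)) := by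
      apply TensorProduct.ext'; intro a b
      simp [Rg_tmul]
    have e3 := LinearMap.congr_fun e2 (Dl u)
    simp only [LinearMap.comp_apply, LinearMap.mulRight_apply] at e3
    simp only [D, LinearMap.comp_apply, AlgHom.toLinearMap_apply, e3]
    rw [map_mul, Dl_ι, mul_add, sub_mul, map_add, map_sub, Algebra.TensorProduct.tmul_mul_tmul,
       mul_one, one_mul, LinearMap.lTensor_tmul, hπ]
    abel
  rw [e1]
  refine TF_map (LinearMap.lTensor _ π ∘ₗ LinearMap.mulRight k ((1 : UU) ⊗ₜ[k] (ιU y))) ?_ h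
  intro a ha b _
  simp only [LinearMap.comp_apply, LinearMap.mulRight_apply, Algebra.TensorProduct.tmul_mul_tmul,
    mul_one, LinearMap.lTensor_tmul]
  exact tmul_mem_TF ha trivial

theorem D_one (π : UU →ₗ[k] g) (h1 : π 1 = 0) : D π 1 = 0 := by
  simp [D, Algebra.TensorProduct.one_def, h1]

theorem D_mem (π : UU →ₗ[k] g) (h1 : π 1 = 0) (hπ : ∀ x, π (ιU x) = x) {p : ℕ} {u : UU}
    (hu : u ∈ Fil (p + 1)) : D π u ∈ TF (Fil p) ⊤ := by
  have key := Fil_ind (S := fun p => (TF (Fil p) ⊤).comap (D π)) (by simp [D_one π h1])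
    (fun p => Submodule.comap_mono (TF_mono (Fil_mono1 p))) (by
    intro p ih u hu y
    have h := D_mul π hπ hu y
    rw [Submodule.mem_comap]
    have e1 : D π (u * ιU y) = (D π (u * ιU y) - Rg y (D π u) - u ⊗ₜ y) + Rg y (D π u) + u ⊗ₜ y := by
      abel
    rw [e1]
    refine add_mem (add_mem (TF_mono (Fil_mono1 p) h) ?_) (tmul_mem_TF hu trivial)
    refine TF_map (Rg y) ?_ (ih hu)
    intro a ha b _
    exact tmul_mem_TF (Fil_mul ha y) trivial) p
  exact key hu

/-- multiplication `U ⊗ g → U` -/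
noncomputable def mu : UU ⊗[k] g →ₗ[k] UU :=
  TensorProduct.lift ((LinearMap.mul k UU).compl₂ ιL)

theorem mu_tmul (u : UU) (x : g) : mu (u ⊗ₜ[k] x) = u * ιU x := rfl

theorem mu_D (π : UU →ₗ[k] g) (h1 : π 1 = 0) (hπ : ∀ x, π (ιU x) = x) {p : ℕ} {u : UU}
    (hu : u ∈ Fil (p + 1)) : mu (D π u) - (p : k) • u ∈ Fil p := by
  have key := Fil_ind (S := fun p => ((Fil p).comap (mu ∘ₗ D π - (p : k) • LinearMap.id)) ⊓ Fil (p + 1))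
    (by simp [D_one π h1]; exact Submodule.mem_span_singleton_self 1) (by
    intro p u hu
    obtain ⟨h, h'⟩ := hu
    refine ⟨?_, Fil_mono1 _ h'⟩
    simp only [Submodule.mem_comap, LinearMap.sub_apply, LinearMap.comp_apply, LinearMap.smul_apply,
      LinearMap.id_apply, SetLike.mem_coe] at h ⊢
    have : mu (D π u) - ((p + 1 : ℕ) : k) • u = (mu (D π u) - (p : k) • u) - u := by
      push_cast; rw [add_smul, one_smul]; abel
    rw [this]
    exact sub_mem (Fil_mono1 _ h) h') (by
    intro p ih u hu y
    obtain ⟨h, h'⟩ := ih hu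
    refine ⟨?_, Fil_mul h' y⟩
    simp only [Submodule.mem_comap, LinearMap.sub_apply, LinearMap.comp_apply, LinearMap.smul_apply,
      LinearMap.id_apply, SetLike.mem_coe] at h ⊢
    have e1 : mu (D π (u * ιU y)) - ((p + 1 : ℕ) : k) • (u * ιU y) =
      mu (D π (u * ιU y) - Rg y (D π u) - u ⊗ₜ y) +
        ((mu ∘ₗ Rg y - LinearMap.mulRight k (ιU y) ∘ₗ mu : UU ⊗[k] g →ₗ[k] UU)) (D π u) +
        (mu (D π u) - (p : k) • u) * ιU y := by
      simp only [map_sub, LinearMap.sub_apply, LinearMap.comp_apply, LinearMap.mulRight_apply,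
        sub_mul, mu_tmul, Nat.cast_add, Nat.cast_one, add_smul, one_smul, smul_mul_assoc]
      abel
    rw [e1]
    refine add_mem (add_mem ?_ ?_) (Fil_mul h y)
    · refine TF_map mu ?_ (D_mul π hπ hu y)
      intro a ha b _
      exact Fil_mul ha b
    · refine TF_map _ ?_ (D_mem π h1 hπ hu)
      intro a ha b _
      have : (mu ∘ₗ Rg y - LinearMap.mulRight k (ιU y) ∘ₗ mu : UU ⊗[k] g →ₗ[k] UU) (a ⊗ₜ[k] b) =
          a * ιU ⁅y, b⁆ := by
        simp only [LinearMap.sub_apply, LinearMap.comp_apply, LinearMap.mulRight_apply, Rg_tmul,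
          mu_tmul, LieHom.map_lie, LieRing.of_associative_ring_bracket, mul_sub, mul_assoc]
      rw [this]
      exact Fil_mul ha _) p
  exact (key hu).1

/-- `τ ↦ τ ∧ w` -/
noncomputable def wed : EE →ₗ[k] UU ⊗[k] g →ₗ[k] VV :=
  (LinearMap.lTensorHom UU) ∘ₗ ((LinearMap.mul k EE).flip.compl₂ (ιE : g →ₗ[k] EE))

theorem wed_tmul (w : EE) (u : UU) (x : g) : wed w (u ⊗ₜ[k] x) = u ⊗ₜ (ιE x * w) := rfl

/-- the homotopy -/
noncomputable def h (π : UU →ₗ[k] g) : VV →ₗ[k] VV := TensorProduct.lift (wed.flip ∘ₗ D π)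

theorem h_tmul (π : UU →ₗ[k] g) (u : UU) (w : EE) : h π (u ⊗ₜ[k] w) = wed w (D π u) := rfl

theorem wed_mul (y : g) (w : EE) (t : UU ⊗[k] g) : wed (ιE y * w) t = - e y (wed w t) := by
  have : wed (ιE y * w) = - e y ∘ₗ wed w := by
    apply TensorProduct.ext'; intro a b
    simp only [wed_tmul, LinearMap.comp_apply, LinearMap.neg_apply, e_tmul]
    rw [swapE, tmul_neg]
  exact LinearMap.congr_fun this t

theorem h_e (π : UU →ₗ[k] g) (y : g) (z : VV) : h π (e y z) = - e y (h π z) := by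
  have : h π ∘ₗ e y = - e y ∘ₗ h π := by
    apply TensorProduct.ext'; intro a b
    simp only [LinearMap.comp_apply, LinearMap.neg_apply, e_tmul, h_tmul, wed_mul]
  exact LinearMap.congr_fun this z

/-- the filtration on `V n` -/
noncomputable def FV (p n : ℕ) : Submodule k VV := TF (Fil p) (⋀[k]^n g)

theorem wed_mem {p n : ℕ} {w : EE} (hw : w ∈ ⋀[k]^n g) {t : UU ⊗[k] g} (ht : t ∈ TF (Fil p) ⊤) :
    wed w t ∈ FV p (n + 1) :=
  TF_map _ (fun _ ha b _ => tmul_mem_TF ha (mul_mem_pow b hw)) ht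

theorem e_mem {p n : ℕ} (y : g) {z : VV} (hz : z ∈ FV p n) : e y z ∈ FV p (n + 1) :=
  TF_map _ (fun _ ha _ hb => tmul_mem_TF ha (mul_mem_pow y hb)) hz

/-- `u ⊗ x ↦ e_x (d (u ⊗ w))` -/
noncomputable def G (w : EE) : UU ⊗[k] g →ₗ[k] VV :=
  TensorProduct.lift (LinearMap.mk₂ k (fun u x => e x (d (u ⊗ₜ w)))
    (by intros; simp [add_tmul]) (by intros; simp [← smul_tmul'])
    (by intros; simp [e_add]) (by intros; simp [e_smul]))

theorem G_tmul (w : EE) (u : UU) (x : g) : G w (u ⊗ₜ[k] x) = e x (d (u ⊗ₜ w)) := rfl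

/-- `u ⊗ x ↦ u ⊗ L x w` -/
noncomputable def LL (w : EE) : UU ⊗[k] g →ₗ[k] VV := LinearMap.lTensor _ (L.flip w)
theorem LL_tmul (w : EE) (u : UU) (x : g) : LL w (u ⊗ₜ[k] x) = u ⊗ₜ L x w := rfl

theorem d_wed (w : EE) (t : UU ⊗[k] g) : d (wed w t) = mu t ⊗ₜ w - LL w t - G w t := by
  have : d ∘ₗ wed w = (TensorProduct.mk k UU EE).flip w ∘ₗ mu - LL w - G w := by
    apply TensorProduct.ext'; intro a b
    simp only [LinearMap.comp_apply, LinearMap.sub_apply, LL_tmul, G_tmul, wed_tmul, mu_tmul,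
      LinearMap.flip_apply, TensorProduct.mk_apply]
    rw [← e_tmul, d_e]; simp
  exact LinearMap.congr_fun this t

theorem dh_mem (π : UU →ₗ[k] g) (h1 : π 1 = 0) (hπ : ∀ x, π (ιU x) = x) {p n : ℕ} {u : UU}
    (hu : u ∈ Fil (p + 1)) {w : EE} (hw : w ∈ ⋀[k]^n g) :
    d (h π (u ⊗ₜ w)) - ((p : k) • (u ⊗ₜ w) - G w (D π u)) ∈ FV p n := by
  rw [h_tmul, d_wed]
  have : mu (D π u) ⊗ₜ[k] w - LL w (D π u) - G w (D π u) - ((p : k) • (u ⊗ₜ w) - G w (D π u)) =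
      (mu (D π u) - (p : k) • u) ⊗ₜ w - LL w (D π u) := by
    rw [sub_tmul, smul_tmul']; abel
  rw [this]
  refine sub_mem (tmul_mem_TF (mu_D π h1 hπ hu) hw) ?_
  refine TF_map _ ?_ (D_mem π h1 hπ hu)
  intro a ha b _
  exact tmul_mem_TF ha (L_mem b n hw)

theorem hd_mem (π : UU →ₗ[k] g) (h1 : π 1 = 0) (hπ : ∀ x, π (ιU x) = x) {p : ℕ} {u : UU}
    (hu : u ∈ Fil (p + 1)) (n : ℕ) {w : EE} (hw : w ∈ ⋀[k]^n g) :
    h π (d (u ⊗ₜ w)) - (G w (D π u) + (n : k) • (u ⊗ₜ w)) ∈ FV p n := by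
  have G_lin : ∀ t : UU ⊗[k] g, ∃ f : EE →ₗ[k] VV, ∀ w, f w = G w t := by
    intro t
    refine ⟨⟨⟨fun w => G w t, ?_⟩, ?_⟩, fun w => rfl⟩
    · intro w w'
      have : G (w + w') = G w + G w' := by
        apply TensorProduct.ext'; intro a b; simp [G_tmul, tmul_add]
      rw [this]; rfl
    · intro c w
      have : G (c • w) = c • G w := by
        apply TensorProduct.ext'; intro a b; simp [G_tmul]
      change G (c • w) t = _
      rw [this]; rfl
  obtain ⟨f, hf⟩ := G_lin (D π u)
  let A : ℕ → EE →ₗ[k] VV := fun n =>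
    (h π ∘ₗ d - (n : k) • LinearMap.id) ∘ₗ TensorProduct.mk k UU EE u - f
  have hA : ∀ n w, A n w = h π (d (u ⊗ₜ w)) - (G w (D π u) + (n : k) • (u ⊗ₜ w)) := by
    intro n w
    simp only [A, LinearMap.sub_apply, LinearMap.comp_apply, LinearMap.smul_apply,
      LinearMap.id_apply, TensorProduct.mk_apply, hf]
    abel
  suffices ∀ n, (⋀[k]^n g) ≤ (FV p n).comap (A n) by
    rw [← hA]; exact this n hw
  intro n
  induction n with
  | zero =>
    apply pow_zero_ind
    have : G (1 : EE) = (0 : UU ⊗[k] g →ₗ[k] VV) := by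
      apply TensorProduct.ext'; intro a b; simp [G_tmul, d_one]
    rw [Submodule.mem_comap, hA, d_one, this]; simp
  | succ n ih =>
    apply pow_ind
    intro y w hw
    have ih' := ih hw
    rw [Submodule.mem_comap, hA] at ih' ⊢
    have hG : ∀ t, G (ιE y * w) t = wed w (Rg y t) - wed (L y w) t + e y (G w t) := by
      intro t
      have : G (ιE y * w) = wed w ∘ₗ Rg y - wed (L y w) + e y ∘ₗ G w := by
        apply TensorProduct.ext'; intro a b
        simp only [LinearMap.comp_apply, LinearMap.sub_apply, LinearMap.add_apply, G_tmul,
          wed_tmul, Rg_tmul]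
        rw [← e_tmul, d_e, map_sub, map_sub, R_tmul, Lam_tmul, e_tmul, e_tmul, e_e b y]
        abel
      rw [this]; rfl
    have key : h π (d (u ⊗ₜ (ιE y * w))) - (G (ιE y * w) (D π u) +
          ((n + 1 : ℕ) : k) • (u ⊗ₜ (ιE y * w))) =
        wed w (D π (u * ιU y) - Rg y (D π u) - u ⊗ₜ y) +
        e y (h π (d (u ⊗ₜ w)) - (G w (D π u) + (n : k) • (u ⊗ₜ w))) := by
      rw [hG, ← e_tmul, d_e, R_tmul, Lam_tmul]
      simp only [map_sub, map_add, map_smul, h_e, h_tmul, wed_tmul, e_tmul]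
      push_cast
      rw [add_smul, one_smul]
      abel
    rw [key]
    exact add_mem (wed_mem hw (D_mul π hπ hu y)) (e_mem y ih')

theorem homotopy_mem (π : UU →ₗ[k] g) (h1 : π 1 = 0) (hπ : ∀ x, π (ιU x) = x) {p n : ℕ} {z : VV}
    (hz : z ∈ FV (p + 1) n) :
    d (h π z) + h π (d z) - ((p + n : ℕ) : k) • z ∈ FV p n := by
  refine TF_map (d ∘ₗ h π + h π ∘ₗ d - ((p + n : ℕ) : k) • LinearMap.id) ?_ hz
  intro u hu w hw
  have := add_mem (dh_mem π h1 hπ hu hw) (hd_mem π h1 hπ hu n hw)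
  convert this using 1
  simp only [LinearMap.comp_apply, LinearMap.sub_apply, LinearMap.add_apply, LinearMap.smul_apply,
    LinearMap.id_apply]
  push_cast
  rw [add_smul]
  abel

/-- the degree `n` part of the total complex -/
noncomputable def Vn (n : ℕ) : Submodule k VV := TF ⊤ (⋀[k]^n g)

theorem h_mem (π : UU →ₗ[k] g) {n : ℕ} {z : VV} (hz : z ∈ Vn n) : h π z ∈ Vn (n + 1) := by
  refine TF_map _ ?_ hz
  intro u _ w hw
  rw [h_tmul]
  have : D π u ∈ TF (⊤ : Submodule k UU) (⊤ : Submodule k g) := by rw [TF_top]; trivial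
  exact TF_map _ (fun _ ha b _ => tmul_mem_TF ha (mul_mem_pow b hw)) this

theorem exact_p [CharZero k] (π : UU →ₗ[k] g) (h1 : π 1 = 0) (hπ : ∀ x, π (ιU x) = x) (n p : ℕ) :
    ∀ z : VV, z ∈ FV p (n + 1) → d z = 0 → ∃ z' ∈ Vn (n + 2), d z' = z := by
  induction p with
  | zero =>
    intro z hz _
    have : z = 0 := by
      have h0 : FV 0 (n + 1) ≤ (⊥ : Submodule k VV) := by
        apply TF_le
        intro u hu w _
        have hu' : u = 0 := hu
        rw [hu', zero_tmul]; exact zero_mem _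
      exact h0 hz
    exact ⟨0, zero_mem _, by rw [this, map_zero]⟩
  | succ p ih =>
    intro z hz hdz
    have hm := homotopy_mem π h1 hπ hz
    rw [hdz, map_zero, add_zero] at hm
    obtain ⟨z', hz', hd'⟩ := ih _ hm (by rw [map_sub, map_smul, hdz, d_d, smul_zero, sub_zero])
    have hc : ((p + (n + 1) : ℕ) : k) ≠ 0 := Nat.cast_ne_zero.mpr (by omega)
    refine ⟨((p + (n + 1) : ℕ) : k)⁻¹ • (h π z - z'), ?_, ?_⟩
    · refine Submodule.smul_mem _ _ (sub_mem (h_mem π ?_) hz')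
      exact TF_mono le_top hz
    · rw [map_smul, map_sub, hd', sub_sub_cancel, smul_smul, inv_mul_cancel₀ hc, one_smul]

theorem alg_ind {S : Submodule k UU} (h0 : (1 : UU) ∈ S) (h1 : ∀ u ∈ S, ∀ y : g, u * ιU y ∈ S) :
    S = ⊤ := by
  let A : Subalgebra k UU :=
    { carrier := {a | ∀ u ∈ S, u * a ∈ S}
      mul_mem' := by
        intro a b ha hb u hu
        rw [← mul_assoc]; exact hb _ (ha _ hu)
      add_mem' := by
        intro a b ha hb u hu
        rw [mul_add]; exact add_mem (ha _ hu) (hb _ hu)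
      algebraMap_mem' := by
        intro r u hu
        rw [← Algebra.commutes, ← Algebra.smul_def]; exact S.smul_mem _ hu }
  let φ : UU →ₐ[k] A := UniversalEnvelopingAlgebra.lift k
    { toFun := fun x => ⟨ιU x, fun u hu => h1 u hu x⟩
      map_add' := by intro x y; ext; simp
      map_smul' := by intro c x; ext; simp
      map_lie' := by
        intro x y; ext
        simp [LieRing.of_associative_ring_bracket] }
  have hφ : A.val.comp φ = AlgHom.id k UU := by
    apply UniversalEnvelopingAlgebra.hom_ext
    ext x
    simp [φ, UniversalEnvelopingAlgebra.lift_ι_apply]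
  rw [eq_top_iff]
  intro u _
  have h2 : ((φ u : A) : UU) = u := AlgHom.congr_fun hφ u
  have h3 := (φ u).2 1 h0
  rw [h2, one_mul] at h3
  exact h3

theorem Fil_exhaust : (⨆ p, Fil (k := k) (g := g) p) = ⊤ := by
  have hdir : Directed (· ≤ ·) (Fil (k := k) (g := g)) :=
    (monotone_nat_of_le_succ Fil_mono1).directed_le
  apply alg_ind
  · exact Submodule.mem_iSup_of_mem 1 (Submodule.mem_span_singleton_self 1)
  · intro u hu y
    rw [Submodule.mem_iSup_of_directed _ hdir] at hu
    obtain ⟨p, hp⟩ := hu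
    exact Submodule.mem_iSup_of_mem (p + 1) (Fil_mul hp y)

theorem Vn_exhaust (n : ℕ) {z : VV} (hz : z ∈ Vn n) : ∃ p, z ∈ FV p n := by
  have hmono : Monotone (Fil (k := k) (g := g)) := monotone_nat_of_le_succ Fil_mono1
  have hdir : Directed (· ≤ ·) (fun p => FV (k := k) (g := g) p n) :=
    Monotone.directed_le fun p q hpq => TF_mono (hmono hpq)
  rw [← Submodule.mem_iSup_of_directed _ hdir]
  refine TF_le (S := ⨆ p, FV p n) ?_ hz
  intro u _ w hw
  have hu : u ∈ ⨆ p, Fil (k := k) (g := g) p := by rw [Fil_exhaust]; trivial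
  rw [Submodule.mem_iSup_of_directed _ hmono.directed_le] at hu
  obtain ⟨p, hp⟩ := hu
  exact Submodule.mem_iSup_of_mem p (tmul_mem_TF hp hw)

/-- the augmentation -/
noncomputable def eps : UU →ₐ[k] k := UniversalEnvelopingAlgebra.lift k (0 : g →ₗ⁅k⁆ k)

theorem eps_ι (x : g) : eps (ιU x) = 0 := by
  unfold eps
  rw [UniversalEnvelopingAlgebra.lift_ι_apply]; rfl

/-- exactness of the total Koszul complex if `g` embeds into `U(g)` -/
theorem exact_of_inj [CharZero k] (hinj : Function.Injective (ιU : g → UU)) (n : ℕ) (z : VV)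
    (hz : z ∈ Vn (n + 1)) (hdz : d z = 0) : ∃ z' ∈ Vn (n + 2), d z' = z := by
  obtain ⟨r, hr⟩ := LinearMap.exists_leftInverse_of_injective ιL
    (LinearMap.ker_eq_bot.mpr hinj)
  have hr' : ∀ x : g, r (ιU x) = x := fun x => LinearMap.congr_fun hr x
  let π : UU →ₗ[k] g := r ∘ₗ (LinearMap.id - (Algebra.linearMap k UU) ∘ₗ eps.toLinearMap)
  obtain ⟨p, hp⟩ := Vn_exhaust _ hz
  have hπ : ∀ x : g, π (ιU x) = x := by
    intro x
    simp only [π, LinearMap.comp_apply, LinearMap.sub_apply, LinearMap.id_apply,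
      AlgHom.toLinearMap_apply, eps_ι, map_zero, sub_zero, hr']
  exact exact_p π (by simp [π]) hπ n p z hp hdz


theorem foldr_exists {N : Type*} [AddCommGroup N] [Module k N] (f : g →ₗ[k] EE →ₗ[k] N)
    (hf : ∀ x w, f x (ιE x * w) = 0) :
    ∃ F : EE →ₗ[k] N, ∀ x w, F (ιE x * w) = f x w := by
  let f' : g →ₗ[k] EE × N →ₗ[k] N := f.compl₂ (LinearMap.fst k EE N)
  refine ⟨CliffordAlgebra.foldr' _ f' (by intro m x fx; simpa [f'] using hf m x) 0, ?_⟩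
  intro x w
  rw [CliffordAlgebra.foldr'_ι_mul]; rfl

/-- an alternating bilinear form gives a linear map on the exterior algebra -/
theorem alt_exists {N : Type*} [AddCommGroup N] [Module k N] (c : g →ₗ[k] g →ₗ[k] N)
    (hc : ∀ x, c x x = 0) :
    ∃ F : EE →ₗ[k] N, ∀ x y, F (ιE x * (ιE y * 1)) = c x y := by
  obtain ⟨p1, hp1⟩ := foldr_exists (k := k) (g := g) (N := g)
    (((LinearMap.lsmul k g).flip).compl₂ (ExteriorAlgebra.algebraMapInv (R := k) (M := g)).toLinearMap) (by
      intro x w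
      simp [ExteriorAlgebra.algebraMapInv])
  obtain ⟨F, hF⟩ := foldr_exists (k := k) (g := g) (N := N) (c.compl₂ p1) (by
    intro x w
    rw [LinearMap.compl₂_apply, hp1]
    simp [hc])
  refine ⟨F, ?_⟩
  intro x y
  rw [hF, LinearMap.compl₂_apply, hp1]
  simp

theorem factor {A B C : Type*} [AddCommGroup A] [Module k A] [AddCommGroup B] [Module k B]
    [AddCommGroup C] [Module k C] (f : A →ₗ[k] B) (c : A →ₗ[k] C) (hk : ∀ a, f a = 0 → c a = 0) :
    ∃ ψ : B →ₗ[k] C, ∀ a, ψ (f a) = c a := by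
  obtain ⟨σ, hσ⟩ := LinearMap.exists_rightInverse_of_surjective f.rangeRestrict
    f.range_rangeRestrict
  obtain ⟨ψ, hψ⟩ := LinearMap.exists_extend (c ∘ₗ σ)
  refine ⟨ψ, fun a => ?_⟩
  have h1 : ψ (f a) = c (σ (f.rangeRestrict a)) := LinearMap.congr_fun hψ (f.rangeRestrict a)
  have h2 : f (σ (f.rangeRestrict a)) = f a :=
    congrArg Subtype.val (LinearMap.congr_fun hσ (f.rangeRestrict a))
  rw [h1, ← sub_eq_zero, ← map_sub]
  apply hk
  rw [map_sub, h2, sub_self]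

/-- every 2-cocycle with values in a vector space becomes a coboundary in the coinduced module -/
theorem cocycle_split [CharZero k] (hinj : Function.Injective (ιU : g → UU))
    {N : Type*} [AddCommGroup N] [Module k N] (c : g →ₗ[k] g →ₗ[k] N)
    (hc : ∀ x, c x x = 0) (hcc : ∀ x y z, c ⁅x, y⁆ z + c ⁅y, z⁆ x + c ⁅z, x⁆ y = 0) :
    ∃ Φ : g →ₗ[k] UU →ₗ[k] N, ∀ x y u,
      eps u • c x y = Φ y (u * ιU x) - Φ ⁅x, y⁆ u - Φ x (u * ιU y) := by
  have hanti : ∀ x y, c x y = - c y x := by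
    intro x y
    have := hc (x + y)
    simp only [map_add, LinearMap.add_apply, hc, zero_add, add_zero] at this
    exact eq_neg_of_add_eq_zero_right this
  obtain ⟨F, hF⟩ := alt_exists c hc
  let ct : VV →ₗ[k] N := TensorProduct.lift
    ((LinearMap.lsmul k (EE →ₗ[k] N)).flip F ∘ₗ (eps (k := k) (g := g)).toLinearMap)
  have hct : ∀ (u : UU) (w : EE), ct (u ⊗ₜ w) = eps u • F w := fun u w => rfl
  have hd3 : ∀ z ∈ Vn 3, ct (d z) = 0 := by
    intro z hz
    refine TF_map (S := ⊥) (ct ∘ₗ d) ?_ hz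
    intro u _ w hw
    have : ⋀[k]^3 g ≤ LinearMap.ker (ct ∘ₗ d ∘ₗ TensorProduct.mk k UU EE u) := by
      apply pow_ind
      intro x w hw
      have : ⋀[k]^2 g ≤ LinearMap.ker (ct ∘ₗ d ∘ₗ TensorProduct.mk k UU EE u ∘ₗ
          LinearMap.mulLeft k (ιE x)) := by
        apply pow_ind
        intro y w hw
        have : ⋀[k]^1 g ≤ LinearMap.ker (ct ∘ₗ d ∘ₗ TensorProduct.mk k UU EE u ∘ₗ
            LinearMap.mulLeft k (ιE x) ∘ₗ LinearMap.mulLeft k (ιE y)) := by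
          apply pow_ind
          intro z w hw
          have : ⋀[k]^0 g ≤ LinearMap.ker (ct ∘ₗ d ∘ₗ TensorProduct.mk k UU EE u ∘ₗ
              LinearMap.mulLeft k (ιE x) ∘ₗ LinearMap.mulLeft k (ιE y) ∘ₗ
              LinearMap.mulLeft k (ιE z)) := by
            apply pow_zero_ind
            rw [LinearMap.mem_ker]
            change ct (d (e x (e y (e z (u ⊗ₜ (1 : EE)))))) = 0
            simp only [d_e, map_sub, e_Lam, e_R, map_add, R_tmul, Lam_tmul, L_one, tmul_zero,
              map_zero, d_one]
            simp only [e_tmul, hct, hF, map_mul, eps_ι, mul_zero, zero_smul]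
            have h3 : c ⁅x, y⁆ z - c x ⁅y, z⁆ + c y ⁅x, z⁆ = 0 := by
              rw [← hcc x y z, hanti ⁅y, z⁆ x, ← lie_skew z x, hanti y]
              simp only [map_neg, LinearMap.neg_apply]
              abel
            have h4 := congrArg (fun t => eps u • t) h3
            simp only [smul_add, smul_sub, smul_zero] at h4
            refine Eq.trans ?_ (neg_eq_zero.mpr h4)
            abel
          exact this hw
        exact this hw
      exact this hw
    exact this hw
  obtain ⟨ψ, hψ⟩ := factor (d ∘ₗ (Vn 2).subtype) (ct ∘ₗ (Vn 2).subtype) (by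
    rintro ⟨z, hz⟩ h0
    obtain ⟨z', hz', rfl⟩ := exact_of_inj hinj 1 z hz h0
    exact hd3 z' hz')
  refine ⟨((TensorProduct.mk k UU EE).compr₂ ψ).flip ∘ₗ ιE, ?_⟩
  intro x y u
  have hm : e x (e y (u ⊗ₜ (1 : EE))) ∈ Vn 2 :=
    tmul_mem_TF (by trivial) (mul_mem_pow x (mul_mem_pow y one_mem_pow))
  have h1 := hψ ⟨_, hm⟩
  simp only [LinearMap.comp_apply, Submodule.subtype_apply, d_e, map_sub, e_Lam, e_R, map_add,
    R_tmul, Lam_tmul, L_one, tmul_zero, map_zero, d_one] at h1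
  simp only [e_tmul, hct, hF] at h1
  rw [← h1]
  simp only [LinearMap.comp_apply, LinearMap.flip_apply, LinearMap.compr₂_apply,
    TensorProduct.mk_apply, mul_one, sub_zero, add_zero]

/-- `g` embeds into its universal enveloping algebra (characteristic zero) -/
theorem ι_injective [CharZero k] : Function.Injective (ιU : g → UU) := by
  let ig : g →ₗ⁅k⁆ UU := ιU
  let g' := ig.range
  have hinj : Function.Injective
      (UniversalEnvelopingAlgebra.ι k : g' → UniversalEnvelopingAlgebra k g') := by
    intro x y hxy
    have h1 := congrArg (UniversalEnvelopingAlgebra.lift k g'.incl) hxy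
    rw [UniversalEnvelopingAlgebra.lift_ι_apply, UniversalEnvelopingAlgebra.lift_ι_apply] at h1
    exact Subtype.ext h1
  let q : g →ₗ⁅k⁆ g' := ig.rangeRestrict
  have hq : ∀ X Y, q X = q Y ↔ ιU X = ιU Y := fun X Y => Subtype.ext_iff
  have hcen : ∀ X X' Y : g, q X = q X' → ⁅X, Y⁆ = ⁅X', Y⁆ := by
    intro X X' Y h
    have h1 := congrArg (UniversalEnvelopingAlgebra.lift k (LieAlgebra.ad k g)) ((hq X X').mp h)
    rw [UniversalEnvelopingAlgebra.lift_ι_apply, UniversalEnvelopingAlgebra.lift_ι_apply] at h1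
    exact LinearMap.congr_fun h1 Y
  have hcen' : ∀ X Y Y' : g, q Y = q Y' → ⁅X, Y⁆ = ⁅X, Y'⁆ := by
    intro X Y Y' h
    rw [← lie_skew, hcen _ _ X h, lie_skew]
  obtain ⟨s, hs⟩ := LinearMap.exists_rightInverse_of_surjective q.toLinearMap
    (LinearMap.range_eq_top.mpr ig.surjective_rangeRestrict)
  have hs' : ∀ x, q (s x) = x := fun x => LinearMap.congr_fun hs x
  let c : g' →ₗ[k] g' →ₗ[k] g := LinearMap.mk₂ k (fun x y => ⁅s x, s y⁆ - s ⁅x, y⁆)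
    (by intros; simp only [map_add, add_lie]; abel)
    (by intros; simp only [map_smul, smul_lie, smul_sub])
    (by intros; simp only [map_add, lie_add]; abel)
    (by intros; simp only [map_smul, lie_smul, smul_sub])
  have hcdef : ∀ x y, c x y = ⁅s x, s y⁆ - s ⁅x, y⁆ := fun x y => rfl
  have hc1 : ∀ x y z, c ⁅x, y⁆ z = ⁅⁅s x, s y⁆, s z⁆ - s ⁅⁅x, y⁆, z⁆ := by
    intro x y z
    rw [hcdef, hcen (s ⁅x, y⁆) ⁅s x, s y⁆ (s z)]
    rw [hs', LieHom.map_lie, hs', hs']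
  obtain ⟨Φ, hΦ⟩ := cocycle_split hinj c (by intro x; simp [hcdef]) (by
    intro x y z
    rw [hc1, hc1, hc1]
    have h1 : ⁅⁅s x, s y⁆, s z⁆ + ⁅⁅s y, s z⁆, s x⁆ + ⁅⁅s z, s x⁆, s y⁆ = 0 := by
      rw [← lie_skew ⁅s x, s y⁆, ← lie_skew ⁅s y, s z⁆, ← lie_skew ⁅s z, s x⁆, ← neg_add, ← neg_add, neg_eq_zero]
      have := lie_jacobi (s x) (s y) (s z)
      rw [← this]; abel
    have h2 : ⁅⁅x, y⁆, z⁆ + ⁅⁅y, z⁆, x⁆ + ⁅⁅z, x⁆, y⁆ = 0 := by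
      rw [← lie_skew ⁅x, y⁆, ← lie_skew ⁅y, z⁆, ← lie_skew ⁅z, x⁆, ← neg_add, ← neg_add, neg_eq_zero]
      have := lie_jacobi x y z
      rw [← this]; abel
    have h3 := congrArg s h2
    rw [map_add, map_add, map_zero] at h3
    calc _ = (⁅⁅s x, s y⁆, s z⁆ + ⁅⁅s y, s z⁆, s x⁆ + ⁅⁅s z, s x⁆, s y⁆) -
        (s ⁅⁅x, y⁆, z⁆ + s ⁅⁅y, z⁆, x⁆ + s ⁅⁅z, x⁆, y⁆) := by abel
      _ = 0 := by rw [h1, h3, sub_zero])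
  let U' := UniversalEnvelopingAlgebra k g'
  let κ : g →ₗ[k] g := LinearMap.id - s ∘ₗ q.toLinearMap
  have hκ : ∀ X, κ X = X - s (q X) := fun X => rfl
  have hκlie : ∀ X Y, κ ⁅X, Y⁆ = c (q X) (q Y) := by
    intro X Y
    rw [hκ, hcdef, LieHom.map_lie, hcen (s (q X)) X _ (hs' _), hcen' X (s (q Y)) Y (hs' _)]
  let B : g →ₗ[k] U' →ₗ[k] g := LinearMap.mk₂ k (fun X u => Φ (q X) u + eps u • κ X)
    (by intros; simp only [map_add, LinearMap.add_apply, smul_add]; abel)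
    (by intro a X u; simp only [map_smul, LinearMap.smul_apply, smul_add, smul_comm a])
    (by intros; simp only [map_add, add_smul]; abel)
    (by intros; simp only [map_smul, smul_add, smul_assoc])
  have hB : ∀ X u, B X u = Φ (q X) u + eps u • κ X := fun X u => rfl
  let T : g → Module.End k ((U' →ₗ[k] g) × k) := fun X => LinearMap.inl k (U' →ₗ[k] g) k ∘ₗ
        ((LinearMap.lcomp k g (LinearMap.mulRight k (UniversalEnvelopingAlgebra.ι k (q X) : U'))) ∘ₗ
          LinearMap.fst k _ _ + (LinearMap.toSpanSingleton k _ (B X)) ∘ₗ LinearMap.snd k _ _)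
  have hT1 : ∀ X p u, (T X p).1 u = p.1 (u * UniversalEnvelopingAlgebra.ι k (q X)) + p.2 • B X u :=
    fun X p u => rfl
  have hT2 : ∀ X p, (T X p).2 = 0 := fun X p => rfl
  have hext : ∀ S S' : Module.End k ((U' →ₗ[k] g) × k), (∀ p u, (S p).1 u = (S' p).1 u) →
      (∀ p, (S p).2 = (S' p).2) → S = S' := by
    intro S S' h1 h2
    refine LinearMap.ext fun p => Prod.ext (LinearMap.ext fun u => h1 p u) (h2 p)
  let ρ : g →ₗ⁅k⁆ Module.End k ((U' →ₗ[k] g) × k) :=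
    { toFun := T
      map_add' := by
        intro X Y
        apply hext
        · intro p u
          simp only [LinearMap.add_apply, Prod.fst_add, hT1, map_add, mul_add, smul_add]
          abel
        · intro p
          simp only [LinearMap.add_apply, Prod.snd_add, hT2, add_zero]
      map_smul' := by
        intro a X
        apply hext
        · intro p u
          simp only [LinearMap.smul_apply, Prod.smul_fst, hT1, map_smul, mul_smul_comm, smul_add,
            RingHom.id_apply, smul_comm a]
        · intro p
          simp only [LinearMap.smul_apply, Prod.smul_snd, hT2, smul_zero]
      map_lie' := by
        intro X Y
        apply hext
        · intro p u
          simp only [LieRing.of_associative_ring_bracket, LinearMap.sub_apply, Prod.fst_sub,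
            Module.End.mul_apply, hT1, hT2, zero_smul, add_zero, hB, hκlie, LieHom.map_lie,
            mul_sub, map_sub, hΦ, map_mul, eps_ι, mul_zero, mul_assoc]
          rw [show ∀ a b c : g, a + (b - a - c) = b - c by intros; abel, smul_sub]
          abel
        · intro p
          simp only [LieRing.of_associative_ring_bracket, LinearMap.sub_apply, Prod.snd_sub,
            Module.End.mul_apply, hT2, sub_zero] }
  have hker : ∀ X : g, ιU X = 0 → X = 0 := by
    intro X hX
    have h1 := congrArg (UniversalEnvelopingAlgebra.lift k ρ) hX
    rw [UniversalEnvelopingAlgebra.lift_ι_apply, map_zero] at h1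
    have h2 : (T X (0, 1)).1 1 = 0 := by
      change (ρ X (0, 1)).1 1 = 0
      rw [h1]; rfl
    have hq0 : q X = 0 := by
      rw [← map_zero q, hq, hX, map_zero]
    rw [hT1, hB, hκ, hq0] at h2
    simpa using h2
  intro X Y hXY
  rw [← sub_eq_zero]
  apply hker
  rw [map_sub, hXY, sub_self]

local notation "wE" => ExteriorAlgebra.ιMulti k

theorem tail_succAbove {n : ℕ} (v : Fin (n + 2) → g) (j : Fin (n + 1)) :
    wE (n + 1) (v ∘ j.succ.succAbove) = ιE (v 0) * wE n (Matrix.vecTail v ∘ j.succAbove) := by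
  rw [ExteriorAlgebra.ιMulti_succ_apply]
  congr 2
  · funext l
    simp [Matrix.vecTail]

theorem L_ιMulti (x : g) : ∀ (n : ℕ) (v : Fin (n + 1) → g), L x (wE (n + 1) v) =
    ∑ j : Fin (n + 1), ((-1 : k) ^ (j : ℕ)) • (ιE ⁅x, v j⁆ * wE n (v ∘ j.succAbove))
  | 0, v => by
    rw [ExteriorAlgebra.ιMulti_succ_apply, L_mul, ExteriorAlgebra.ιMulti_zero_apply, L_one]
    simp
  | n + 1, v => by
    rw [ExteriorAlgebra.ιMulti_succ_apply, L_mul, L_ιMulti x n, Fin.sum_univ_succ (n := n + 1), Finset.mul_sum]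
    congr 1
    · simp only [Fin.val_zero, pow_zero, one_smul]
      rfl
    · refine Finset.sum_congr rfl fun j _ => ?_
      rw [tail_succAbove, swapE, Fin.val_succ, pow_succ, mul_smul_comm, smul_neg, mul_neg_one,
        neg_smul, neg_neg]
      rfl

theorem cons_zero {n : ℕ} (a : g) (v : Fin (n + 2) → g) (j : Fin (n + 1)) :
    wE (n + 1) (consRemove2 a v 0 j.succ) = ιE a * wE n (Matrix.vecTail v ∘ j.succAbove) := by
  rw [ExteriorAlgebra.ιMulti_succ_apply]
  congr 2
  funext l
  simp only [Matrix.vecTail, consRemove2, Function.comp]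
  rw [dif_neg (by simp)]
  congr 1
  ext
  simp only [remove2Idx, Fin.val_succ, Fin.val_zero, Fin.succAbove, Fin.lt_def, Fin.val_castSucc]
  split_ifs <;> simp_all

theorem cons_succ {n : ℕ} (a : g) (v : Fin (n + 3) → g) (i j : Fin (n + 2)) :
    wE (n + 2) (consRemove2 a v i.succ j.succ) =
      - (ιE (v 0) * wE (n + 1) (consRemove2 a (Matrix.vecTail v) i j)) := by
  have t : Matrix.vecTail (Matrix.vecTail (consRemove2 a v i.succ j.succ)) =
      Matrix.vecTail (consRemove2 a (Matrix.vecTail v) i j) := by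
    funext l
    simp only [Matrix.vecTail, consRemove2, Function.comp]
    rw [dif_neg (by simp), dif_neg (by simp)]
    congr 1
    ext
    simp only [remove2Idx, Fin.val_succ]
    split_ifs <;> omega
  have h0 : consRemove2 a v i.succ j.succ 0 = a := rfl
  have h1 : Matrix.vecTail (consRemove2 a v i.succ j.succ) 0 = v 0 := by
    simp only [Matrix.vecTail, consRemove2, Function.comp]
    rw [dif_neg (by simp)]
    congr 1
  have h2 : consRemove2 a (Matrix.vecTail v) i j 0 = a := rfl
  rw [ExteriorAlgebra.ιMulti_succ_apply (consRemove2 a v i.succ j.succ),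
    ExteriorAlgebra.ιMulti_succ_apply (Matrix.vecTail (consRemove2 a v i.succ j.succ)), h0, h1, t,
    ExteriorAlgebra.ιMulti_succ_apply (consRemove2 a (Matrix.vecTail v) i j), h2, swapE]

theorem d_formula (u : UU) : ∀ (n : ℕ) (v : Fin (n + 1) → g),
    (∑ i : Fin (n + 1), ((-1 : k) ^ (i : ℕ)) • ((u * ιU (v i)) ⊗ₜ[k] wE n (v ∘ i.succAbove))) +
      (∑ p : Fin (n + 1) × Fin (n + 1), if p.1 < p.2 then
        ((-1 : k) ^ ((p.1 : ℕ) + (p.2 : ℕ))) •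
          (u ⊗ₜ[k] wE n (consRemove2 ⁅v p.1, v p.2⁆ v p.1 p.2)) else 0) =
    d (u ⊗ₜ[k] wE (n + 1) v)
  | 0, v => by
    rw [ExteriorAlgebra.ιMulti_succ_apply, ExteriorAlgebra.ιMulti_zero_apply, ← e_tmul, d_e,
      d_one, R_tmul, Lam_tmul, L_one]
    have h0 : ∀ p : Fin (0 + 1) × Fin (0 + 1), ¬ p.1 < p.2 := by
      rintro ⟨⟨i, hi⟩, ⟨j, hj⟩⟩ h
      rw [Fin.mk_lt_mk] at h
      omega
    simp [h0]
  | n + 1, v => by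
    have hA2 : ∀ i j : Fin (n + 1), (if i.succ < j.succ then
        ((-1 : k) ^ ((i.succ : ℕ) + (j.succ : ℕ))) •
          (u ⊗ₜ[k] wE (n + 1) (consRemove2 ⁅v i.succ, v j.succ⁆ v i.succ j.succ)) else 0) =
        - e (v 0) (if i < j then
        ((-1 : k) ^ ((i : ℕ) + (j : ℕ))) •
          (u ⊗ₜ[k] wE n (consRemove2 ⁅Matrix.vecTail v i, Matrix.vecTail v j⁆ (Matrix.vecTail v) i j)) else 0) := by
      intro i j
      by_cases hij : i < j
      · rw [if_pos hij, if_pos (Fin.succ_lt_succ_iff.mpr hij)]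
        cases n with
        | zero => 
          exfalso
          have h1 := i.2
          have h2 := j.2
          rw [Fin.lt_def] at hij
          omega
        | succ m =>
          rw [cons_succ, map_smul, e_tmul, tmul_neg, smul_neg]
          congr 2
          rw [Fin.val_succ, Fin.val_succ, show (i : ℕ) + 1 + (j + 1) = i + j + 2 by ring, pow_add]
          simp
      · rw [if_neg hij, if_neg (fun h => hij (Fin.succ_lt_succ_iff.mp h)), map_zero, neg_zero]
    have ih := d_formula u n (Matrix.vecTail v)
    rw [ExteriorAlgebra.ιMulti_succ_apply, ← e_tmul, d_e, ← ih, R_tmul, Lam_tmul, L_ιMulti,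
      Fin.sum_univ_succ (n := n + 1), Fintype.sum_prod_type, Fintype.sum_prod_type,
      Fin.sum_univ_succ (n := n + 1)]
    rw [Finset.sum_congr rfl (fun i _ => Fin.sum_univ_succ (n := n + 1) _),
      Fin.sum_univ_succ (n := n + 1)]
    simp only [hA2]
    simp only [tail_succAbove, cons_zero, lt_self_iff_false, if_false, Fin.not_lt_zero,
      Fin.succ_pos, if_true, zero_add, Finset.sum_neg_distrib, ← map_sum, map_add,
      Fin.val_zero, Fin.val_succ, pow_zero, one_smul]
    have h1 : ∑ x : Fin (n + 1), (-1 : k) ^ ((x : ℕ) + 1) • (u * ιU (v x.succ)) ⊗ₜ[k]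
        (ιE (v 0) * wE n (Matrix.vecTail v ∘ x.succAbove)) = - e (v 0)
        (∑ i : Fin (n + 1), ((-1 : k) ^ (i : ℕ)) • ((u * ιU (Matrix.vecTail v i)) ⊗ₜ[k]
          wE n (Matrix.vecTail v ∘ i.succAbove))) := by
      rw [map_sum, ← Finset.sum_neg_distrib]
      refine Finset.sum_congr rfl fun i _ => ?_
      rw [map_smul, e_tmul, pow_succ, mul_neg_one, neg_smul]
      rfl
    have h2 : ∑ x : Fin (n + 1), (-1 : k) ^ ((x : ℕ) + 1) • u ⊗ₜ[k]
        (ιE ⁅v 0, v x.succ⁆ * wE n (Matrix.vecTail v ∘ x.succAbove)) = -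
        (u ⊗ₜ[k] ∑ j : Fin (n + 1), (-1 : k) ^ (j : ℕ) • (ιE ⁅v 0, Matrix.vecTail v j⁆ *
          wE n (Matrix.vecTail v ∘ j.succAbove))) := by
      rw [tmul_sum, ← Finset.sum_neg_distrib]
      refine Finset.sum_congr rfl fun i _ => ?_
      rw [pow_succ, mul_neg_one, neg_smul, tmul_smul]
      rfl
    rw [h1, h2]
    have h3 : v ∘ Fin.succAbove 0 = Matrix.vecTail v := rfl
    rw [h3]
    abel

/-- inclusion of the degree `n` part -/
noncomputable def jn (n : ℕ) : UU ⊗[k] ⋀[k]^n g →ₗ[k] VV :=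
  LinearMap.lTensor UU (⋀[k]^n g).subtype

theorem jn_tmul (n : ℕ) (u : UU) (w : ⋀[k]^n g) : jn n (u ⊗ₜ w) = u ⊗ₜ (w : EE) := rfl

theorem jn_inj (n : ℕ) : Function.Injective (jn (k := k) (g := g) n) :=
  Module.Flat.lTensor_preserves_injective_linearMap _ (Submodule.subtype_injective _)

theorem jn_mem (n : ℕ) (z : UU ⊗[k] ⋀[k]^n g) : jn n z ∈ Vn n := by
  induction z using TensorProduct.induction_on with
  | zero => rw [map_zero]; exact zero_mem _
  | tmul u w => exact tmul_mem_TF trivial w.2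
  | add a b ha hb => rw [map_add]; exact add_mem ha hb

theorem jn_surj (n : ℕ) (z : VV) (hz : z ∈ Vn n) : ∃ y, jn n y = z := by
  have : Vn n ≤ LinearMap.range (jn (k := k) (g := g) n) :=
    TF_le (fun u _ w hw => ⟨u ⊗ₜ ⟨w, hw⟩, rfl⟩)
  exact this hz

/-- augmentation on the total complex -/
noncomputable def augV (ε : UU →ₐ[k] k) : VV →ₗ[k] k :=
  TensorProduct.lift ((LinearMap.mul k k).compl₁₂ ε.toLinearMap
    (ExteriorAlgebra.algebraMapInv (R := k) (M := g)).toLinearMap)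

theorem augV_tmul (ε : UU →ₐ[k] k) (u : UU) (w : EE) :
    augV ε (u ⊗ₜ w) = ε u * ExteriorAlgebra.algebraMapInv w := rfl

theorem augV_one (ε : UU →ₐ[k] k) (u : UU) : augV ε (u ⊗ₜ (1 : EE)) = ε u := by
  rw [augV_tmul, map_one, mul_one]

theorem Vn_zero (z : VV) (hz : z ∈ Vn 0) : ∃ u : UU, z = u ⊗ₜ (1 : EE) := by
  have : Vn 0 ≤ LinearMap.range ((TensorProduct.mk k UU EE).flip 1) := by
    refine TF_le (fun u _ w hw => ?_)
    have h2 : ⋀[k]^0 g ≤ (LinearMap.range ((TensorProduct.mk k UU EE).flip 1)).comap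
        (TensorProduct.mk k UU EE u) := pow_zero_ind ⟨u, rfl⟩
    exact h2 hw
  obtain ⟨u, hu⟩ := this hz
  exact ⟨u, hu.symm⟩

theorem d_e_one (u : UU) (x : g) : d (e x (u ⊗ₜ (1 : EE))) = (u * ιU x) ⊗ₜ 1 := by
  rw [d_e, d_one, R_tmul, Lam_tmul, L_one]; simp

theorem augV_d (ε : UU →ₐ[k] k) (hε : ∀ x : g, ε (ιU x) = 0) (z : VV) (hz : z ∈ Vn 1) :
    augV ε (d z) = 0 := by
  refine TF_map (S := ⊥) (augV ε ∘ₗ d) ?_ hz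
  intro u _ w hw
  have : ⋀[k]^1 g ≤ LinearMap.ker (augV ε ∘ₗ d ∘ₗ TensorProduct.mk k UU EE u) := by
    apply pow_ind
    intro x w hw
    have : ⋀[k]^0 g ≤ LinearMap.ker (augV ε ∘ₗ d ∘ₗ TensorProduct.mk k UU EE u ∘ₗ
        LinearMap.mulLeft k (ιE x)) := by
      apply pow_zero_ind
      rw [LinearMap.mem_ker]
      change augV ε (d (e x (u ⊗ₜ (1 : EE)))) = 0
      rw [d_e_one, augV_one, map_mul, hε, mul_zero]
    exact this hw
  exact this hw

theorem aug_exact (ε : UU →ₐ[k] k) (hε : ∀ x : g, ε (ιU x) = 0) (z : VV) (hz : z ∈ Vn 0)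
    (h0 : augV ε z = 0) : ∃ z' ∈ Vn 1, d z' = z := by
  have key : ∀ u : UU, u ∈ ((Vn 1).map d).comap ((TensorProduct.mk k UU EE).flip 1 -
      (LinearMap.toSpanSingleton k VV ((1 : UU) ⊗ₜ (1 : EE))) ∘ₗ ε.toLinearMap) := by
    intro u
    rw [alg_ind (S := ((Vn 1).map d).comap ((TensorProduct.mk k UU EE).flip 1 -
      (LinearMap.toSpanSingleton k VV ((1 : UU) ⊗ₜ (1 : EE))) ∘ₗ ε.toLinearMap))]
    · trivial
    · change (1 : UU) ⊗ₜ[k] (1 : EE) - ε 1 • ((1 : UU) ⊗ₜ (1 : EE)) ∈ (Vn 1).map d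
      rw [map_one, one_smul, sub_self]
      exact zero_mem _
    · intro u _ y
      change (u * ιU y) ⊗ₜ[k] (1 : EE) - ε (u * ιU y) • ((1 : UU) ⊗ₜ (1 : EE)) ∈ (Vn 1).map d
      rw [map_mul, hε, mul_zero, zero_smul, sub_zero, ← d_e_one]
      exact ⟨_, tmul_mem_TF trivial (mul_mem_pow y one_mem_pow), rfl⟩
  obtain ⟨u, rfl⟩ := Vn_zero z hz
  rw [augV_one] at h0
  obtain ⟨z', hz', h⟩ := key u
  refine ⟨z', hz', ?_⟩
  rw [h]
  change u ⊗ₜ[k] (1 : EE) - ε u • ((1 : UU) ⊗ₜ (1 : EE)) = _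
  rw [h0, zero_smul, sub_zero]

/-- the defining formula for the graded differential -/
def HD (dd : ∀ n : ℕ, (UU ⊗[k] ⋀[k]^(n + 1) g) →ₗ[UU] (UU ⊗[k] ⋀[k]^n g)) : Prop :=
    (∀ (n : ℕ) (u : UniversalEnvelopingAlgebra k g) (v : Fin (n + 1) → g),
      dd n (u ⊗ₜ[k] wedge k (n + 1) v) =
        (∑ i : Fin (n + 1),
            ((-1 : k) ^ (i : ℕ)) •
              ((u * UniversalEnvelopingAlgebra.ι k (v i)) ⊗ₜ[k] wedge k n (v ∘ i.succAbove))) +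
          ∑ p : Fin (n + 1) × Fin (n + 1),
            if p.1 < p.2 then
              ((-1 : k) ^ ((p.1 : ℕ) + (p.2 : ℕ))) •
                (u ⊗ₜ[k] wedge k n (consRemove2 ⁅v p.1, v p.2⁆ v p.1 p.2))
            else 0)

theorem jn_dd {dd : ∀ n : ℕ, (UU ⊗[k] ⋀[k]^(n + 1) g) →ₗ[UU] (UU ⊗[k] ⋀[k]^n g)} (hd : HD dd)
    (n : ℕ) (z) : jn n (dd n z) = d (jn (n + 1) z) := by
  induction z using TensorProduct.induction_on with
  | zero => simp only [map_zero]
  | add a b ha hb => simp only [map_add, ha, hb]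
  | tmul u w =>
    have hw : w ∈ Submodule.span k (Set.range (exteriorPower.ιMulti k (n + 1) (M := g))) := by
      rw [exteriorPower.ιMulti_span]; trivial
    induction hw using Submodule.span_induction with
    | zero => simp only [tmul_zero, map_zero]
    | add a b _ _ ha hb => simp only [tmul_add, map_add, ha, hb]
    | smul c a _ ha =>
      have : dd n (u ⊗ₜ (c • a)) = c • dd n (u ⊗ₜ a) := by
        rw [tmul_smul]
        exact LinearMap.map_smul_of_tower (dd n) c _
      rw [this, tmul_smul, map_smul, map_smul, map_smul, ha]
    | mem w hw =>
      obtain ⟨v, rfl⟩ := hw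
      have hv : exteriorPower.ιMulti k (n + 1) v = wedge k (n + 1) v := rfl
      rw [hv, hd n u v, map_add, map_sum, map_sum, jn_tmul]
      refine Eq.trans ?_ (d_formula u n v)
      congr 1
      refine Finset.sum_congr rfl fun p _ => ?_
      split_ifs
      · rfl
      · rfl

theorem dd_exact [CharZero k] {dd : ∀ n : ℕ, (UU ⊗[k] ⋀[k]^(n + 1) g) →ₗ[UU] (UU ⊗[k] ⋀[k]^n g)} (hd : HD dd)
    (n : ℕ) (z) : dd n z = 0 ↔ z ∈ LinearMap.range (dd (n + 1)) := by
  constructor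
  · intro hz
    obtain ⟨z', hz', h⟩ := exact_of_inj ι_injective n (jn (n + 1) z) (jn_mem _ z)
      (by rw [← jn_dd hd, hz, map_zero])
    obtain ⟨y, rfl⟩ := jn_surj _ _ hz'
    exact ⟨y, jn_inj _ (by rw [jn_dd hd, h])⟩
  · rintro ⟨y, rfl⟩
    apply jn_inj
    rw [jn_dd hd, jn_dd hd, d_d, map_zero]

theorem dd_exact0 {dd : ∀ n : ℕ, (UU ⊗[k] ⋀[k]^(n + 1) g) →ₗ[UU] (UU ⊗[k] ⋀[k]^n g)} (hd : HD dd)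
    (ε : UU →ₐ[k] k) (hε : ∀ x : g, ε (ιU x) = 0) (z) :
    augV ε (jn 0 z) = 0 ↔ z ∈ LinearMap.range (dd 0) := by
  constructor
  · intro hz
    obtain ⟨z', hz', h⟩ := aug_exact ε hε (jn 0 z) (jn_mem _ z) hz
    obtain ⟨y, rfl⟩ := jn_surj _ _ hz'
    exact ⟨y, jn_inj _ (by rw [jn_dd hd, h])⟩
  · rintro ⟨y, rfl⟩
    rw [jn_dd hd]
    exact augV_d ε hε _ (jn_mem _ y)

theorem augV_smul (ε : UU →ₐ[k] k) (a : UU) (z : UU ⊗[k] ⋀[k]^0 g) :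
    augV ε (jn 0 (a • z)) = ε a * augV ε (jn 0 z) := by
  induction z using TensorProduct.induction_on with
  | zero => simp only [smul_zero, map_zero, mul_zero]
  | add x y hx hy => simp only [smul_add, map_add, hx, hy, mul_add]
  | tmul u w =>
    rw [smul_tmul', jn_tmul, jn_tmul, augV_tmul, augV_tmul, smul_eq_mul, map_mul, mul_assoc]

theorem augV_surj (ε : UU →ₐ[k] k) (c : k) : ∃ z : UU ⊗[k] ⋀[k]^0 g, augV ε (jn 0 z) = c := by
  refine ⟨c • ((1 : UU) ⊗ₜ[k] ⟨1, one_mem_pow⟩), ?_⟩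
  rw [map_smul, map_smul, jn_tmul, augV_one, map_one, smul_eq_mul, mul_one]

end CEK
end CEproof

section CEres
namespace CER

theorem lift_proj {A P B C : Type*} [Ring A] [AddCommGroup P] [Module A P] [AddCommGroup B] [Module A B]
    [AddCommGroup C] [Module A C] [Module.Projective A P] (h : P →ₗ[A] B) (q : C →ₗ[A] B)
    (hr : ∀ p, h p ∈ LinearMap.range q) : ∃ l : P →ₗ[A] C, ∀ p, q (l p) = h p := by
  obtain ⟨l, hl⟩ := Module.projective_lifting_property q.rangeRestrict
    (h.codRestrict (LinearMap.range q) hr) q.surjective_rangeRestrict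
  exact ⟨l, fun p => congrArg Subtype.val (LinearMap.congr_fun hl p)⟩

/-- building sequences by dependent choice -/
theorem dep_choice {T : ℕ → Type*} (pr : ∀ n, T n → Prop) (rel : ∀ n, T n → T (n + 1) → Prop)
    (t0 : T 0) (h0 : pr 0 t0)
    (hs : ∀ n t, pr n t → ∃ t', pr (n + 1) t' ∧ rel n t t') :
    ∃ s : ∀ n, T n, s 0 = t0 ∧ ∀ n, rel n (s n) (s (n + 1)) := by
  choose nx h1 h2 using hs
  let s : ∀ n, {t : T n // pr n t} := fun n =>
    Nat.rec ⟨t0, h0⟩ (fun n t => ⟨nx n t.1 t.2, h1 n t.1 t.2⟩) n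
  exact ⟨fun n => (s n).1, rfl, fun n => h2 n _ (s n).2⟩

section
variable {A X : Type*} {P Q : ℕ → Type*} [Ring A] [AddCommGroup X] [Module A X]
  [∀ n, AddCommGroup (P n)] [∀ n, Module A (P n)] [∀ n, Module.Projective A (P n)]
  [∀ n, AddCommGroup (Q n)] [∀ n, Module A (Q n)]
  (dP : ∀ n, P (n + 1) →ₗ[A] P n) (dQ : ∀ n, Q (n + 1) →ₗ[A] Q n)
  (eP : P 0 →ₗ[A] X) (eQ : Q 0 →ₗ[A] X)

theorem lift_exists (hP0 : ∀ p, eP (dP 0 p) = 0) (hP : ∀ n p, dP n (dP (n + 1) p) = 0)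
    (hQs : Function.Surjective eQ) (hQ0 : ∀ q, eQ q = 0 → q ∈ LinearMap.range (dQ 0))
    (hQ : ∀ n q, dQ n q = 0 → q ∈ LinearMap.range (dQ (n + 1))) :
    ∃ f : ∀ n, P n →ₗ[A] Q n, (∀ p, eQ (f 0 p) = eP p) ∧
      ∀ n p, dQ n (f (n + 1) p) = f n (dP n p) := by
  obtain ⟨f0, hf0⟩ := lift_proj eP eQ (fun p => hQs _)
  obtain ⟨f, h1, h2⟩ := dep_choice (T := fun n => P n →ₗ[A] Q n)
    (fun n f => ∀ p, f (dP n p) ∈ LinearMap.range (dQ n))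
    (fun n f f' => ∀ p, dQ n (f' p) = f (dP n p)) f0
    (fun p => hQ0 _ (by rw [hf0, hP0])) (by
      intro n f hf
      obtain ⟨f', hf'⟩ := lift_proj (f ∘ₗ dP n) (dQ n) hf
      refine ⟨f', fun p => hQ _ _ ?_, hf'⟩
      rw [hf', LinearMap.comp_apply, hP, map_zero])
  exact ⟨f, by rw [h1]; exact hf0, h2⟩

theorem htpy_exists (hP : ∀ n p, dP n (dP (n + 1) p) = 0)
    (hQ0 : ∀ q, eQ q = 0 → q ∈ LinearMap.range (dQ 0))
    (hQ : ∀ n q, dQ n q = 0 → q ∈ LinearMap.range (dQ (n + 1)))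
    (f : ∀ n, P n →ₗ[A] Q n) (hf0 : ∀ p, eQ (f 0 p) = 0)
    (hf : ∀ n p, dQ n (f (n + 1) p) = f n (dP n p)) :
    ∃ s : ∀ n, P n →ₗ[A] Q (n + 1), (∀ p, f 0 p = dQ 0 (s 0 p)) ∧
      ∀ n p, f (n + 1) p = dQ (n + 1) (s (n + 1) p) + s n (dP n p) := by
  obtain ⟨s0, hs0⟩ := lift_proj (f 0) (dQ 0) (fun p => hQ0 _ (hf0 p))
  obtain ⟨s, h1, h2⟩ := dep_choice (T := fun n => P n →ₗ[A] Q (n + 1))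
    (fun n s => ∀ p, dQ n (s (dP n p)) = f n (dP n p))
    (fun n s s' => ∀ p, f (n + 1) p = dQ (n + 1) (s' p) + s (dP n p)) s0
    (fun p => hs0 _) (by
      intro n s hs
      obtain ⟨s', hs'⟩ := lift_proj (f (n + 1) - s ∘ₗ dP n) (dQ (n + 1)) (by
        intro p
        apply hQ
        rw [LinearMap.sub_apply, map_sub, LinearMap.comp_apply, hs, hf, sub_self])
      refine ⟨s', fun p => ?_, fun p => ?_⟩
      · rw [hs', LinearMap.sub_apply, LinearMap.comp_apply, hP, map_zero, sub_zero]
      · rw [hs', LinearMap.sub_apply, LinearMap.comp_apply, sub_add_cancel])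
  exact ⟨s, by rw [h1]; exact fun p => (hs0 p).symm, h2⟩
end

section
variable {k A : Type*} {P Q : ℕ → Type*} [CommRing k] [Ring A] [Algebra k A]
  (M : Type*) [AddCommGroup M] [Module k M] [Module A M] [IsScalarTower k A M]
  [∀ n, AddCommGroup (P n)] [∀ n, Module A (P n)]
  [∀ n, AddCommGroup (Q n)] [∀ n, Module A (Q n)]
  (dP : ∀ n, P (n + 1) →ₗ[A] P n) (dQ : ∀ n, Q (n + 1) →ₗ[A] Q n)

theorem ker_map (f : ∀ n, P n →ₗ[A] Q n) (hf : ∀ n p, dQ n (f (n + 1) p) = f n (dP n p)) (n : ℕ) :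
    ∀ φ ∈ LinearMap.ker (precomp k M (dQ n)), precomp k M (f n) φ ∈ LinearMap.ker (precomp k M (dP n)) := by
  intro φ hφ
  rw [LinearMap.mem_ker] at hφ ⊢
  ext p
  change φ (f n (dP n p)) = 0
  rw [← hf]
  exact LinearMap.congr_fun hφ (f (n + 1) p)

/-- induced map on cocycles -/
noncomputable def kmap (f : ∀ n, P n →ₗ[A] Q n) (hf : ∀ n p, dQ n (f (n + 1) p) = f n (dP n p)) (n : ℕ) :
    LinearMap.ker (precomp k M (dQ n)) →ₗ[k] LinearMap.ker (precomp k M (dP n)) :=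
  (precomp k M (f n)).restrict (ker_map M dP dQ f hf n)

theorem kmap_apply (f : ∀ n, P n →ₗ[A] Q n) (hf : ∀ n p, dQ n (f (n + 1) p) = f n (dP n p)) (n : ℕ)
    (φ : LinearMap.ker (precomp k M (dQ n))) (p : P n) :
    (kmap M dP dQ f hf n φ).1 p = φ.1 (f n p) := rfl

/-- induced map on cohomology -/
noncomputable def hmap (f : ∀ n, P n →ₗ[A] Q n) (hf : ∀ n p, dQ n (f (n + 1) p) = f n (dP n p)) (n : ℕ) :
    (LinearMap.ker (precomp k M (dQ (n + 1))) ⧸ (LinearMap.range (precomp k M (dQ n))).comap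
      (LinearMap.ker (precomp k M (dQ (n + 1)))).subtype) →ₗ[k]
    (LinearMap.ker (precomp k M (dP (n + 1))) ⧸ (LinearMap.range (precomp k M (dP n))).comap
      (LinearMap.ker (precomp k M (dP (n + 1)))).subtype) :=
  Submodule.mapQ _ _ (kmap M dP dQ f hf (n + 1)) (by
    rintro ⟨φ, hφ⟩ ⟨ψ, hψ⟩
    refine ⟨precomp k M (f n) ψ, ?_⟩
    change precomp k M (dQ n) ψ = φ at hψ
    subst hψ
    ext p
    change ψ (f n (dP n p)) = ψ (dQ n (f (n + 1) p))
    rw [hf])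

theorem hmap_mk (f : ∀ n, P n →ₗ[A] Q n) (hf : ∀ n p, dQ n (f (n + 1) p) = f n (dP n p)) (n : ℕ) (φ) :
    hmap (k := k) M dP dQ f hf n (Submodule.Quotient.mk φ) =
      Submodule.Quotient.mk (kmap M dP dQ f hf (n + 1) φ) := rfl

theorem k_inv (f : ∀ n, P n →ₗ[A] Q n) (hf : ∀ n p, dQ n (f (n + 1) p) = f n (dP n p))
    (g : ∀ n, Q n →ₗ[A] P n) (hg : ∀ n p, dP n (g (n + 1) p) = g n (dQ n p))
    (s : P 0 →ₗ[A] P 1) (hs : ∀ p, g 0 (f 0 p) - p = dP 0 (s p))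
    (φ : LinearMap.ker (precomp k M (dP 0))) :
    kmap M dP dQ f hf 0 (kmap M dQ dP g hg 0 φ) = φ := by
  apply Subtype.ext
  ext p
  rw [kmap_apply, kmap_apply, ← sub_eq_zero, ← map_sub, hs]
  exact LinearMap.congr_fun φ.2 (s p)

theorem h_inv (f : ∀ n, P n →ₗ[A] Q n) (hf : ∀ n p, dQ n (f (n + 1) p) = f n (dP n p))
    (g : ∀ n, Q n →ₗ[A] P n) (hg : ∀ n p, dP n (g (n + 1) p) = g n (dQ n p)) (n : ℕ)
    (s : P (n + 1) →ₗ[A] P (n + 2)) (s' : P n →ₗ[A] P (n + 1))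
    (hs : ∀ p, g (n + 1) (f (n + 1) p) - p = dP (n + 1) (s p) + s' (dP n p)) (φ) :
    hmap (k := k) M dP dQ f hf n (hmap M dQ dP g hg n φ) = φ := by
  obtain ⟨φ, rfl⟩ := Submodule.Quotient.mk_surjective _ φ
  rw [hmap_mk, hmap_mk, Submodule.Quotient.eq]
  refine ⟨precomp k M s' φ.1, ?_⟩
  ext p
  change φ.1 (s' (dP n p)) = φ.1 (g (n + 1) (f (n + 1) p)) - φ.1 p
  rw [← map_sub, hs, map_add]
  have : φ.1 (dP (n + 1) (s p)) = 0 := LinearMap.congr_fun φ.2 (s p)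
  rw [this, zero_add]
end

theorem comparison {k A X : Type*} {P Q : ℕ → Type*} [CommRing k] [Ring A] [Algebra k A]
    (M : Type*) [AddCommGroup M] [Module k M] [Module A M] [IsScalarTower k A M]
    [AddCommGroup X] [Module A X]
    [∀ n, AddCommGroup (P n)] [∀ n, Module A (P n)] [∀ n, Module.Projective A (P n)]
    [∀ n, AddCommGroup (Q n)] [∀ n, Module A (Q n)] [∀ n, Module.Projective A (Q n)]
    (dP : ∀ n, P (n + 1) →ₗ[A] P n) (dQ : ∀ n, Q (n + 1) →ₗ[A] Q n)
    (eP : P 0 →ₗ[A] X) (eQ : Q 0 →ₗ[A] X)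
    (hPs : Function.Surjective eP) (hQs : Function.Surjective eQ)
    (hP0 : ∀ p, eP p = 0 ↔ p ∈ LinearMap.range (dP 0))
    (hQ0 : ∀ p, eQ p = 0 ↔ p ∈ LinearMap.range (dQ 0))
    (hP : ∀ n p, dP n p = 0 ↔ p ∈ LinearMap.range (dP (n + 1)))
    (hQ : ∀ n p, dQ n p = 0 ↔ p ∈ LinearMap.range (dQ (n + 1))) :
    Nonempty (LinearMap.ker (precomp k M (dP 0)) ≃ₗ[k] LinearMap.ker (precomp k M (dQ 0))) ∧
    ∀ n, Nonempty ((LinearMap.ker (precomp k M (dP (n + 1))) ⧸ (LinearMap.range (precomp k M (dP n))).comap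
      (LinearMap.ker (precomp k M (dP (n + 1)))).subtype) ≃ₗ[k]
      (LinearMap.ker (precomp k M (dQ (n + 1))) ⧸ (LinearMap.range (precomp k M (dQ n))).comap
      (LinearMap.ker (precomp k M (dQ (n + 1)))).subtype)) := by
  have hP0' : ∀ p, eP (dP 0 p) = 0 := fun p => (hP0 _).2 ⟨p, rfl⟩
  have hQ0' : ∀ p, eQ (dQ 0 p) = 0 := fun p => (hQ0 _).2 ⟨p, rfl⟩
  have hP' : ∀ n p, dP n (dP (n + 1) p) = 0 := fun n p => (hP n _).2 ⟨p, rfl⟩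
  have hQ' : ∀ n p, dQ n (dQ (n + 1) p) = 0 := fun n p => (hQ n _).2 ⟨p, rfl⟩
  obtain ⟨f, hf0, hf⟩ := lift_exists dP dQ eP eQ hP0' hP' hQs (fun p => (hQ0 p).1) (fun n p => (hQ n p).1)
  obtain ⟨g, hg0, hg⟩ := lift_exists dQ dP eQ eP hQ0' hQ' hPs (fun p => (hP0 p).1) (fun n p => (hP n p).1)
  obtain ⟨s, hs0, hs⟩ := htpy_exists dP dP eP hP' (fun p => (hP0 p).1) (fun n p => (hP n p).1)
    (fun n => g n ∘ₗ f n - LinearMap.id) (by intro p; simp [hg0, hf0]) (by intro n p; simp [hg, hf])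
  obtain ⟨t, ht0, ht⟩ := htpy_exists dQ dQ eQ hQ' (fun p => (hQ0 p).1) (fun n p => (hQ n p).1)
    (fun n => f n ∘ₗ g n - LinearMap.id) (by intro p; simp [hg0, hf0]) (by intro n p; simp [hg, hf])
  constructor
  · exact ⟨LinearEquiv.ofLinearMap (kmap M dQ dP g hg 0) (kmap M dP dQ f hf 0)
      (LinearMap.ext fun φ => k_inv M dQ dP g hg f hf (t 0) ht0 φ)
      (LinearMap.ext fun φ => k_inv M dP dQ f hf g hg (s 0) hs0 φ)⟩
  · intro n
    exact ⟨LinearEquiv.ofLinearMap (hmap M dQ dP g hg n) (hmap M dP dQ f hf n)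
      (LinearMap.ext fun φ => h_inv M dQ dP g hg f hf n (t (n + 1)) (t n) (ht n) φ)
      (LinearMap.ext fun φ => h_inv M dP dQ f hf g hg n (s (n + 1)) (s n) (hs n) φ)⟩

end CER
end CEres

theorem CE_cohomology_computes_Ext
    (k g : Type*) [Field k] [CharZero k] [LieRing g] [LieAlgebra k g]
    (M : Type*) [AddCommGroup M] [Module k M]
    [Module (UniversalEnvelopingAlgebra k g) M]
    [IsScalarTower k (UniversalEnvelopingAlgebra k g) M]
    -- the Koszul complex `V•(g)` and its differential
    (d : ∀ n : ℕ,
      (UniversalEnvelopingAlgebra k g ⊗[k] ⋀[k]^(n + 1) g) →ₗ[UniversalEnvelopingAlgebra k g]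
        (UniversalEnvelopingAlgebra k g ⊗[k] ⋀[k]^n g))
    (hd : ∀ (n : ℕ) (u : UniversalEnvelopingAlgebra k g) (v : Fin (n + 1) → g),
      d n (u ⊗ₜ[k] wedge k (n + 1) v) =
        (∑ i : Fin (n + 1),
            ((-1 : k) ^ (i : ℕ)) •
              ((u * UniversalEnvelopingAlgebra.ι k (v i)) ⊗ₜ[k] wedge k n (v ∘ i.succAbove))) +
          ∑ p : Fin (n + 1) × Fin (n + 1),
            if p.1 < p.2 then
              ((-1 : k) ^ ((p.1 : ℕ) + (p.2 : ℕ))) •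
                (u ⊗ₜ[k] wedge k n (consRemove2 ⁅v p.1, v p.2⁆ v p.1 p.2))
            else 0)
    -- an arbitrary projective resolution `P•` of the trivial left `U(g)`-module `k`
    (P : ℕ → Type*) [∀ n, AddCommGroup (P n)] [∀ n, Module k (P n)]
    [∀ n, Module (UniversalEnvelopingAlgebra k g) (P n)]
    [∀ n, IsScalarTower k (UniversalEnvelopingAlgebra k g) (P n)]
    [∀ n, Module.Projective (UniversalEnvelopingAlgebra k g) (P n)]
    (dP : ∀ n : ℕ, P (n + 1) →ₗ[UniversalEnvelopingAlgebra k g] P n)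
    (ε : UniversalEnvelopingAlgebra k g →ₐ[k] k)
    (hε : ∀ x : g, ε (UniversalEnvelopingAlgebra.ι k x) = 0)
    (eP : P 0 →ₗ[k] k)
    (hePlin : ∀ (a : UniversalEnvelopingAlgebra k g) (y : P 0), eP (a • y) = ε a * eP y)
    (hPsurj : Function.Surjective eP)
    (hPexact0 : LinearMap.range ((dP 0).restrictScalars k) = LinearMap.ker eP)
    (hPexact : ∀ n : ℕ, LinearMap.range (dP (n + 1)) = LinearMap.ker (dP n)) :
    -- `H⁰(Hom_{U(g)}(V•(g), M)) ≅ H⁰(Hom_{U(g)}(P•, M)) = Ext⁰_{U(g)}(k, M)`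
    Nonempty
      (↥(LinearMap.ker (precomp k (A := UniversalEnvelopingAlgebra k g)
          (N := UniversalEnvelopingAlgebra k g ⊗[k] ⋀[k]^0 g)
          (N' := UniversalEnvelopingAlgebra k g ⊗[k] ⋀[k]^1 g) M (d 0))) ≃ₗ[k] ↥(LinearMap.ker (precomp k (A := UniversalEnvelopingAlgebra k g) (N := P 0) (N' := P 1) M (dP 0)))) ∧
      -- `Hⁿ⁺¹(Hom_{U(g)}(V•(g), M)) ≅ Hⁿ⁺¹(Hom_{U(g)}(P•, M)) = Extⁿ⁺¹_{U(g)}(k, M)`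
      ∀ n : ℕ,
        Nonempty
          ((↥(LinearMap.ker (precomp k (A := UniversalEnvelopingAlgebra k g)
              (N := UniversalEnvelopingAlgebra k g ⊗[k] ⋀[k]^(n + 1) g)
              (N' := UniversalEnvelopingAlgebra k g ⊗[k] ⋀[k]^(n + 2) g) M (d (n + 1)))) ⧸
              (LinearMap.range (precomp k (A := UniversalEnvelopingAlgebra k g)
              (N := UniversalEnvelopingAlgebra k g ⊗[k] ⋀[k]^n g)
              (N' := UniversalEnvelopingAlgebra k g ⊗[k] ⋀[k]^(n + 1) g) M (d n))).comap
                (LinearMap.ker (precomp k (A := UniversalEnvelopingAlgebra k g)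
              (N := UniversalEnvelopingAlgebra k g ⊗[k] ⋀[k]^(n + 1) g)
              (N' := UniversalEnvelopingAlgebra k g ⊗[k] ⋀[k]^(n + 2) g) M (d (n + 1)))).subtype) ≃ₗ[k]
            (↥(LinearMap.ker (precomp k (A := UniversalEnvelopingAlgebra k g) (N := P (n + 1)) (N' := P (n + 2)) M (dP (n + 1)))) ⧸
              (LinearMap.range (precomp k (A := UniversalEnvelopingAlgebra k g) (N := P n) (N' := P (n + 1)) M (dP n))).comap
                (LinearMap.ker (precomp k (A := UniversalEnvelopingAlgebra k g) (N := P (n + 1)) (N' := P (n + 2)) M (dP (n + 1)))).subtype)) := by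
  let eV : (UniversalEnvelopingAlgebra k g ⊗[k] ⋀[k]^0 g) →ₗ[k] k := CEK.augV ε ∘ₗ CEK.jn 0
  let _ : Module (UniversalEnvelopingAlgebra k g) k := Module.compHom k (ε : UniversalEnvelopingAlgebra k g →+* k)
  have hsm : ∀ (a : UniversalEnvelopingAlgebra k g) (c : k), a • c = ε a * c := fun a c => rfl
  let eV' : (UniversalEnvelopingAlgebra k g ⊗[k] ⋀[k]^0 g) →ₗ[UniversalEnvelopingAlgebra k g] k :=
    { toFun := eV
      map_add' := map_add eV
      map_smul' := fun a y => CEK.augV_smul ε a y }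
  let eP' : P 0 →ₗ[UniversalEnvelopingAlgebra k g] k :=
    { toFun := eP
      map_add' := map_add eP
      map_smul' := fun a y => hePlin a y }
  exact CER.comparison (k := k) (A := UniversalEnvelopingAlgebra k g) (X := k)
    (P := fun n => UniversalEnvelopingAlgebra k g ⊗[k] ⋀[k]^n g) (Q := P) M d dP eV' eP'
    (CEK.augV_surj ε) hPsurj
    (fun p => CEK.dd_exact0 (dd := d) hd ε hε p)
    (fun p => by
      have h := SetLike.ext_iff.mp hPexact0 p
      exact h.symm)
    (fun n p => CEK.dd_exact (dd := d) hd n p)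
    (fun n p => by
      have h := SetLike.ext_iff.mp (hPexact n) p
      exact h.symm)
end
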